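/- arXiv:2108.11290 — 2 statements merged into one kernel-verified Lean document; each statement's English description precedes it below -/
import Mathlib

section
/- Let G be a topological multigraph on n ≥ 1 vertices in which any two distinct edges share at most one common interior point and no two parallel edges cross. Let o ∈ ℝ² be a point not lying on any edge and not a vertex of G, let k ≥ 0 be an integer, and let L° be the set of all lenses of G that contain o and contain fewer than 2^k vertices of G. Then |L°| ≤ 16·2^k·n. -/
open Set

/-- A topological multigraph: a finite vertex set `V ⊂ ℝ²` together with a finite family of
edges, each represented by a continuous injective arc `[0,1] → ℝ²` whose endpoints are two
distinct vertices and whose interior avoids all vertices. -/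
structure TopMultigraph where
  V : Finset (ℝ × ℝ)
  ι : Type
  fintype_ι : Fintype ι
  arc : ι → unitInterval → ℝ × ℝ
  continuous_arc : ∀ e, Continuous (arc e)
  injective_arc : ∀ e, Function.Injective (arc e)
  source_mem : ∀ e, arc e 0 ∈ V
  target_mem : ∀ e, arc e 1 ∈ V
  ends_ne : ∀ e, arc e 0 ≠ arc e 1
  interior_avoids : ∀ e (t : unitInterval), t ≠ 0 → t ≠ 1 → arc e t ∉ V

namespace TopMultigraph

variable (G : TopMultigraph)

instance : Fintype G.ι := G.fintype_ι

/-- The number of edges of `G`. -/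
noncomputable def edgeCount : ℕ := Nat.card G.ι

/-- The interior of an edge: the image of the open interval `(0,1)`. -/
def arcInterior (e : G.ι) : Set (ℝ × ℝ) :=
  G.arc e '' {t : unitInterval | t ≠ 0 ∧ t ≠ 1}

/-- The set of the two endpoints of an edge. -/
def endpoints (e : G.ι) : Set (ℝ × ℝ) := {G.arc e 0, G.arc e 1}

/-- Two distinct edges are parallel if they join the same pair of vertices. -/
def Parallel (e f : G.ι) : Prop := e ≠ f ∧ G.endpoints e = G.endpoints f

/-- Two edges are independent if they share no endpoint. -/
def Independent (e f : G.ι) : Prop := Disjoint (G.endpoints e) (G.endpoints f)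

/-- Two edges cross if their open arcs share a common point. -/
def Cross (e f : G.ι) : Prop := (G.arcInterior e ∩ G.arcInterior f).Nonempty

/-- `G` is single-crossing if any two distinct edges share at most one common interior point. -/
def SingleCrossing : Prop :=
  ∀ e f : G.ι, e ≠ f → (G.arcInterior e ∩ G.arcInterior f).Subsingleton

/-- An edge `e` joins `u` and `v` if its endpoint set is `{u, v}`. -/
def Joins (e : G.ι) (u v : ℝ × ℝ) : Prop := G.endpoints e = {u, v}

/-- The union of the images of all edges of `G` joining `u` and `v`. -/
def pairUnion (u v : ℝ × ℝ) : Set (ℝ × ℝ) :=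
  ⋃ e ∈ {e : G.ι | G.Joins e u v}, Set.range (G.arc e)

/-- `ℓ` is a lens of `G` at the pair `{u, v}`: `u ≠ v` are joined by at least one edge, no two
of the parallel edges joining them cross, and `ℓ` is a bounded connected component of the
complement of the union of the edges joining `u` and `v`. -/
def IsLensAt (u v : ℝ × ℝ) (ℓ : Set (ℝ × ℝ)) : Prop :=
  u ≠ v ∧ (∃ e, G.Joins e u v) ∧
  (∀ e f : G.ι, G.Joins e u v → G.Joins f u v → e ≠ f → ¬ G.Cross e f) ∧
  Bornology.IsBounded ℓ ∧
  ∃ x ∈ (G.pairUnion u v)ᶜ, ℓ = connectedComponentIn (G.pairUnion u v)ᶜ x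

/-- `ℓ` is a lens of `G`. -/
def IsLens (ℓ : Set (ℝ × ℝ)) : Prop := ∃ u v, G.IsLensAt u v ℓ

/-- `L(G)`: the set of all lenses of `G`. -/
def lenses : Set (Set (ℝ × ℝ)) := {ℓ | G.IsLens ℓ}

/-- No two parallel edges of `G` cross. -/
def ParallelNoncrossing : Prop := ∀ e f : G.ι, G.Parallel e f → ¬ G.Cross e f

/-- `G` is separated: no two parallel edges cross and every lens contains a vertex. -/
def Separated : Prop :=
  G.ParallelNoncrossing ∧ ∀ ℓ, G.IsLens ℓ → ∃ v ∈ G.V, v ∈ ℓ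

/-- The crossing number of `G`: the number of unordered pairs of distinct edges that cross. -/
noncomputable def crossingNumber : ℕ :=
  Nat.card {p : Sym2 G.ι // ¬ p.IsDiag ∧ ∀ e ∈ p, ∀ f ∈ p, e ≠ f → G.Cross e f}

/-- The degree of a vertex: the number of edges incident to it. -/
noncomputable def degree (v : ℝ × ℝ) : ℕ :=
  Nat.card {e : G.ι // v ∈ G.endpoints e}

end TopMultigraph

section PA
open Set Complex

namespace LensProof

abbrev II := unitInterval

theorem exists_log {A : Type*} [TopologicalSpace A] [SimplyConnectedSpace A]
    [LocallyPathConnectedSpace A] (f : A → ℂ) (hf : Continuous f) (h0 : ∀ a, f a ≠ 0) :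
    ∃ L : A → ℂ, Continuous L ∧ ∀ a, exp (L a) = f a := by
  obtain ⟨a0⟩ : Nonempty A := inferInstance
  rcases isCoveringMapOn_exp.existsUnique_continuousMap_lifts
    ⟨f, hf⟩ (a₀ := a0) (exp_log (h0 a0)) (fun x ↦ h0 x) with ⟨F, ⟨-, hF⟩, -⟩
  exact ⟨F, F.continuous, fun a => congrFun hF a⟩

theorem exists_log_I (f : II → ℂ) (hf : Continuous f) (h0 : ∀ a, f a ≠ 0) :
    ∃ L : II → ℂ, Continuous L ∧ ∀ a, exp (L a) = f a := by
  obtain ⟨L, hL, h⟩ := exists_log (fun x : ℝ => f (Set.projIcc 0 1 zero_le_one x))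
    (hf.comp continuous_projIcc) (fun a => h0 _)
  refine ⟨fun a => L a, by fun_prop, fun a => ?_⟩
  rw [h, Set.projIcc_val]

theorem exists_log_sq (f : II × II → ℂ) (hf : Continuous f) (h0 : ∀ a, f a ≠ 0) :
    ∃ L : II × II → ℂ, Continuous L ∧ ∀ a, exp (L a) = f a := by
  obtain ⟨L, hL, h⟩ := exists_log (fun x : ℝ × ℝ => f (Set.projIcc 0 1 zero_le_one x.1,
      Set.projIcc 0 1 zero_le_one x.2))
    (hf.comp ((continuous_projIcc.comp continuous_fst).prodMk
      (continuous_projIcc.comp continuous_snd))) (fun a => h0 _)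
  refine ⟨fun a => L (a.1, a.2), by fun_prop, fun a => ?_⟩
  rw [h]; simp only [Set.projIcc_val]

theorem log_unique {A : Type*} [TopologicalSpace A] [PreconnectedSpace A] {L M : A → ℂ}
    (hL : Continuous L) (hM : Continuous M) (h : ∀ a, exp (L a) = exp (M a)) (a b : A) :
    L a - L b = M a - M b := by
  have hc : Continuous (fun a => L a - M a) := hL.sub hM
  have hk : ∀ a, ∃ n : ℤ, L a - M a = n * (2 * Real.pi * I) := by
    intro a
    obtain ⟨n, hn⟩ := exp_eq_exp_iff_exists_int.1 (h a)
    exact ⟨n, by rw [hn]; ring⟩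
  choose n hn using hk
  have hnc : Continuous n := by
    have h1 : Continuous (fun a => ((n a : ℤ) : ℝ)) := by
      have : (fun a => ((n a : ℤ) : ℝ)) = fun a => (L a - M a).im / (2 * Real.pi) := by
        ext a
        rw [hn]
        have := Real.pi_pos.ne'
        simp
      rw [this]
      fun_prop
    exact Int.isClosedEmbedding_coe_real.isEmbedding.continuous_iff.2 h1
  have := PreconnectedSpace.constant ‹_› hnc (x := a) (y := b)
  have h1 := hn a
  have h2 := hn b
  rw [this] at h1
  linear_combination h1 - h2

open Classical in
/-- total change of the logarithm along a path -/
noncomputable def dl (f : II → ℂ) : ℂ :=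
  if h : ∃ L : II → ℂ, Continuous L ∧ ∀ a, exp (L a) = f a then h.choose 1 - h.choose 0 else 0

theorem dl_eq {f L : II → ℂ} (hL : Continuous L) (h : ∀ a, exp (L a) = f a) :
    dl f = L 1 - L 0 := by
  have hex : ∃ L : II → ℂ, Continuous L ∧ ∀ a, exp (L a) = f a := ⟨L, hL, h⟩
  rw [dl, dif_pos hex]
  exact log_unique hex.choose_spec.1 hL (fun a => by rw [hex.choose_spec.2, h]) _ _

theorem exp_dl {f : II → ℂ} (hf : Continuous f) (h0 : ∀ a, f a ≠ 0) :
    exp (dl f) = f 1 / f 0 := by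
  obtain ⟨L, hL, h⟩ := exists_log_I f hf h0
  rw [dl_eq hL h, exp_sub, h, h]

theorem dl_mul {f g : II → ℂ} (hf : Continuous f) (hf0 : ∀ a, f a ≠ 0)
    (hg : Continuous g) (hg0 : ∀ a, g a ≠ 0) :
    dl (fun a => f a * g a) = dl f + dl g := by
  obtain ⟨L, hL, h⟩ := exists_log_I f hf hf0
  obtain ⟨M, hM, h'⟩ := exists_log_I g hg hg0
  rw [dl_eq hL h, dl_eq hM h', dl_eq (hL.add hM) (fun a => by simp [exp_add, h, h'])]
  simp; ring

theorem dl_neg {f : II → ℂ} (hf : Continuous f) (hf0 : ∀ a, f a ≠ 0) :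
    dl (fun a => - f a) = dl f := by
  obtain ⟨L, hL, h⟩ := exists_log_I f hf hf0
  rw [dl_eq hL h, dl_eq (L := fun a => L a + Real.pi * I) (by fun_prop)
    (fun a => by simp [exp_add, h])]
  ring

theorem dl_sub_comm {f : II → ℂ} (hf : Continuous f) (c : ℂ) (hf0 : ∀ a, f a ≠ c) :
    dl (fun a => c - f a) = dl (fun a => f a - c) := by
  rw [← dl_neg (f := fun a => f a - c) (by fun_prop) (fun a => sub_ne_zero.2 (hf0 a))]
  simp

theorem dl_symm {f : II → ℂ} (hf : Continuous f) (hf0 : ∀ a, f a ≠ 0) :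
    dl (fun a => f (unitInterval.symm a)) = - dl f := by
  obtain ⟨L, hL, h⟩ := exists_log_I f hf hf0
  rw [dl_eq hL h, dl_eq (L := fun a => L (unitInterval.symm a)) (by fun_prop)
    (fun a => by simp [h])]
  simp

theorem dl_int {f : II → ℂ} (hf : Continuous f) (h0 : ∀ a, f a ≠ 0) (h : f 0 = f 1) :
    ∃ n : ℤ, dl f = n * (2 * Real.pi * I) := by
  have := exp_dl hf h0
  rw [h, div_self (h0 _)] at this
  exact Complex.exp_eq_one_iff.1 this

/-- homotopy square lemma -/
theorem square (F : II × II → ℂ) (hF : Continuous F) (h0 : ∀ a, F a ≠ 0) :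
    dl (fun s => F (s, 0)) + dl (fun t => F (1, t)) =
      dl (fun s => F (s, 1)) + dl (fun t => F (0, t)) := by
  obtain ⟨L, hL, h⟩ := exists_log_sq F hF h0
  rw [dl_eq (L := fun s => L (s, 0)) (by fun_prop) (fun a => h _),
    dl_eq (L := fun s => L (1, s)) (by fun_prop) (fun a => h _),
    dl_eq (L := fun s => L (s, 1)) (by fun_prop) (fun a => h _),
    dl_eq (L := fun s => L (0, s)) (by fun_prop) (fun a => h _)]
  ring

/-- intersection index (times `2πi`) of two paths -/
noncomputable def ix (γ δ : II → ℂ) : ℂ :=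
  dl (fun s => γ s - δ 0) - dl (fun s => γ s - δ 1) + dl (fun t => δ t - γ 1)
    - dl (fun t => δ t - γ 0)

theorem ix_disjoint {γ δ : II → ℂ} (hγ : Continuous γ) (hδ : Continuous δ)
    (h : ∀ s t, γ s ≠ δ t) : ix γ δ = 0 := by
  have := square (fun x => γ x.1 - δ x.2) (by fun_prop) (fun a => sub_ne_zero.2 (h _ _))
  simp only at this
  rw [dl_sub_comm hδ (γ 1) (fun a => (h _ _).symm), dl_sub_comm hδ (γ 0) (fun a => (h _ _).symm)]
    at this
  rw [ix]
  linear_combination this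

theorem two_pi_I_ne : (2 * Real.pi * I : ℂ) ≠ 0 := Complex.two_pi_I_ne_zero

/-- A nonzero winding number of a simple closed curve is odd. Here the closed curve is given by
its logarithm. -/
theorem winding_odd {L : II → ℂ} (hL : Continuous L) (s : ℤ) (hs : s ≠ 0)
    (h1 : L 1 = L 0 + s * (2 * Real.pi * I))
    (hinj : ∀ a b : II, exp (L a) = exp (L b) → a = b ∨ (a = 0 ∧ b = 1) ∨ (a = 1 ∧ b = 0)) :
    Odd s := by
  by_contra hodd
  rw [Int.not_odd_iff_even] at hodd
  have hs' : (s : ℂ) ≠ 0 := by exact_mod_cast hs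
  set D : II → ℂ := fun a => exp (L a / s) with hD
  have hDc : Continuous D := by fun_prop
  have hD01 : D 1 = D 0 := by
    simp only [hD, h1]
    rw [add_div, exp_add, mul_div_cancel_left₀ _ hs', Complex.exp_two_pi_mul_I, mul_one]
  have hDs : ∀ a, D a ^ s = exp (L a) := by
    intro a
    simp only [hD]
    rw [← exp_int_mul, mul_div_cancel₀ _ hs']
  have hne : ∀ a b, D a + D b ≠ 0 := by
    intro a b h
    have h2 : D a = - D b := by linear_combination h
    have h3 : exp (L a) = exp (L b) := by
      rw [← hDs, ← hDs, h2, hodd.neg_zpow]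
    have h4 : D a = D b := by
      rcases hinj a b h3 with h | ⟨rfl, rfl⟩ | ⟨rfl, rfl⟩
      · rw [h]
      · exact hD01.symm
      · exact hD01
    have h5 : D b ≠ 0 := exp_ne_zero _
    rw [h4] at h
    apply h5
    linear_combination h / 2
  obtain ⟨M, hM, hMe⟩ := exists_log_sq (fun x : II × II => D x.1 + D x.2) (by fun_prop)
    (fun x => hne _ _)
  have e1 := dl_eq (f := fun a => D a + D 0) (L := fun a => M (a, 0)) (by fun_prop)
    (fun a => hMe _)
  have e2 := dl_eq (f := fun a => D a + D 0) (L := fun a => M (1, a)) (by fun_prop)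
    (fun a => by rw [hMe, hD01, add_comm])
  have e3 := dl_eq (f := fun a => D a + D a) (L := fun a => M (a, a)) (by fun_prop)
    (fun a => hMe _)
  have e4 := dl_eq (f := fun a => D a + D a) (L := fun a => L a / s + log 2) (by fun_prop)
    (fun a => by rw [exp_add, exp_log two_ne_zero]; simp [hD]; ring)
  obtain ⟨n, hn⟩ := dl_int (f := fun a => D a + D 0) (by fun_prop) (fun a => hne _ _)
    (by rw [hD01])
  have e5 : L 1 / s - L 0 / s = 2 * Real.pi * I := by
    rw [h1, add_div, mul_div_cancel_left₀ _ hs']; ring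
  have : (2 * n : ℂ) * (2 * Real.pi * I) = 1 * (2 * Real.pi * I) := by
    linear_combination e1 + e2 - e3 + e4 + e5 - 2 * hn
  have h6 := mul_right_cancel₀ two_pi_I_ne this
  have h7 : 2 * n = 1 := by exact_mod_cast h6
  omega

/-- Eilenberg type criterion. -/
theorem eilenberg {K U : Set ℂ} (hK : IsClosed K) (hU : IsOpen U) (hUb : Bornology.IsBounded U)
    (hfr : frontier U ⊆ K) {p q : ℂ} (hp : p ∈ U) (hq : q ∉ U) (hqK : q ∉ K) (hpK : p ∉ K)
    (n m : ℤ)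
    (L : K → ℂ) (hL : Continuous L) (hLe : ∀ z : K, exp (L z) = (z - p) ^ n * (z - q) ^ m) :
    n = 0 := by
  classical
  obtain ⟨G, hG⟩ := ContinuousMap.exists_restrict_eq hK ⟨L, hL⟩
  have hGe : ∀ z ∈ K, exp (G z) = (z - p) ^ n * (z - q) ^ m := by
    intro z hz
    rw [← hLe ⟨z, hz⟩]
    congr 1
    exact congrArg (fun f => f ⟨z, hz⟩) hG
  set M : ℂ → ℂ := fun z => if z ∈ U then (z - q) ^ m * exp (- G z) else (z - p) ^ (-n) with hMdef
  have hqc : q ∉ closure U := by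
    intro h
    exact hqK (hfr ⟨h, by rwa [hU.interior_eq]⟩)
  have hMc : Continuous M := by
    apply continuous_if
    · intro z hz
      have hzK := hfr hz
      have hzp : z - p ≠ 0 := sub_ne_zero.2 (fun h => hpK (h ▸ hzK))
      have hzq : z - q ≠ 0 := sub_ne_zero.2 (fun h => hqK (h ▸ hzK))
      rw [exp_neg, hGe z hzK, zpow_neg]
      have := zpow_ne_zero n hzp
      have := zpow_ne_zero m hzq
      field_simp
    · apply ContinuousOn.mul
      · apply ContinuousOn.zpow₀ (by fun_prop)
        intro z hz
        left
        exact sub_ne_zero.2 (fun h => hqc (h ▸ hz))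
      · exact (by fun_prop : Continuous fun z => exp (- G z)).continuousOn
    · apply ContinuousOn.zpow₀ (by fun_prop)
      intro z hz
      left
      have : {a | a ∉ U} = Uᶜ := rfl
      rw [this, hU.isClosed_compl.closure_eq] at hz
      exact sub_ne_zero.2 (fun h => hz (h ▸ hp))
  have hM0 : ∀ z, M z ≠ 0 := by
    intro z
    simp only [hMdef]
    split_ifs with hz
    · exact mul_ne_zero (zpow_ne_zero _ (sub_ne_zero.2 (fun h => hq (h ▸ hz)))) (exp_ne_zero _)
    · exact zpow_ne_zero _ (sub_ne_zero.2 (fun h => hz (h ▸ hp)))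
  obtain ⟨N, hN, hNe⟩ := exists_log M hMc hM0
  obtain ⟨R, hR⟩ := hUb.subset_closedBall p
  set r : ℝ := max R 0 + 1 with hr
  have hr0 : 0 < r := by positivity
  have hrR : R < r := by have := le_max_left R 0; linarith
  set c : II → ℂ := fun t => p + r * exp (2 * Real.pi * I * (t : ℝ)) with hc
  have hcc : Continuous c := by fun_prop
  have hcU : ∀ t, c t ∉ U := by
    intro t ht
    have := hR ht
    rw [Metric.mem_closedBall, dist_eq_norm] at this
    simp only [hc, add_sub_cancel_left, norm_mul] at this
    have h2 : ‖exp (2 * Real.pi * I * ((t : ℝ) : ℂ))‖ = 1 := by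
      have : (2 * Real.pi * I * ((t : ℝ) : ℂ) : ℂ) = ((2 * Real.pi * t : ℝ) : ℂ) * I := by
        push_cast; ring
      rw [this, norm_exp_ofReal_mul_I]
    rw [h2] at this
    simp [abs_of_pos hr0] at this
    linarith
  have hMc' : ∀ t, M (c t) = exp (-n * (Real.log r + 2 * Real.pi * I * (t : ℝ))) := by
    intro t
    simp only [hMdef, if_neg (hcU t)]
    have : c t - p = exp (Real.log r + 2 * Real.pi * I * (t : ℝ)) := by
      rw [exp_add, ← ofReal_exp, Real.exp_log hr0]
      simp [hc]
    rw [this, ← exp_int_mul]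
    push_cast; rfl
  have e := log_unique (L := fun t => N (c t))
    (M := fun t : II => -n * (Real.log r + 2 * Real.pi * I * (t : ℝ)))
    (by fun_prop) (by fun_prop) (fun t => by rw [hNe, hMc']) 1 0
  have hc01 : c 1 = c 0 := by simp [hc]
  rw [hc01] at e
  simp at e
  have : (n : ℂ) * (2 * Real.pi * I) = 0 := by linear_combination e
  rcases mul_eq_zero.1 this with h | h
  · exact_mod_cast h
  · exact absurd h two_pi_I_ne

theorem frontier_component {X : Type*} [TopologicalSpace X] [LocallyConnectedSpace X] {K : Set X}
    (hK : IsClosed K) (x : X) : frontier (connectedComponentIn Kᶜ x) ⊆ K := by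
  intro z hz
  by_contra hzK
  have hV : IsOpen (connectedComponentIn Kᶜ z) := hK.isOpen_compl.connectedComponentIn
  have hzV : z ∈ connectedComponentIn Kᶜ z := mem_connectedComponentIn hzK
  obtain ⟨y, hyV, hyU⟩ := mem_closure_iff.1 hz.1 _ hV hzV
  have h1 := connectedComponentIn_eq hyV
  have h2 := connectedComponentIn_eq hyU
  have hU : IsOpen (connectedComponentIn Kᶜ x) := hK.isOpen_compl.connectedComponentIn
  apply hz.2
  rw [hU.interior_eq, h2, ← h1]
  exact hzV

end LensProof
end PA

section PB
open Set Complex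

namespace LensProof

/-- A family of arcs from `u` to `v`, pairwise meeting only at the ends. -/
structure Fam {ι : Type} (a : ι → II → ℂ) (u v : ℂ) : Prop where
  cont : ∀ i, Continuous (a i)
  zero : ∀ i, a i 0 = u
  one : ∀ i, a i 1 = v
  meet : ∀ i j s t, a i s = a j t → (i = j ∧ s = t) ∨ (s = 0 ∧ t = 0) ∨ (s = 1 ∧ t = 1)

def KK {ι : Type} (a : ι → II → ℂ) : Set ℂ := ⋃ i, range (a i)

noncomputable def ww {ι : Type} (a : ι → II → ℂ) (i j : ι) (w : ℂ) : ℂ :=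
  dl (fun s => a i s - w) - dl (fun s => a j s - w)

theorem exists_log_from (f : II → ℂ) (hf : Continuous f) (h0 : ∀ a, f a ≠ 0) (l : ℂ)
    (hl : exp l = f 0) :
    ∃ L : II → ℂ, Continuous L ∧ (∀ a, exp (L a) = f a) ∧ L 0 = l ∧ L 1 = l + dl f := by
  obtain ⟨L, hL, h⟩ := exists_log_I f hf h0
  have e : exp (l - L 0) = 1 := by rw [exp_sub, hl, h, div_self (h0 0)]
  refine ⟨fun a => L a + (l - L 0), by fun_prop, fun a => by rw [exp_add, e, h, mul_one], by simp, ?_⟩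
  rw [dl_eq hL h]; ring

section
variable {ι : Type} {a : ι → II → ℂ} {u v : ℂ}

theorem mem_KK (i : ι) (s : II) : a i s ∈ KK a := mem_iUnion.2 ⟨i, s, rfl⟩

theorem ne_of_notMem {w : ℂ} (hw : w ∉ KK a) (i : ι) (s : II) : a i s ≠ w :=
  fun h => hw (h ▸ mem_KK i s)

theorem sub_ne {w : ℂ} (hw : w ∉ KK a) (i : ι) (s : II) : a i s - w ≠ 0 :=
  sub_ne_zero.2 (ne_of_notMem hw i s)

theorem Fam.comp (h : Fam a u v) {κ : Type} (g : κ → ι) (hg : Function.Injective g) :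
    Fam (fun k => a (g k)) u v :=
  ⟨fun i => h.cont _, fun i => h.zero _, fun i => h.one _, fun i j s t hst => by
    rcases h.meet _ _ _ _ hst with ⟨h1, h2⟩ | h1
    · exact Or.inl ⟨hg h1, h2⟩
    · exact Or.inr h1⟩

theorem Fam.isCompact [Finite ι] (h : Fam a u v) : IsCompact (KK a) :=
  isCompact_iUnion fun i => isCompact_range (h.cont i)

theorem Fam.glue [Finite ι] (h : Fam a u v) {p q : ℂ} (hp : p ∉ KK a) (hq : q ∉ KK a) (n m : ℤ)
    (c : ℂ) (hc : ∀ i, n * dl (fun s => a i s - p) + m * dl (fun s => a i s - q) = c) :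
    ∃ L : KK a → ℂ, Continuous L ∧ ∀ z : KK a, exp (L z) = (z - p) ^ n * (z - q) ^ m := by
  rcases isEmpty_or_nonempty ι with hι | ⟨⟨i0⟩⟩
  · refine ⟨fun _ => 0, by fun_prop, fun z => ?_⟩
    obtain ⟨i, -⟩ := mem_iUnion.1 z.2
    exact hι.elim i
  have hup : u - p ≠ 0 := by have := sub_ne hp i0 0; rwa [h.zero] at this
  have huq : u - q ≠ 0 := by have := sub_ne hq i0 0; rwa [h.zero] at this
  have hP : ∀ i, ∃ L : II → ℂ, Continuous L ∧ (∀ s, exp (L s) = a i s - p) ∧ L 0 = log (u - p) ∧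
      L 1 = log (u - p) + dl (fun s => a i s - p) := fun i =>
    exists_log_from _ (by have := h.cont i; fun_prop) (sub_ne hp i) _ (by rw [exp_log hup, h.zero])
  have hQ : ∀ i, ∃ L : II → ℂ, Continuous L ∧ (∀ s, exp (L s) = a i s - q) ∧ L 0 = log (u - q) ∧
      L 1 = log (u - q) + dl (fun s => a i s - q) := fun i =>
    exists_log_from _ (by have := h.cont i; fun_prop) (sub_ne hq i) _ (by rw [exp_log huq, h.zero])
  choose P hPc hPe hP0 hP1 using hP
  choose Q hQc hQe hQ0 hQ1 using hQ
  let π : C((Σ _ : ι, II), KK a) := ⟨fun x => ⟨a x.1 x.2, mem_KK _ _⟩, by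
    apply Continuous.subtype_mk
    rw [continuous_sigma_iff]
    exact fun i => h.cont i⟩
  have hπs : Function.Surjective π := by
    rintro ⟨z, hz⟩
    obtain ⟨i, s, rfl⟩ := mem_iUnion.1 hz
    exact ⟨⟨i, s⟩, rfl⟩
  have hπq : Topology.IsQuotientMap π := .of_surjective_continuous hπs π.continuous
  let g : C((Σ _ : ι, II), ℂ) := ⟨fun x => n * P x.1 x.2 + m * Q x.1 x.2, by
    rw [continuous_sigma_iff]
    intro i
    have := hPc i
    have := hQc i
    simp only
    fun_prop⟩
  have hg : ∀ x y, π x = π y → g x = g y := by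
    rintro ⟨i, s⟩ ⟨j, t⟩ hxy
    have hxy : a i s = a j t := congrArg Subtype.val hxy
    change n * P i s + m * Q i s = n * P j t + m * Q j t
    rcases h.meet _ _ _ _ hxy with ⟨rfl, rfl⟩ | ⟨rfl, rfl⟩ | ⟨rfl, rfl⟩
    · rfl
    · rw [hP0, hP0, hQ0, hQ0]
    · rw [hP1, hP1, hQ1, hQ1]
      linear_combination hc i - hc j
  refine ⟨hπq.lift g hg, (hπq.lift g hg).continuous, fun z => ?_⟩
  obtain ⟨⟨i, s⟩, rfl⟩ := hπs z
  have : hπq.lift g hg (π ⟨i, s⟩) = g ⟨i, s⟩ := by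
    have := hπq.lift_comp g hg
    exact congrArg (fun f => f ⟨i, s⟩) this
  rw [this]
  change exp (n * P i s + m * Q i s) = (a i s - p) ^ n * (a i s - q) ^ m
  rw [exp_add, exp_int_mul, exp_int_mul, hPe, hQe]

theorem Fam.exists_ne [Finite ι] (h : Fam a u v) {o w : ℂ} (ho : o ∉ KK a) (hw : w ∉ KK a)
    (hb : Bornology.IsBounded (connectedComponentIn (KK a)ᶜ o))
    (hwo : w ∉ connectedComponentIn (KK a)ᶜ o) (n m : ℤ) (hn : n ≠ 0) :
    ∃ i j, n * ww a i j o + m * ww a i j w ≠ 0 := by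
  by_contra! hall
  rcases isEmpty_or_nonempty ι with hι | ⟨⟨i0⟩⟩
  · have : KK a = ∅ := by simp [KK]
    rw [this, compl_empty, connectedComponentIn_univ] at hwo
    exact hwo (by rw [PreconnectedSpace.connectedComponent_eq_univ]; trivial)
  obtain ⟨L, hL, hLe⟩ := h.glue ho hw n m (n * dl (fun s => a i0 s - o) + m * dl (fun s => a i0 s - w))
    (fun i => by have := hall i i0; simp only [ww] at this; linear_combination this)
  exact hn (eilenberg h.isCompact.isClosed h.isCompact.isClosed.isOpen_compl.connectedComponentIn
    hb (frontier_component h.isCompact.isClosed _) (mem_connectedComponentIn ho) hwo hw ho n m L hL hLe)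

theorem Fam.ww_const [Finite ι] (h : Fam a u v) {p q : ℂ} (hp : p ∉ KK a)
    (hq : q ∈ connectedComponentIn (KK a)ᶜ p) (i j : ι) : ww a i j p = ww a i j q := by
  have hC : IsConnected (connectedComponentIn (KK a)ᶜ p) :=
    isConnected_connectedComponentIn_iff.2 hp
  have hO : IsOpen (connectedComponentIn (KK a)ᶜ p) :=
    h.isCompact.isClosed.isOpen_compl.connectedComponentIn
  have hPC := (hO.isConnected_iff_isPathConnected).1 hC
  obtain ⟨γ, hγ⟩ := hPC.joinedIn p (mem_connectedComponentIn hp) q hq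
  have hγ' : ∀ t, γ t ∉ KK a := fun t => connectedComponentIn_subset _ _ (hγ t)
  have key : ∀ i, dl (fun s => a i s - p) + dl (fun t => v - γ t) =
      dl (fun s => a i s - q) + dl (fun t => u - γ t) := by
    intro i
    have := h.cont i
    have := square (fun x => a i x.1 - γ x.2) (by fun_prop) (fun x => sub_ne (hγ' _) _ _)
    simpa [h.zero, h.one] using this
  simp only [ww]
  linear_combination key i - key j

theorem Fam.ww_far (h : Fam a u v) {R : ℝ} {w : ℂ} (hR : ∀ i s, ‖a i s‖ ≤ R) (hw : R < ‖w‖)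
    (i j : ι) : ww a i j w = 0 := by
  have hw0 : w ≠ 0 := by
    rintro rfl
    have := hR i 0
    have := norm_nonneg (a i 0)
    simp at hw; linarith
  have hs : ∀ i s, 1 - a i s / w ∈ slitPlane := by
    intro i s
    left
    have h1 : ‖a i s / w‖ < 1 := by
      rw [norm_div, div_lt_one (by positivity)]
      exact (hR i s).trans_lt hw
    have := (re_le_norm (a i s / w)).trans_lt h1
    simp only [sub_re, one_re]
    linarith
  have key : ∀ i, dl (fun s => a i s - w) = log (1 - v / w) - log (1 - u / w) := by
    intro i
    have hci := h.cont i
    rw [dl_eq (L := fun s => log (1 - a i s / w) + log (-w))]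
    · simp [h.zero, h.one]
    · apply Continuous.add _ continuous_const
      exact Continuous.clog (by fun_prop) (hs i)
    · intro s
      rw [exp_add, exp_log (slitPlane_ne_zero (hs i s)), exp_log (neg_ne_zero.2 hw0)]
      field_simp
      ring
  simp [ww, key]

theorem Fam.bounded [Finite ι] (h : Fam a u v) {p : ℂ} (hp : p ∉ KK a) {i j : ι}
    (hne : ww a i j p ≠ 0) : Bornology.IsBounded (connectedComponentIn (KK a)ᶜ p) := by
  obtain ⟨R, hR⟩ := h.isCompact.isBounded.subset_closedBall 0
  rw [isBounded_iff_forall_norm_le]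
  refine ⟨R, fun y hy => ?_⟩
  by_contra! hlt
  apply hne
  rw [h.ww_const hp hy]
  exact h.ww_far (fun i s => by simpa using hR (mem_KK i s)) hlt i j

theorem Fam.int (h : Fam a u v) {p : ℂ} (hp : p ∉ KK a) (i j : ι) :
    ∃ n : ℤ, ww a i j p = n * (2 * Real.pi * I) := by
  have h1 := h.cont i
  have h2 := h.cont j
  apply Complex.exp_eq_one_iff.1
  rw [ww, exp_sub, exp_dl (by fun_prop) (sub_ne hp i), exp_dl (by fun_prop) (sub_ne hp j)]
  rw [h.zero, h.zero, h.one, h.one, div_self]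
  have e1 := sub_ne hp i 0
  have e2 := sub_ne hp i 1
  rw [h.zero] at e1
  rw [h.one] at e2
  exact div_ne_zero e2 e1

theorem Fam.jordan (h : Fam a u v) {p q : ℂ} (hp : p ∉ KK a) (hq : q ∉ KK a) {i j : ι}
    (hpn : ww a i j p ≠ 0) (hqn : ww a i j q ≠ 0) : ww a i j p = ww a i j q := by
  have hij : i ≠ j := by rintro rfl; simp [ww] at hpn
  let g : Bool → ι := fun b => if b then i else j
  have hg : Function.Injective g := by
    intro b c; cases b <;> cases c <;> simp [g, hij, hij.symm]
  have h' := h.comp g hg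
  set a' : Bool → II → ℂ := fun k => a (g k)
  have hsub : KK a' ⊆ KK a := by
    intro z hz
    obtain ⟨k, s, rfl⟩ := mem_iUnion.1 hz
    exact mem_KK _ _
  have hp' : p ∉ KK a' := fun hh => hp (hsub hh)
  have hq' : q ∉ KK a' := fun hh => hq (hsub hh)
  have hw : ∀ w, ww a' true false w = ww a i j w := fun w => rfl
  by_cases hqp : q ∈ connectedComponentIn (KK a')ᶜ p
  · rw [← hw, ← hw]; exact h'.ww_const hp' hqp _ _
  · exfalso
    obtain ⟨m', hm⟩ := h.int hp i j
    obtain ⟨n', hn⟩ := h.int hq i j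
    have hn0 : n' ≠ 0 := by rintro rfl; simp [hn] at hqn
    obtain ⟨x, y, hxy⟩ := h'.exists_ne hp' hq' (h'.bounded hp' (i := true) (j := false) hpn) hqp
      n' (-m') hn0
    apply hxy
    have hneg : ∀ w, ww a' false true w = - ww a i j w := fun w => by
      rw [← hw]; simp [ww]
    cases x <;> cases y
    · simp [ww]
    · rw [hneg, hneg, hm, hn]; push_cast; ring
    · rw [hw, hw, hm, hn]; push_cast; ring
    · simp [ww]

theorem ww_add (i j k : ι) (w : ℂ) : ww a i j w + ww a j k w = ww a i k w := by
  simp [ww]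

theorem Fam.select [Finite ι] (h : Fam a u v) {o : ℂ} (ho : o ∉ KK a)
    (hb : Bornology.IsBounded (connectedComponentIn (KK a)ᶜ o)) (T : Finset ℂ)
    (hT : ∀ w ∈ T, w ∉ KK a) :
    ∃ i j, ww a i j o ≠ 0 ∧ ∀ w ∈ T, w ∉ connectedComponentIn (KK a)ᶜ o → ww a i j w = 0 := by
  classical
  have hne : ∃ i j, ww a i j o ≠ 0 := by
    have hbb : Bornology.IsBounded (connectedComponentIn (KK a)ᶜ o ∪ KK a) :=
      hb.union h.isCompact.isBounded
    obtain ⟨q, hq⟩ : ∃ q, q ∉ connectedComponentIn (KK a)ᶜ o ∪ KK a := by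
      by_contra! hall
      exact NormedSpace.unbounded_univ ℂ ℂ (hbb.subset fun x _ => hall x)
    rw [mem_union, not_or] at hq
    obtain ⟨i, j, hij⟩ := h.exists_ne ho hq.2 hb hq.1 1 0 one_ne_zero
    exact ⟨i, j, by simpa using hij⟩
  obtain ⟨i1, j1, h1⟩ := hne
  let c : ι × ι → ℕ := fun x => (T.filter fun w => ww a x.1 x.2 w ≠ 0).card
  obtain ⟨⟨i, j⟩, hij, hmin⟩ := Set.exists_min_image {x : ι × ι | ww a x.1 x.2 o ≠ 0} c
    (Set.toFinite _) ⟨(i1, j1), h1⟩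
  refine ⟨i, j, hij, fun w hw hwo => ?_⟩
  by_contra hwn
  have hwK := hT w hw
  have hS := h.jordan ho hwK hij hwn
  have hd : ∃ k, ww a i k o ≠ ww a i k w := by
    obtain ⟨x, y, hxy⟩ := h.exists_ne ho hwK hb hwo 1 (-1) one_ne_zero
    by_contra! hall
    apply hxy
    have e1 := ww_add (a := a) i x y o
    have e2 := ww_add (a := a) i x y w
    push_cast
    linear_combination e1 - e2 + hall y - hall x
  obtain ⟨k, hk⟩ := hd
  have ko := ww_add (a := a) i k j o
  have kw := ww_add (a := a) i k j w
  have hlt : ∀ x y : ι, ww a x y o ≠ 0 → ww a x y w = 0 →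
      (∀ z ∈ T, ww a i j z = 0 → ww a x y z = 0) → False := by
    intro x y h1 h2 h3
    have h4 := hmin (x, y) h1
    apply absurd h4
    rw [not_le]
    apply Finset.card_lt_card
    rw [Finset.ssubset_iff_of_subset]
    · exact ⟨w, by simp [hw, hwn], by simp [h2]⟩
    · intro z hz
      rw [Finset.mem_filter] at hz ⊢
      exact ⟨hz.1, fun h5 => hz.2 (h3 z hz.1 h5)⟩
  by_cases hz : ww a i k o = 0
  · have h3 : ww a k j o ≠ 0 := by rw [hz, zero_add] at ko; rwa [ko]
    have h2 : ww a i k w ≠ 0 := by rw [hz] at hk; exact hk.symm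
    have h4 : ww a k j w = 0 := by
      by_contra h5
      have := h.jordan ho hwK h3 h5
      apply hk; linear_combination ko - kw + hS - this
    refine hlt k j h3 h4 fun z hzT hz0 => ?_
    by_contra h5
    have e1 := h.jordan ho (hT z hzT) h3 h5
    have kz := ww_add (a := a) i k j z
    have h6 : ww a i k z ≠ 0 := by
      intro h7; apply h5; linear_combination kz + hz0 - h7
    have e2 := h.jordan hwK (hT z hzT) h2 h6
    apply hij
    linear_combination (1/2 : ℂ) * (-ko + hz + e1 + hS - kw + h4 + e2 + kz + hz0)
  · have h2 : ww a i k w = 0 := by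
      by_contra h5
      exact hk (h.jordan ho hwK hz h5)
    have h3 : ww a k j w ≠ 0 := by rw [h2, zero_add] at kw; rwa [kw]
    have h4 : ww a k j o = 0 := by
      by_contra h5
      have := h.jordan ho hwK h5 h3
      apply hk; linear_combination ko - kw + hS - this
    refine hlt i k hz h2 fun z hzT hz0 => ?_
    by_contra h5
    have e1 := h.jordan ho (hT z hzT) hz h5
    have kz := ww_add (a := a) i k j z
    have h6 : ww a k j z ≠ 0 := by
      intro h7; apply h5; linear_combination kz + hz0 - h7
    have e2 := h.jordan hwK (hT z hzT) h3 h6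
    apply hij
    linear_combination (1/2 : ℂ) * (-ko + h4 + e1 + hS - kw + h2 + e2 + kz + hz0)

theorem Fam.odd (h : Fam a u v) {o : ℂ} (ho : o ∉ KK a) {i j : ι} (hne : ww a i j o ≠ 0) :
    ∃ s : ℤ, Odd s ∧ ww a i j o = s * (2 * Real.pi * I) := by
  obtain ⟨s, hs⟩ := h.int ho i j
  refine ⟨s, ?_, hs⟩
  have hij : i ≠ j := by rintro rfl; simp [ww] at hne
  have hs0 : s ≠ 0 := by rintro rfl; simp [hs] at hne
  have huo : u - o ≠ 0 := by have := sub_ne ho i 0; rwa [h.zero] at this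
  obtain ⟨P, hPc, hPe, hP0, hP1⟩ := exists_log_from (fun s => a i s - o)
    (by have := h.cont i; fun_prop) (sub_ne ho i) (log (u - o)) (by rw [exp_log huo, h.zero])
  obtain ⟨Q, hQc, hQe, hQ0, hQ1⟩ := exists_log_from (fun s => a j s - o)
    (by have := h.cont j; fun_prop) (sub_ne ho j) (log (u - o)) (by rw [exp_log huo, h.zero])
  have hexp : exp (ww a i j o) = 1 := Complex.exp_eq_one_iff.2 ⟨s, hs⟩
  let p1 : Path (P 0) (P 1) := ⟨⟨P, hPc⟩, rfl, rfl⟩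
  let p2 : Path (P 1) (Q 0 + ww a i j o) := ⟨⟨fun t => Q (unitInterval.symm t) + ww a i j o, by fun_prop⟩,
    by simp only [unitInterval.symm_zero]; rw [hP1, hQ1, ww]; ring, by simp⟩
  have key : ∀ t : II, (∃ x : II, (x : ℝ) = 2 * t ∧ exp (p1.trans p2 t) = a i x - o) ∨
      (∃ x : II, (x : ℝ) = 2 - 2 * t ∧ (1 / 2 : ℝ) < t ∧ exp (p1.trans p2 t) = a j x - o) := by
    intro t
    rw [Path.trans_apply]
    split_ifs with ht
    · left
      exact ⟨_, rfl, hPe _⟩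
    · right
      have ht2 : (1 / 2 : ℝ) < t := not_le.1 ht
      refine ⟨unitInterval.symm ⟨2 * t - 1,
        unitInterval.two_mul_sub_one_mem_iff.2 ⟨ht2.le, t.2.2⟩⟩, ?_, ht2, ?_⟩
      · simp; ring
      · change exp (Q _ + ww a i j o) = _
        rw [exp_add, hexp, mul_one, hQe]
  refine winding_odd (L := p1.trans p2) (p1.trans p2).continuous s hs0 ?_ ?_
  · simp [hP0, hQ0, hs]
  · intro x y hxy
    rcases key x with ⟨x', hx', hx⟩ | ⟨x', hx', hx2, hx⟩ <;> rcases key y with ⟨y', hy', hy⟩ | ⟨y', hy', hy2, hy⟩ <;>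
      rw [hx, hy, sub_left_inj] at hxy <;>
      rcases h.meet _ _ _ _ hxy with ⟨e1, e2⟩ | ⟨rfl, rfl⟩ | ⟨rfl, rfl⟩
    · left; apply Subtype.ext; rw [e2] at hx'; linarith
    · left; apply Subtype.ext; simp only [Icc.coe_zero, Icc.coe_one] at hx' hy'; linarith
    · left; apply Subtype.ext; simp only [Icc.coe_zero, Icc.coe_one] at hx' hy'; linarith
    · exact absurd e1 hij
    · right; left; simp only [Icc.coe_zero, Icc.coe_one] at hx' hy'
      constructor <;> apply Subtype.ext <;> simp only [Icc.coe_zero, Icc.coe_one] <;> linarith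
    · simp only [Icc.coe_zero, Icc.coe_one] at hx' hy'; exfalso; linarith
    · exact absurd e1.symm hij
    · right; right; simp only [Icc.coe_zero, Icc.coe_one] at hx' hy'
      constructor <;> apply Subtype.ext <;> simp only [Icc.coe_zero, Icc.coe_one] <;> linarith
    · simp only [Icc.coe_zero, Icc.coe_one] at hx' hy'; exfalso; linarith
    · left; apply Subtype.ext; rw [e2] at hx'; linarith
    · left; apply Subtype.ext; simp only [Icc.coe_zero, Icc.coe_one] at hx' hy'; linarith
    · left; apply Subtype.ext; simp only [Icc.coe_zero, Icc.coe_one] at hx' hy'; linarith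

end
end LensProof
end PB

section PC
open Set Complex

namespace LensProof

theorem dl_split {g h : II → ℂ} {o w z : ℂ} (hh : Continuous h) (hg : ∀ s, h s ^ 2 = g s - o)
    (hz : z ^ 2 = w - o) (hne : ∀ s, g s ≠ w) :
    dl (fun s => g s - w) = dl (fun s => h s - z) + dl (fun s => h s + z) := by
  have hm : ∀ s, g s - w = (h s - z) * (h s + z) := fun s => by linear_combination hz - hg s
  have h0 : ∀ s, (h s - z) * (h s + z) ≠ 0 := fun s => by rw [← hm]; exact sub_ne_zero.2 (hne s)
  rw [← dl_mul (by fun_prop) (fun s => left_ne_zero_of_mul (h0 s)) (by fun_prop)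
    (fun s => right_ne_zero_of_mul (h0 s))]
  simp only [hm]

theorem lift_ne {g h : II → ℂ} {o w z : ℂ} (hg : ∀ s, h s ^ 2 = g s - o)
    (hz : z ^ 2 = w - o) (hne : ∀ s, g s ≠ w) (s : II) : h s - z ≠ 0 ∧ h s + z ≠ 0 := by
  have hm : g s - w = (h s - z) * (h s + z) := by linear_combination hz - hg s
  have h0 : (h s - z) * (h s + z) ≠ 0 := by rw [← hm]; exact sub_ne_zero.2 (hne s)
  exact ⟨left_ne_zero_of_mul h0, right_ne_zero_of_mul h0⟩

theorem ix_lift {g d g' d' : II → ℂ} {o : ℂ} (hg' : Continuous g') (hd' : Continuous d')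
    (hg : ∀ s, g' s ^ 2 = g s - o) (hd : ∀ s, d' s ^ 2 = d s - o)
    (h0 : ∀ s, g s ≠ d 0) (h1 : ∀ s, g s ≠ d 1) (h2 : ∀ s, d s ≠ g 0) (h3 : ∀ s, d s ≠ g 1)
    (hdo : ∀ s, d s ≠ o)
    (hsc : ∀ s t s' t', g s = d t → g s' = d t' → s = s' ∧ t = t') :
    ix g' d' = 0 ∨ ix g' d' = ix g d := by
  by_cases hdis : ∀ s t, g' s ≠ d' t
  · left; exact ix_disjoint hg' hd' hdis
  right
  push Not at hdis
  obtain ⟨s, t, hst⟩ := hdis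
  have hst2 : ∀ s t, g' s ^ 2 = d' t ^ 2 → g s = d t := fun s t h => by
    linear_combination h - hg s + hd t
  have hdis : ix g' (fun t => - d' t) = 0 := by
    apply ix_disjoint hg' (by fun_prop)
    intro s' t' h
    obtain ⟨rfl, rfl⟩ := hsc s t s' t' (hst2 _ _ (by rw [hst])) (hst2 _ _ (by rw [h, neg_sq]))
    have hz : d' t = 0 := by linear_combination (h - hst) / 2
    have := hd t
    rw [hz] at this
    exact hdo t (by linear_combination -this)
  have a0 := dl_split hg' hg (hd 0) h0
  have a1 := dl_split hg' hg (hd 1) h1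
  have a2 := dl_split hd' hd (hg 0) h2
  have a3 := dl_split hd' hd (hg 1) h3
  have n0 := dl_neg (f := fun t => d' t + g' 1) (by fun_prop) (fun s => (lift_ne hd (hg 1) h3 s).2)
  have n1 := dl_neg (f := fun t => d' t + g' 0) (by fun_prop) (fun s => (lift_ne hd (hg 0) h2 s).2)
  simp only [neg_add, ← sub_eq_add_neg] at n0 n1
  simp only [ix, sub_neg_eq_add] at hdis ⊢
  rw [a0, a1, a2, a3]
  linear_combination - hdis + n0 - n1


theorem exists_sqrt {e f : II → ℂ} {o u : ℂ} (he : Continuous e) (hf : Continuous f)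
    (heo : ∀ s, e s ≠ o) (hfo : ∀ s, f s ≠ o) (he0 : e 0 = u) (hf0 : f 0 = u) {n : ℤ} (hn : Odd n)
    (hw : dl (fun s => e s - o) - dl (fun s => f s - o) = n * (2 * Real.pi * I)) :
    ∃ e' f' : II → ℂ, Continuous e' ∧ Continuous f' ∧ (∀ s, e' s ^ 2 = e s - o) ∧
      (∀ s, f' s ^ 2 = f s - o) ∧ f' 0 = - e' 0 ∧ f' 1 = e' 1 := by
  have huo : u - o ≠ 0 := he0 ▸ sub_ne_zero.2 (heo 0)
  obtain ⟨P, hPc, hPe, hP0, hP1⟩ := exists_log_from (fun s => e s - o)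
    (by fun_prop) (fun s => sub_ne_zero.2 (heo s)) (log (u - o)) (by rw [exp_log huo, he0])
  obtain ⟨Q, hQc, hQe, hQ0, hQ1⟩ := exists_log_from (fun s => f s - o)
    (by fun_prop) (fun s => sub_ne_zero.2 (hfo s)) (log (u - o)) (by rw [exp_log huo, hf0])
  have hsq : ∀ x, exp (x / 2) ^ 2 = exp x := fun x => by
    rw [← exp_nat_mul]; congr 1; push_cast; ring
  refine ⟨fun s => exp (P s / 2), fun s => - exp (Q s / 2), by fun_prop, by fun_prop,
    fun s => by rw [hsq, hPe], fun s => by rw [neg_sq, hsq, hQe], by simp only [hP0, hQ0], ?_⟩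
  obtain ⟨k, hk⟩ := hn
  have : P 1 / 2 = Q 1 / 2 + (k * (2 * Real.pi * I) + Real.pi * I) := by
    rw [hP1, hQ1]
    rw [hk] at hw
    push_cast at hw
    linear_combination hw / 2
  simp only
  rw [this, exp_add, exp_add (_ * _), exp_pi_mul_I, exp_int_mul_two_pi_mul_I]
  ring

theorem ix_int {g d : II → ℂ} (hg : Continuous g) (hd : Continuous d)
    (h0 : ∀ s, g s ≠ d 0) (h1 : ∀ s, g s ≠ d 1) (h2 : ∀ s, d s ≠ g 0) (h3 : ∀ s, d s ≠ g 1) :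
    ∃ n : ℤ, ix g d = n * (2 * Real.pi * I) := by
  apply Complex.exp_eq_one_iff.1
  rw [ix, exp_sub, exp_add, exp_sub, exp_dl (by fun_prop) (fun s => sub_ne_zero.2 (h0 s)),
    exp_dl (by fun_prop) (fun s => sub_ne_zero.2 (h1 s)),
    exp_dl (by fun_prop) (fun s => sub_ne_zero.2 (h2 s)),
    exp_dl (by fun_prop) (fun s => sub_ne_zero.2 (h3 s))]
  have a := sub_ne_zero.2 (h0 0)
  have b := sub_ne_zero.2 (h0 1)
  have c := sub_ne_zero.2 (h1 0)
  have d := sub_ne_zero.2 (h1 1)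
  have a' := sub_ne_zero.2 (h0 0).symm
  have b' := sub_ne_zero.2 (h0 1).symm
  have c' := sub_ne_zero.2 (h1 0).symm
  have d' := sub_ne_zero.2 (h1 1).symm
  field_simp
  ring

theorem main_ix {e1 f1 e2 f2 : II → ℂ} {o u1 v1 u2 v2 : ℂ}
    (he1 : Continuous e1) (hf1 : Continuous f1) (he2 : Continuous e2) (hf2 : Continuous f2)
    (e10 : e1 0 = u1) (e11 : e1 1 = v1) (f10 : f1 0 = u1) (f11 : f1 1 = v1)
    (e20 : e2 0 = u2) (e21 : e2 1 = v2) (f20 : f2 0 = u2) (f21 : f2 1 = v2)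
    (e1o : ∀ s, e1 s ≠ o) (f1o : ∀ s, f1 s ≠ o) (e2o : ∀ s, e2 s ≠ o) (f2o : ∀ s, f2 s ≠ o)
    (e1u : ∀ s, e1 s ≠ u2) (e1v : ∀ s, e1 s ≠ v2) (f1u : ∀ s, f1 s ≠ u2) (f1v : ∀ s, f1 s ≠ v2)
    (e2u : ∀ s, e2 s ≠ u1) (e2v : ∀ s, e2 s ≠ v1) (f2u : ∀ s, f2 s ≠ u1) (f2v : ∀ s, f2 s ≠ v1)
    {s1 s2 : ℤ} (hs1 : Odd s1) (hs2 : Odd s2)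
    (w1 : dl (fun s => e1 s - o) - dl (fun s => f1 s - o) = s1 * (2 * Real.pi * I))
    (w2 : dl (fun s => e2 s - o) - dl (fun s => f2 s - o) = s2 * (2 * Real.pi * I))
    (em1u : dl (fun s => e1 s - u2) = dl (fun s => f1 s - u2))
    (em1v : dl (fun s => e1 s - v2) = dl (fun s => f1 s - v2))
    (em2u : dl (fun s => e2 s - u1) = dl (fun s => f2 s - u1))
    (em2v : dl (fun s => e2 s - v1) = dl (fun s => f2 s - v1))
    (cee : ∀ s t s' t', e1 s = e2 t → e1 s' = e2 t' → s = s' ∧ t = t')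
    (cef : ∀ s t s' t', e1 s = f2 t → e1 s' = f2 t' → s = s' ∧ t = t')
    (cfe : ∀ s t s' t', f1 s = e2 t → f1 s' = e2 t' → s = s' ∧ t = t')
    (cff : ∀ s t s' t', f1 s = f2 t → f1 s' = f2 t' → s = s' ∧ t = t') :
    ∃ x : ℤ, Odd x ∧ ix e1 e2 = x * (2 * Real.pi * I) := by
  obtain ⟨E1, F1, cE1, cF1, E1s, F1s, F10, F11⟩ := exists_sqrt he1 hf1 e1o f1o e10 f10 hs1 w1
  obtain ⟨E2, F2, cE2, cF2, E2s, F2s, F20, F21⟩ := exists_sqrt he2 hf2 e2o f2o e20 f20 hs2 w2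
  obtain ⟨x, hx⟩ := ix_int he1 he2 (by rwa [e20]) (by rwa [e21]) (by rwa [e10]) (by rwa [e11])
  refine ⟨x, ?_, hx⟩
  have xef : ix e1 f2 = ix e1 e2 := by
    simp only [ix, e10, e11, e20, e21, f20, f21, em2u, em2v]
  have xfe : ix f1 e2 = ix e1 e2 := by
    simp only [ix, e10, e11, e20, e21, f10, f11, em1u, em1v]
  have xff : ix f1 f2 = ix e1 e2 := by
    simp only [ix, e10, e11, e20, e21, f10, f11, f20, f21, em1u, em1v, em2u, em2v]
  have conv : ∀ {z : ℂ}, (z = 0 ∨ z = ix e1 e2) → ∃ c : ℤ, z = c * x * (2 * Real.pi * I) := by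
    rintro z (h | h)
    · exact ⟨0, by simp [h]⟩
    · exact ⟨1, by rw [h, hx]; simp⟩
  obtain ⟨c1, hc1⟩ := conv (ix_lift cE1 cE2 E1s E2s (by rwa [e20]) (by rwa [e21]) (by rwa [e10])
    (by rwa [e11]) e2o cee)
  obtain ⟨c2, hc2⟩ := conv (xef ▸ ix_lift cE1 cF2 E1s F2s (by rwa [f20]) (by rwa [f21])
    (by rwa [e10]) (by rwa [e11]) f2o cef)
  obtain ⟨c3, hc3⟩ := conv (xfe ▸ ix_lift cF1 cE2 F1s E2s (by rwa [e20]) (by rwa [e21])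
    (by rwa [f10]) (by rwa [f11]) e2o cfe)
  obtain ⟨c4, hc4⟩ := conv (xff ▸ ix_lift cF1 cF2 F1s F2s (by rwa [f20]) (by rwa [f21])
    (by rwa [f10]) (by rwa [f11]) f2o cff)
  have p1s : E1 0 ^ 2 = u1 - o := by rw [E1s, e10]
  have p2s : E2 0 ^ 2 = u2 - o := by rw [E2s, e20]
  have m1 := em1u
  rw [dl_split cE1 E1s p2s e1u, dl_split cF1 F1s p2s f1u] at m1
  have m2 := em2u
  rw [dl_split cE2 E2s p1s e2u, dl_split cF2 F2s p1s f2u] at m2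
  have n1 := lift_ne E1s p2s e1u
  have n2 := lift_ne F1s p2s f1u
  have n3 := lift_ne E2s p1s e2u
  have n4 := lift_ne F2s p1s f2u
  simp only [ix, F10, F11, F20, F21, sub_neg_eq_add] at hc1 hc2 hc3 hc4
  have hexp : exp (dl (fun s => E1 s - E2 0) - dl (fun s => F1 s - E2 0) -
      (dl (fun s => E2 s - E1 0) - dl (fun s => F2 s - E1 0))) = exp (Real.pi * I) := by
    rw [exp_sub, exp_sub, exp_sub, exp_dl (by fun_prop) (fun s => (n1 s).1),
      exp_dl (by fun_prop) (fun s => (n2 s).1), exp_dl (by fun_prop) (fun s => (n3 s).1),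
      exp_dl (by fun_prop) (fun s => (n4 s).1), exp_pi_mul_I, F10, F11, F20, F21]
    have a1 := (n1 1).1
    have a2 := (n1 0).1
    have a3 := (n1 0).2
    have a4 := (n3 1).1
    have a5 := (n3 0).1
    have a6 : -E1 0 - E2 0 ≠ 0 := by rw [← neg_ne_zero]; convert a3 using 1; ring
    have a7 : -E2 0 - E1 0 ≠ 0 := by rw [← neg_ne_zero]; convert a3 using 1; ring
    field_simp
    ring
  obtain ⟨k, hk⟩ := exp_eq_exp_iff_exists_int.1 hexp
  have hfin : ((c1 - c2 - c3 + c4 : ℤ) * x : ℂ) * (2 * Real.pi * I) =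
      (2 * k + 1 : ℤ) * (2 * Real.pi * I) := by
    push_cast
    linear_combination - hc1 + hc2 + hc3 - hc4 + 2 * hk - m1 + m2
  have h6 := mul_right_cancel₀ two_pi_I_ne hfin
  have h7 : (c1 - c2 - c3 + c4) * x = 2 * k + 1 := by exact_mod_cast h6
  have h8 : Odd ((c1 - c2 - c3 + c4) * x) := ⟨k, h7⟩
  exact (Int.odd_mul.1 h8).2

end LensProof
end PC

section PD
open Set Complex

namespace LensProof

theorem NN_ex {e : II → ℂ} {w : ℂ} (he : Continuous e) (hw : ∀ s, e s ≠ w) :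
    ∃ N : ℤ, dl (fun s => e s - w) = log (e 1 - w) - log (e 0 - w) + N * (2 * Real.pi * I) := by
  have h0 : ∀ s, e s - w ≠ 0 := fun s => sub_ne_zero.2 (hw s)
  have := exp_dl (f := fun s => e s - w) (by fun_prop) h0
  obtain ⟨N, hN⟩ := Complex.exp_eq_exp_iff_exists_int.1
    (show exp (dl (fun s => e s - w)) = exp (log (e 1 - w) - log (e 0 - w)) by
      rw [this, exp_sub, exp_log (h0 1), exp_log (h0 0)])
  exact ⟨N, hN⟩

open Classical in
noncomputable def NN (e : II → ℂ) (w : ℂ) : ℤ :=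
  if h : ∃ N : ℤ, dl (fun s => e s - w) = log (e 1 - w) - log (e 0 - w) + N * (2 * Real.pi * I)
  then h.choose else 0

theorem NN_spec {e : II → ℂ} {w : ℂ} (he : Continuous e) (hw : ∀ s, e s ≠ w) :
    dl (fun s => e s - w) = log (e 1 - w) - log (e 0 - w) + NN e w * (2 * Real.pi * I) := by
  have h := NN_ex he hw
  rw [NN, dif_pos h]
  exact h.choose_spec

theorem BB_ex {x y : ℂ} (h : x ≠ y) :
    ∃ b : ℤ, log (x - y) - log (y - x) = (2 * b + 1) * (Real.pi * I) := by
  have h1 : x - y ≠ 0 := sub_ne_zero.2 h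
  have h2 : y - x ≠ 0 := sub_ne_zero.2 h.symm
  obtain ⟨b, hb⟩ := Complex.exp_eq_exp_iff_exists_int.1
    (show exp (log (x - y)) = exp (log (y - x) + Real.pi * I) by
      rw [exp_add, exp_log h1, exp_log h2, exp_pi_mul_I]; ring)
  exact ⟨b, by rw [hb]; ring⟩

open Classical in
noncomputable def BB (x y : ℂ) : ℤ :=
  if h : ∃ b : ℤ, log (x - y) - log (y - x) = (2 * b + 1) * (Real.pi * I) then h.choose else 0

theorem BB_spec {x y : ℂ} (h : x ≠ y) :
    log (x - y) - log (y - x) = (2 * BB x y + 1) * (Real.pi * I) := by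
  have h := BB_ex h
  rw [BB, dif_pos h]
  exact h.choose_spec

theorem BB_add {x y : ℂ} (h : x ≠ y) : ((BB x y : ℤ) : ZMod 2) + (BB y x : ℤ) = 1 := by
  have h1 := BB_spec h
  have h2 := BB_spec h.symm
  have h3 : ((2 * (BB x y + BB y x + 1) : ℤ) : ℂ) * (Real.pi * I) = 0 := by
    push_cast
    linear_combination -h1 - h2
  have h4 : (2 * (BB x y + BB y x + 1) : ℤ) = 0 := by
    have : ((Real.pi : ℂ) * I) ≠ 0 := by simp [Real.pi_ne_zero]
    exact_mod_cast (mul_eq_zero.1 h3).resolve_right this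
  have h5 : BB x y + BB y x = -1 := by omega
  rw [← Int.cast_add, h5]
  rfl

theorem disc {e1 e2 : II → ℂ} {u1 v1 u2 v2 : ℂ}
    (he1 : Continuous e1) (he2 : Continuous e2)
    (e10 : e1 0 = u1) (e11 : e1 1 = v1) (e20 : e2 0 = u2) (e21 : e2 1 = v2)
    (e1u : ∀ s, e1 s ≠ u2) (e1v : ∀ s, e1 s ≠ v2)
    (e2u : ∀ s, e2 s ≠ u1) (e2v : ∀ s, e2 s ≠ v1)
    {x : ℤ} (hx : Odd x) (hix : ix e1 e2 = x * (2 * Real.pi * I)) :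
    (NN e1 u2 : ZMod 2) + NN e1 v2 + NN e2 u1 + NN e2 v1 + BB u1 u2 + BB u1 v2 + BB v1 u2
      + BB v1 v2 = 1 := by
  have b1 := BB_spec (x := u1) (y := u2) (by rw [← e10]; exact e1u 0)
  have b2 := BB_spec (x := u1) (y := v2) (by rw [← e10]; exact e1v 0)
  have b3 := BB_spec (x := v1) (y := u2) (by rw [← e11]; exact e1u 1)
  have b4 := BB_spec (x := v1) (y := v2) (by rw [← e11]; exact e1v 1)
  rw [ix, e10, e11, e20, e21, NN_spec he1 e1u, NN_spec he1 e1v, NN_spec he2 e2u, NN_spec he2 e2v,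
    e10, e11, e20, e21] at hix
  have h3 : ((x - (NN e1 u2 - NN e1 v2 + NN e2 v1 - NN e2 u1 + BB v1 u2 - BB u1 u2 - BB v1 v2
      + BB u1 v2) : ℤ) : ℂ) * (2 * Real.pi * I) = 0 := by
    push_cast
    linear_combination -hix - b1 + b2 + b3 - b4
  have h4 := (mul_eq_zero.1 h3).resolve_right two_pi_I_ne
  have h5 : x = (NN e1 u2 - NN e1 v2 + NN e2 v1 - NN e2 u1 + BB v1 u2 - BB u1 u2 - BB v1 v2
      + BB u1 v2) := by
    have : (x - (NN e1 u2 - NN e1 v2 + NN e2 v1 - NN e2 u1 + BB v1 u2 - BB u1 u2 - BB v1 v2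
      + BB u1 v2) : ℤ) = 0 := by exact_mod_cast h4
    omega
  have h6 : (x : ZMod 2) = 1 := by
    obtain ⟨m, rfl⟩ := hx
    have : (2 : ZMod 2) = 0 := rfl
    push_cast
    rw [this]; simp
  rw [h5] at h6
  push_cast at h6
  have h : (2 : ZMod 2) = 0 := rfl
  linear_combination h6 + h * ((NN e1 v2 : ZMod 2) + NN e2 u1 + BB u1 u2 + BB v1 v2)

end LensProof
end PD

section PE
namespace LensProof
open Finset

section comb
variable {α : Type*}

open Classical in
noncomputable def mm (S : Finset α) (R : α → α → Prop) : ℕ :=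
  ∑ x ∈ S, ∑ y ∈ S, if R x y then 1 else 0

open Classical in
noncomputable def dg (S : Finset α) (R : α → α → Prop) (x : α) : ℕ :=
  ∑ y ∈ S, if R x y then 1 else 0

/-- The parity condition. -/
def QQ (β : α → α → ZMod 2) (col : α → ZMod 2) (S : Finset α) (R : α → α → Prop)
    (n : α → α → α → ZMod 2) : Prop :=
  ∀ a ∈ S, ∀ b ∈ S, ∀ c ∈ S, ∀ d ∈ S, a ≠ c → a ≠ d → b ≠ c → b ≠ d → R a b → R c d →
    n a b c + n a b d + n c d a + n c d b + β a c + β a d + β b c + β b d =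
      (col a + col b) * (col c + col d)

theorem mm_mono {S : Finset α} {R R' : α → α → Prop} (h : ∀ x y, R x y → R' x y) :
    mm S R ≤ mm S R' := by
  classical
  unfold mm
  refine Finset.sum_le_sum fun x _ => Finset.sum_le_sum fun y _ => ?_
  split_ifs with h1 h2 <;> simp
  exact h2 (h _ _ h1)

theorem mm_erase [DecidableEq α] {S : Finset α} {R : α → α → Prop} (hs : ∀ x y, R x y → R y x)
    (hi : ∀ x, ¬ R x x) {b : α} (hb : b ∈ S) :
    mm S R = mm (S.erase b) R + 2 * dg S R b := by
  classical
  have h0 : dg S R b = ∑ y ∈ S.erase b, if R b y then 1 else 0 := by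
    rw [dg, ← Finset.add_sum_erase S _ hb, if_neg (hi b), zero_add]
  have h1 : ∀ x, (∑ y ∈ S, if R x y then 1 else 0) =
      (if R b x then 1 else 0) + ∑ y ∈ S.erase b, if R x y then 1 else 0 := by
    intro x
    rw [← Finset.add_sum_erase S _ hb]
    congr 1
    exact if_congr ⟨hs _ _, hs _ _⟩ rfl rfl
  have h2 : mm S R = dg S R b + ∑ x ∈ S.erase b, ∑ y ∈ S, if R x y then 1 else 0 := by
    rw [mm, ← Finset.add_sum_erase S _ hb]; rfl
  rw [h2, Finset.sum_congr rfl (fun x _ => h1 x), Finset.sum_add_distrib, ← h0]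
  unfold mm
  ring

theorem mm_edge [DecidableEq α] {S : Finset α} {R : α → α → Prop} (hs : ∀ x y, R x y → R y x)
    (hi : ∀ x, ¬ R x x) {a b : α} (ha : a ∈ S) (hb : b ∈ S) (hab : R a b) :
    mm S R = mm S (fun x y => R x y ∧ ¬ (x = a ∧ y = b) ∧ ¬ (x = b ∧ y = a)) + 2 := by
  classical
  have hne : a ≠ b := fun h => hi b (h ▸ hab)
  have h1 : ∀ x y, (if R x y then 1 else 0) =
      (if (R x y ∧ ¬ (x = a ∧ y = b) ∧ ¬ (x = b ∧ y = a)) then 1 else 0) +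
      (if x = a then (if y = b then 1 else 0) else 0) +
      (if x = b then (if y = a then 1 else 0) else 0) := by
    intro x y
    have := hs _ _ hab
    by_cases h1 : x = a <;> by_cases h2 : y = b <;> by_cases h3 : x = b <;> by_cases h4 : y = a <;>
      simp_all
  unfold mm
  simp only [h1, Finset.sum_add_distrib]
  simp [Finset.sum_ite_irrel, ha, hb]

theorem four {x1 x2 x3 x4 x5 x6 x7 x8 x9 x10 x11 x12 ab ac ad bc bd cd cb db dc A B C D : ZMod 2}
    (h1 : x1 + x2 + x3 + x4 + ac + ad + bc + bd = (A + B) * (C + D))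
    (h2 : x5 + x6 + x7 + x8 + ab + ad + cb + cd = (A + C) * (B + D))
    (h3 : x9 + x10 + x11 + x12 + ab + ac + db + dc = (A + D) * (B + C))
    (e1 : bc + cb = 1) (e2 : bd + db = 1) (e3 : cd + dc = 1) :
    x1 + x2 + x3 + x4 + x5 + x6 + x7 + x8 + x9 + x10 + x11 + x12 = 1 := by
  have h : (2 : ZMod 2) = 0 := rfl
  linear_combination h1 + h2 + h3 - e1 - e2 - e3 +
    (A * B + A * C + A * D + B * C + B * D + C * D - ab - ac - ad - 2) * h

theorem no_K5 {β : α → α → ZMod 2} (hβ : ∀ x y, x ≠ y → β x y + β y x = 1) {col : α → ZMod 2}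
    {S : Finset α} {R : α → α → Prop} {n : α → α → α → ZMod 2}
    (hi : ∀ x, ¬ R x x) (hQ : QQ β col S R n)
    {a b c d e : α} (ha : a ∈ S) (hb : b ∈ S) (hc : c ∈ S) (hd : d ∈ S) (he : e ∈ S)
    (hab : R a b) (hac : R a c) (had : R a d) (hae : R a e) (hbc : R b c) (hbd : R b d)
    (hbe : R b e) (hcd : R c d) (hce : R c e) (hde : R d e) : False := by
  have ne : ∀ {x y}, R x y → x ≠ y := fun h e => hi _ (e ▸ h)
  have key : ∀ a b c d, a ∈ S → b ∈ S → c ∈ S → d ∈ S → R a b → R a c → R a d → R b c → R b d →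
      R c d → n a b c + n a b d + n c d a + n c d b + n a c b + n a c d + n b d a + n b d c +
        n a d b + n a d c + n b c a + n b c d = 1 := by
    intro a b c d ha hb hc hd hab hac had hbc hbd hcd
    exact four (hQ a ha b hb c hc d hd (ne hac) (ne had) (ne hbc) (ne hbd) hab hcd)
      (hQ a ha c hc b hb d hd (ne hab) (ne had) (ne hbc).symm (ne hcd) hac hbd)
      (hQ a ha d hd b hb c hc (ne hab) (ne hac) (ne hbd).symm (ne hcd).symm had hbc)
      (hβ _ _ (ne hbc)) (hβ _ _ (ne hbd)) (hβ _ _ (ne hcd))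
  have k1 := key a b c d ha hb hc hd hab hac had hbc hbd hcd
  have k2 := key a b c e ha hb hc he hab hac hae hbc hbe hce
  have k3 := key a b d e ha hb hd he hab had hae hbd hbe hde
  have k4 := key a c d e ha hc hd he hac had hae hcd hce hde
  have k5 := key b c d e hb hc hd he hbc hbd hbe hcd hce hde
  have h : (2 : ZMod 2) = 0 := rfl
  have : (1 : ZMod 2) = 0 := by
    linear_combination -(k1 + k2 + k3 + k4 + k5) - 2 * h + h * (
      n a b c + n a b d + n a b e + n a c b + n a c d + n a c e + n a d b + n a d c + n a d e
      + n a e b + n a e c + n a e d + n b c a + n b c d + n b c e + n b d a + n b d c + n b d e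
      + n b e a + n b e c + n b e d + n c d a + n c d b + n c d e + n c e a + n c e b + n c e d
      + n d e a + n d e b + n d e c)
  exact one_ne_zero this

/-- relation after contracting `b` into `a` -/
def RC (R : α → α → Prop) (a b : α) : α → α → Prop := fun x y =>
  R x y ∨ (x = a ∧ y ≠ a ∧ R b y) ∨ (y = a ∧ x ≠ a ∧ R b x)

open Classical in
noncomputable def nC (R : α → α → Prop) (n : α → α → α → ZMod 2) (a b : α) : α → α → α → ZMod 2 :=
  fun x y z => if R x y then n x y z else if x = a then n a b z + n b y z else
    if y = a then n a b z + n b x z else 0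

theorem QQ_contract [DecidableEq α] {β : α → α → ZMod 2} (hβ : ∀ x y, x ≠ y → β x y + β y x = 1)
    {col : α → ZMod 2}
    {S : Finset α} {R : α → α → Prop} {n : α → α → α → ZMod 2}
    (hi : ∀ x, ¬ R x x) (hQ : QQ β col S R n)
    {a b : α} (ha : a ∈ S) (hb : b ∈ S) (hab : R a b) :
    QQ β col (S.erase b) (RC R a b) (nC R n a b) := by
  classical
  have hne : a ≠ b := fun h => hi b (h ▸ hab)
  have h2 : (2 : ZMod 2) = 0 := rfl
  -- new edge `a y`, old edge `c d`
  have key : ∀ y c d, y ∈ S → c ∈ S → d ∈ S → y ≠ b → c ≠ b → d ≠ b → a ≠ c → a ≠ d → y ≠ c →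
      y ≠ d → R b y → R c d →
      (n a b c + n b y c) + (n a b d + n b y d) + n c d a + n c d y + β a c + β a d + β y c + β y d
        = (col a + col y) * (col c + col d) := by
    intro y c d hy hc hd hyb hcb hdb hac had hyc hyd hby hcd
    have q1 := hQ a ha b hb c hc d hd hac had hcb.symm hdb.symm hab hcd
    have q2 := hQ b hb y hy c hc d hd hcb.symm hdb.symm hyc hyd hby hcd
    linear_combination q1 + q2 + h2 * (col b * (col c + col d) - n c d b - β b c - β b d)
  have key2 : ∀ y c d, y ∈ S → c ∈ S → d ∈ S → y ≠ b → c ≠ b → d ≠ b → a ≠ c → a ≠ d → y ≠ c →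
      y ≠ d → R b y → R c d →
      n c d a + n c d y + (n a b c + n b y c) + (n a b d + n b y d) + β c a + β c y + β d a + β d y
        = (col c + col d) * (col a + col y) := by
    intro y c d hy hc hd hyb hcb hdb hac had hyc hyd hby hcd
    have := key y c d hy hc hd hyb hcb hdb hac had hyc hyd hby hcd
    linear_combination this + hβ _ _ hac + hβ _ _ had + hβ _ _ hyc + hβ _ _ hyd +
      h2 * (2 - β a c - β a d - β y c - β y d)
  intro p hp q hq c hc d hd hpc hpd hqc hqd hpq hcd
  rw [mem_erase] at hp hq hc hd
  by_cases r1 : R p q <;> by_cases r2 : R c d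
  · simp only [nC, if_pos r1, if_pos r2]
    exact hQ p hp.2 q hq.2 c hc.2 d hd.2 hpc hpd hqc hqd r1 r2
  · simp only [nC, if_pos r1, if_neg r2]
    rcases hcd with h | ⟨rfl, hda, hbd⟩ | ⟨rfl, hca, hbc⟩
    · exact absurd h r2
    · simp only [if_true]
      have := key2 d p q hd.2 hp.2 hq.2 hd.1 hp.1 hq.1 hpc.symm hqc.symm hpd.symm hqd.symm hbd r1
      linear_combination this
    · simp only [if_neg hca, if_true]
      have := key2 c p q hc.2 hp.2 hq.2 hc.1 hp.1 hq.1 hpd.symm hqd.symm hpc.symm hqc.symm hbc r1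
      linear_combination this
  · simp only [nC, if_neg r1, if_pos r2]
    rcases hpq with h | ⟨rfl, hqa, hbq⟩ | ⟨rfl, hpa, hbp⟩
    · exact absurd h r1
    · simp only [if_true]
      have := key q c d hq.2 hc.2 hd.2 hq.1 hc.1 hd.1 hpc hpd hqc hqd hbq r2
      linear_combination this
    · simp only [if_neg hpa, if_true]
      have := key p c d hp.2 hc.2 hd.2 hp.1 hc.1 hd.1 hqc hqd hpc hpd hbp r2
      linear_combination this
  · exfalso
    rcases hpq with h | ⟨h, -⟩ | ⟨h, -⟩ <;> rcases hcd with h' | ⟨h', -⟩ | ⟨h', -⟩ <;>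
      first
      | exact r1 h
      | exact r2 h'
      | exact hpc (h.trans h'.symm)
      | exact hpd (h.trans h'.symm)
      | exact hqc (h.trans h'.symm)
      | exact hqd (h.trans h'.symm)

theorem RC_symm {R : α → α → Prop} (hs : ∀ x y, R x y → R y x) (a b : α) :
    ∀ x y, RC R a b x y → RC R a b y x := by
  intro x y h
  rcases h with h | h | h
  · exact Or.inl (hs _ _ h)
  · exact Or.inr (Or.inr h)
  · exact Or.inr (Or.inl h)

theorem RC_irrefl {R : α → α → Prop} (hi : ∀ x, ¬ R x x) (a b : α) : ∀ x, ¬ RC R a b x x := by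
  rintro x (h | ⟨h, h', -⟩ | ⟨h, h', -⟩)
  · exact hi x h
  · exact h' h
  · exact h' h

theorem mm_contract [DecidableEq α] {S : Finset α} {R : α → α → Prop} (hs : ∀ x y, R x y → R y x)
    (hi : ∀ x, ¬ R x x) {a b : α} (ha : a ∈ S) (hb : b ∈ S) (hab : R a b) :
    mm S R ≤ mm (S.erase b) (RC R a b) + 2 * (1 + dg S (fun x y => R a y ∧ R b y) a) := by
  classical
  have hne : a ≠ b := fun h => hi b (h ▸ hab)
  rw [mm_erase hs hi hb]
  set C : α → Prop := fun y => R b y ∧ y ≠ a ∧ ¬ R a y with hC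
  have hd : dg S R b = 1 + dg S (fun x y => R a y ∧ R b y) a + ∑ y ∈ S.erase b, if C y then 1 else 0 := by
    have h1 : ∀ y, (if R b y then 1 else 0) = (if y = a then 1 else 0) +
        (if R a y ∧ R b y then 1 else 0) + (if C y then 1 else 0) := by
      intro y
      have := hi a
      have := hs _ _ hab
      by_cases h1 : y = a
      · subst h1; simp_all
      · by_cases h2 : R a y <;> by_cases h3 : R b y <;> simp_all
    have h2 : (∑ y ∈ S.erase b, if C y then 1 else 0) = ∑ y ∈ S, if C y then 1 else 0 := by
      rw [← Finset.add_sum_erase S _ hb, if_neg, zero_add]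
      exact fun h => hi b h.1
    rw [h2]
    unfold dg
    simp only [h1, Finset.sum_add_distrib]
    rw [Finset.sum_ite_eq', if_pos ha]
    congr!
  have hm : mm (S.erase b) R + 2 * (∑ y ∈ S.erase b, if C y then 1 else 0) ≤
      mm (S.erase b) (RC R a b) := by
    have ha' : a ∈ S.erase b := mem_erase.2 ⟨hne, ha⟩
    have e1 : (∑ y ∈ S.erase b, if C y then 1 else 0) = ∑ x ∈ S.erase b, ∑ y ∈ S.erase b,
        if x = a then (if C y then 1 else 0) else 0 := by
      simp [Finset.sum_ite_irrel, ha']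
    have e2 : (∑ y ∈ S.erase b, if C y then 1 else 0) = ∑ x ∈ S.erase b, ∑ y ∈ S.erase b,
        if y = a then (if C x then 1 else 0) else 0 := by
      rw [e1, Finset.sum_comm]
    rw [two_mul]
    nth_rewrite 1 [e1]
    rw [e2]
    unfold mm
    simp only [← Finset.sum_add_distrib]
    refine Finset.sum_le_sum fun x _ => Finset.sum_le_sum fun y _ => ?_
    by_cases hx : x = a
    · subst hx
      by_cases hy : y = x
      · subst hy; simp [hC, hi, RC]
      · by_cases h1 : R x y <;> by_cases h2 : R b y <;> simp [hC, RC, h1, h2, hy]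
    · by_cases hy : y = a
      · subst hy
        by_cases h1 : R x y <;> by_cases h2 : R b x
        · simp [hC, RC, h1, h2, hx, hs _ _ h1]
        · simp [hC, RC, h1, h2, hx]
        · simp [hC, RC, h1, h2, hx]
          split_ifs <;> simp
        · simp [hC, RC, h1, h2, hx]
      · simp [RC, hx, hy]
  omega

theorem mm_eq_sum (S : Finset α) (R : α → α → Prop) : mm S R = ∑ x ∈ S, dg S R x := rfl

theorem mader {β : α → α → ZMod 2} (hβ : ∀ x y, x ≠ y → β x y + β y x = 1) {col : α → ZMod 2} :
    ∀ (k m : ℕ) (S : Finset α) (R : α → α → Prop) (n : α → α → α → ZMod 2),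
      S.card ≤ k → mm S R = m → S.Nonempty → (∀ x y, R x y → R y x) → (∀ x, ¬ R x x) →
      QQ β col S R n → mm S R + 4 ≤ 6 * S.card := by
  classical
  intro k
  induction k with
  | zero =>
    intro m S R n hk hm hS
    have := hS.card_pos
    omega
  | succ k ihk =>
    intro m
    induction m using Nat.strong_induction_on with
    | h m ihm =>
    intro S R n hk hm hS hs hi hQ
    by_contra! hbad
    have hpos := hS.card_pos
    have hcard2 : 2 ≤ S.card := by
      by_contra! h
      have h1 : S.card = 1 := by omega
      obtain ⟨x, rfl⟩ := Finset.card_eq_one.1 h1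
      have : mm {x} R = 0 := by
        unfold mm
        rw [Finset.sum_singleton, Finset.sum_singleton, if_neg (hi x)]
      omega
    -- at most `6 N - 2`
    have hm1 : mm S R + 2 ≤ 6 * S.card := by
      by_contra! h
      have : ∃ a ∈ S, ∃ b ∈ S, R a b := by
        by_contra! hall
        have : mm S R = 0 := by
          unfold mm
          refine Finset.sum_eq_zero fun x hx => Finset.sum_eq_zero fun y hy => ?_
          rw [if_neg (hall x hx y hy)]
        omega
      obtain ⟨a, ha, b, hb, hab⟩ := this
      have he := mm_edge hs hi ha hb hab
      have := ihm (mm S (fun x y => R x y ∧ ¬ (x = a ∧ y = b) ∧ ¬ (x = b ∧ y = a))) (by omega) S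
        (fun x y => R x y ∧ ¬ (x = a ∧ y = b) ∧ ¬ (x = b ∧ y = a)) n (by omega) rfl hS
        (fun x y h => ⟨hs _ _ h.1, fun h' => h.2.2 h'.symm, fun h' => h.2.1 h'.symm⟩)
        (fun x h => hi x h.1)
        (fun p hp q hq c hc d hd h1 h2 h3 h4 h5 h6 =>
          hQ p hp q hq c hc d hd h1 h2 h3 h4 h5.1 h6.1)
      omega
    have hdel : ∀ b ∈ S, 4 ≤ dg S R b := by
      intro b hb
      by_contra! h
      have e := mm_erase hs hi hb
      have hc := Finset.card_erase_of_mem hb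
      have := ihk _ (S.erase b) R n (by omega) rfl (by rw [← Finset.card_pos]; omega) hs hi
        (fun p hp q hq c hc d hd => hQ p (mem_of_mem_erase hp) q (mem_of_mem_erase hq) c
          (mem_of_mem_erase hc) d (mem_of_mem_erase hd))
      omega
    have hmle : ∀ a ∈ S, ∀ b ∈ S, R a b → 3 ≤ dg S (fun x y => R a y ∧ R b y) a := by
      intro a ha b hb hab
      by_contra! h
      have e := mm_contract hs hi ha hb hab
      have hc := Finset.card_erase_of_mem hb
      have := ihk _ (S.erase b) (RC R a b) (nC R n a b) (by omega) rfl (by rw [← Finset.card_pos]; omega)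
        (RC_symm hs a b) (RC_irrefl hi a b) (QQ_contract hβ hi hQ ha hb hab)
      omega
    obtain ⟨v, hv, hv5⟩ : ∃ v ∈ S, dg S R v ≤ 5 := by
      by_contra! hall
      have : ∑ x ∈ S, 6 ≤ ∑ x ∈ S, dg S R x := Finset.sum_le_sum fun x hx => hall x hx
      rw [← mm_eq_sum] at this
      simp at this
      omega
    set T := S.filter (R v) with hT
    have hTc : dg S R v = T.card := by simp [dg, hT]
    have hTm : ∀ {x}, x ∈ T ↔ x ∈ S ∧ R v x := by intro x; simp [hT]
    have hT4 := hdel v hv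
    have hcom : ∀ x ∈ T, 3 ≤ (T.filter (R x)).card := by
      intro x hx
      have := hmle v hv x (hTm.1 hx).1 (hTm.1 hx).2
      refine this.trans (le_of_eq ?_)
      rw [hT, Finset.filter_filter, Finset.card_filter]
      unfold dg
      congr!
    have huniq : ∀ x ∈ T, ∀ y ∈ T, ∀ z ∈ T, x ≠ y → x ≠ z → y ≠ z → R x y ∨ R x z := by
      intro x hx y hy z hz hxy hxz hyz
      by_contra! hno
      have h1 := hcom x hx
      have h2 : T.filter (R x) ⊆ ((T.erase x).erase y).erase z := by
        intro w hw
        rw [mem_filter] at hw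
        simp only [mem_erase]
        refine ⟨?_, ?_, ?_, hw.1⟩
        · rintro rfl; exact hno.2 hw.2
        · rintro rfl; exact hno.1 hw.2
        · rintro rfl; exact hi _ hw.2
      have h3 := Finset.card_le_card h2
      rw [card_erase_of_mem (by simp [hz, hyz.symm, hxz.symm]),
        card_erase_of_mem (by simp [hy, hxy.symm]), card_erase_of_mem hx] at h3
      omega
    have hclique : ∀ T' ⊆ T, 4 ≤ T'.card → (∀ x ∈ T', ∀ y ∈ T', x ≠ y → R x y) → False := by
      intro T' hT' hc4 hcl
      obtain ⟨a, ha⟩ : T'.Nonempty := by rw [← Finset.card_pos]; omega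
      have : 2 < (T'.erase a).card := by rw [card_erase_of_mem ha]; omega
      obtain ⟨b, c, d, hb, hc, hd, hbc, hbd, hcd⟩ := Finset.two_lt_card_iff.1 this
      rw [mem_erase] at hb hc hd
      have t := fun {x} (h : x ∈ T') => hTm.1 (hT' h)
      exact no_K5 hβ hi hQ hv (t ha).1 (t hb.2).1 (t hc.2).1 (t hd.2).1 (t ha).2 (t hb.2).2
        (t hc.2).2 (t hd.2).2 (hcl _ ha _ hb.2 hb.1.symm) (hcl _ ha _ hc.2 hc.1.symm)
        (hcl _ ha _ hd.2 hd.1.symm) (hcl _ hb.2 _ hc.2 hbc) (hcl _ hb.2 _ hd.2 hbd)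
        (hcl _ hc.2 _ hd.2 hcd)
    by_cases hcl : ∀ x ∈ T, ∀ y ∈ T, x ≠ y → R x y
    · exact hclique T subset_rfl (by omega) hcl
    push Not at hcl
    obtain ⟨x, hx, x', hx', hxx, hxn⟩ := hcl
    have hT5 : T.card = 5 := by
      by_contra h5
      have h1 := hcom x hx
      have h2 : T.filter (R x) ⊆ (T.erase x).erase x' := by
        intro w hw
        rw [mem_filter] at hw
        simp only [mem_erase]
        refine ⟨?_, ?_, hw.1⟩
        · rintro rfl; exact hxn hw.2
        · rintro rfl; exact hi _ hw.2
      have h3 := Finset.card_le_card h2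
      rw [card_erase_of_mem (by simp [hx', hxx.symm]), card_erase_of_mem hx] at h3
      omega
    by_cases hcl2 : ∀ y ∈ T.erase x, ∀ z ∈ T.erase x, y ≠ z → R y z
    · exact hclique (T.erase x) (erase_subset _ _) (by rw [card_erase_of_mem hx]; omega) hcl2
    push Not at hcl2
    obtain ⟨y, hy, y', hy', hyy, hyn⟩ := hcl2
    rw [mem_erase] at hy hy'
    have hxn' : ¬ R x' x := fun h => hxn (hs _ _ h)
    have hyn' : ¬ R y' y := fun h => hyn (hs _ _ h)
    have hx'y : x' ≠ y := by
      rintro rfl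
      rcases huniq x' hx' x hx y' hy'.2 hxx.symm hyy hy'.1.symm with h | h
      · exact hxn' h
      · exact hyn h
    have hx'y' : x' ≠ y' := by
      rintro rfl
      rcases huniq x' hx' x hx y hy.2 hxx.symm hyy.symm hy.1.symm with h | h
      · exact hxn' h
      · exact hyn' h
    have hz : ((((T.erase x).erase x').erase y).erase y').Nonempty := by
      rw [← Finset.card_pos, card_erase_of_mem (by simp [hy', hx'y'.symm, hyy.symm]),
        card_erase_of_mem (by simp [hy, hx'y.symm]),
        card_erase_of_mem (by simp [hx', hxx.symm]), card_erase_of_mem hx]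
      omega
    obtain ⟨z, hz⟩ := hz
    simp only [mem_erase] at hz
    obtain ⟨hzy', hzy, hzx', hzx, hzT⟩ := hz
    have gx : ∀ w ∈ T, w ≠ x → w ≠ x' → R x w := fun w hw h1 h2 =>
      (huniq x hx x' hx' w hw hxx h1.symm h2.symm).resolve_left hxn
    have gx' : ∀ w ∈ T, w ≠ x → w ≠ x' → R x' w := fun w hw h1 h2 =>
      (huniq x' hx' x hx w hw hxx.symm h2.symm h1.symm).resolve_left hxn'
    have gy : ∀ w ∈ T, w ≠ y → w ≠ y' → R y w := fun w hw h1 h2 =>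
      (huniq y hy.2 y' hy'.2 w hw hyy h1.symm h2.symm).resolve_left hyn
    have gy' : ∀ w ∈ T, w ≠ y → w ≠ y' → R y' w := fun w hw h1 h2 =>
      (huniq y' hy'.2 y hy.2 w hw hyy.symm h2.symm h1.symm).resolve_left hyn'
    have hxy : R x y := gx y hy.2 hy.1 hx'y.symm
    have hvy : v ≠ y := fun h => hi y (h ▸ (hTm.1 hy.2).2)
    refine no_K5 hβ (RC_irrefl hi x y) (QQ_contract hβ hi hQ (hTm.1 hx).1 (hTm.1 hy.2).1 hxy)
      (a := v) (b := x) (c := x') (d := y') (e := z) ?_ ?_ ?_ ?_ ?_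
      (Or.inl (hTm.1 hx).2) (Or.inl (hTm.1 hx').2) (Or.inl (hTm.1 hy'.2).2) (Or.inl (hTm.1 hzT).2)
      (Or.inr (Or.inl ⟨rfl, hxx.symm, gy x' hx' hx'y hx'y'⟩))
      (Or.inl (gx y' hy'.2 hy'.1 hx'y'.symm)) (Or.inl (gx z hzT hzx hzx'))
      (Or.inl (gx' y' hy'.2 hy'.1 hx'y'.symm)) (Or.inl (gx' z hzT hzx hzx'))
      (Or.inl (gy' z hzT hzy hzy')) <;> rw [mem_erase]
    · exact ⟨hvy, hv⟩
    · exact ⟨hy.1.symm, (hTm.1 hx).1⟩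
    · exact ⟨hx'y, (hTm.1 hx').1⟩
    · exact ⟨hyy.symm, (hTm.1 hy'.2).1⟩
    · exact ⟨hzy, (hTm.1 hzT).1⟩

end comb
end LensProof
end PE

section PF
namespace LensProof
open Finset

section cut
variable {α : Type*}

theorem dg_add {S : Finset α} {R R1 R2 : α → α → Prop} {a a1 a2 : α}
    (h : ∀ y ∈ S, (R a y → R1 a1 y ∨ R2 a2 y)) : dg S R a ≤ dg S R1 a1 + dg S R2 a2 := by
  classical
  unfold dg
  rw [← Finset.sum_add_distrib]
  refine Finset.sum_le_sum fun y hy => ?_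
  by_cases h1 : R a y
  · rcases h y hy h1 with h2 | h2 <;> simp [h1, h2]
  · simp [h1]

theorem dg_congr {S : Finset α} {R R' : α → α → Prop} {a : α}
    (h : ∀ y ∈ S, (R a y ↔ R' a y)) : dg S R a = dg S R' a := by
  classical
  unfold dg
  exact Finset.sum_congr rfl fun y hy => if_congr (h y hy) rfl rfl

theorem mm_congr {S : Finset α} {R R' : α → α → Prop}
    (h : ∀ x ∈ S, ∀ y ∈ S, (R x y ↔ R' x y)) : mm S R = mm S R' := by
  classical
  unfold mm
  exact Finset.sum_congr rfl fun x hx => Finset.sum_congr rfl fun y hy =>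
    if_congr (h x hx y hy) rfl rfl

theorem dg_erase [DecidableEq α] {S : Finset α} {R : α → α → Prop} {a b : α} (ha : a ∈ S)
    (hb : R b a) : dg S R b = dg (S.erase a) R b + 1 := by
  classical
  unfold dg
  rw [← Finset.add_sum_erase S _ ha, if_pos hb, add_comm]

theorem mm_two [DecidableEq α] {S : Finset α} {R : α → α → Prop} (hs : ∀ x y, R x y → R y x)
    (hi : ∀ x, ¬ R x x) {a b : α} (ha : a ∈ S) (hb : b ∈ S) (hab : R a b) :
    mm S R = mm ((S.erase b).erase a) R + 2 + 2 * (dg ((S.erase b).erase a) R a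
      + dg ((S.erase b).erase a) R b) := by
  have hne : a ≠ b := fun h => hi b (h ▸ hab)
  have ha' : a ∈ S.erase b := mem_erase.2 ⟨hne, ha⟩
  have e1 := mm_erase hs hi hb
  have e2 := mm_erase hs hi ha'
  have e3 := dg_erase ha (hs _ _ hab)
  have e4 : dg (S.erase b) R a = dg ((S.erase b).erase a) R a := by
    classical
    unfold dg
    rw [← Finset.add_sum_erase _ _ ha', if_neg (hi a), zero_add]
  have e5 : dg (S.erase a) R b = dg ((S.erase b).erase a) R b := by
    classical
    have hb' : b ∈ S.erase a := mem_erase.2 ⟨hne.symm, hb⟩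
    unfold dg
    rw [← Finset.add_sum_erase _ _ hb', if_neg (hi b), zero_add, Finset.erase_right_comm]
  omega

theorem cutx {R : α → α → Prop} (hs : ∀ x y, R x y → R y x) (hi : ∀ x, ¬ R x x) :
    ∀ (N : ℕ) (S : Finset α), S.card ≤ N → ∃ T ⊆ S, ∃ col : α → Bool,
      (∀ x ∈ S, ∀ y ∈ S, R x y → x ∈ T ∨ y ∈ T) ∧
      mm S R + T.card ≤ 2 * mm S (fun x y => R x y ∧ col x ≠ col y) := by
  classical
  intro N
  induction N with
  | zero =>
    intro S hS
    have : S = ∅ := by rw [← Finset.card_eq_zero]; omega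
    subst this
    exact ⟨∅, subset_rfl, fun _ => true, by simp, by simp [mm]⟩
  | succ N ih =>
    intro S hS
    by_cases hE : ∃ a ∈ S, ∃ b ∈ S, R a b
    swap
    · push Not at hE
      refine ⟨∅, empty_subset _, fun _ => true, fun x hx y hy h => absurd h (hE x hx y hy), ?_⟩
      have : mm S R = 0 := by
        unfold mm
        refine Finset.sum_eq_zero fun x hx => Finset.sum_eq_zero fun y hy => ?_
        rw [if_neg (hE x hx y hy)]
      simp [this]
    obtain ⟨a, ha, b, hb, hab⟩ := hE
    have hne : a ≠ b := fun h => hi b (h ▸ hab)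
    have ha' : a ∈ S.erase b := mem_erase.2 ⟨hne, ha⟩
    have hc1 := card_erase_of_mem hb
    have hc2 := card_erase_of_mem ha'
    set S' := (S.erase b).erase a with hS'
    have hSm : ∀ {x}, x ∈ S → x ≠ a → x ≠ b → x ∈ S' := fun h1 h2 h3 =>
      mem_erase.2 ⟨h2, mem_erase.2 ⟨h3, h1⟩⟩
    have haS : a ∉ S' := by simp [hS']
    have hbS : b ∉ S' := by simp [hS']
    have hSS : S' ⊆ S := (erase_subset _ _).trans (erase_subset _ _)
    obtain ⟨T, hT, col, hcov, hm⟩ := ih S' (by omega)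
    have hcov' : ∀ x ∈ S, ∀ y ∈ S, R x y → x ∈ insert a (insert b T) ∨ y ∈ insert a (insert b T) := by
      intro x hx y hy h
      simp only [Finset.mem_insert]
      by_cases h1 : x = a
      · exact Or.inl (Or.inl h1)
      by_cases h2 : x = b
      · exact Or.inl (Or.inr (Or.inl h2))
      by_cases h3 : y = a
      · exact Or.inr (Or.inl h3)
      by_cases h4 : y = b
      · exact Or.inr (Or.inr (Or.inl h4))
      rcases hcov x (hSm hx h1 h2) y (hSm hy h3 h4) h with h | h
      · exact Or.inl (Or.inr (Or.inr h))
      · exact Or.inr (Or.inr (Or.inr h))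
    have hsub : insert a (insert b T) ⊆ S := by
      intro x hx
      simp only [Finset.mem_insert] at hx
      rcases hx with rfl | rfl | hx
      · exact ha
      · exact hb
      · exact hSS (hT hx)
    have hTc : (insert a (insert b T)).card = T.card + 2 := by
      rw [card_insert_of_notMem, card_insert_of_notMem]
      · exact fun h => hbS (hT h)
      · simp only [Finset.mem_insert, not_or]
        exact ⟨hne, fun h => haS (hT h)⟩
    have e0 := mm_two hs hi ha hb hab
    rw [← hS'] at e0
    -- the coloring
    let cl : Bool → α → Bool := fun c x => if x = a then c else if x = b then !c else col x
    have hcl : ∀ c, ∀ x ∈ S', cl c x = col x := by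
      intro c x hx
      have h1 : x ≠ a := fun h => haS (h ▸ hx)
      have h2 : x ≠ b := fun h => hbS (h ▸ hx)
      simp [cl, h1, h2]
    have hca : ∀ c, cl c a = c := fun c => by simp [cl]
    have hcb : ∀ c, cl c b = !c := fun c => by simp [cl, hne.symm]
    have e1 : ∀ c, mm S (fun x y => R x y ∧ cl c x ≠ cl c y) =
        mm S' (fun x y => R x y ∧ col x ≠ col y) + 2 +
        2 * (dg S' (fun x y => R x y ∧ cl c x ≠ cl c y) a +
          dg S' (fun x y => R x y ∧ cl c x ≠ cl c y) b) := by
      intro c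
      rw [mm_two (R := fun x y => R x y ∧ cl c x ≠ cl c y) (fun x y h => ⟨hs _ _ h.1, h.2.symm⟩)
        (fun x h => hi _ h.1) ha hb ⟨hab, by rw [hca, hcb]; simp⟩]
      congr 2
      refine mm_congr fun x hx y hy => ?_
      rw [hcl c x hx, hcl c y hy]
    have e2 : dg S' R a ≤ dg S' (fun x y => R x y ∧ cl true x ≠ cl true y) a +
        dg S' (fun x y => R x y ∧ cl false x ≠ cl false y) a := by
      refine dg_add fun y hy h => ?_
      simp only [hca, hcl _ y hy]
      cases col y <;> simp [h]
    have e3 : dg S' R b ≤ dg S' (fun x y => R x y ∧ cl true x ≠ cl true y) b +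
        dg S' (fun x y => R x y ∧ cl false x ≠ cl false y) b := by
      refine dg_add fun y hy h => ?_
      simp only [hcb, hcl _ y hy]
      cases col y <;> simp [h]
    have f1 := e1 true
    have f2 := e1 false
    by_cases hch : dg S' R a + dg S' R b ≤ 2 * (dg S' (fun x y => R x y ∧ cl true x ≠ cl true y) a +
        dg S' (fun x y => R x y ∧ cl true x ≠ cl true y) b)
    · exact ⟨_, hsub, cl true, hcov', by omega⟩
    · exact ⟨_, hsub, cl false, hcov', by omega⟩

theorem cut_bound {R : α → α → Prop} (hs : ∀ x y, R x y → R y x) (hi : ∀ x, ¬ R x x)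
    (S : Finset α) (H : ∀ S' ⊆ S, ∀ col : α → Bool,
      mm S' (fun x y => R x y ∧ col x ≠ col y) ≤ 6 * S'.card) :
    13 * mm S R ≤ 150 * S.card := by
  classical
  obtain ⟨T, hT, col, hcov, hm⟩ := cutx hs hi _ S le_rfl
  obtain ⟨T2, hT2, col2, hcov2, hm2⟩ := cutx hs hi _ T le_rfl
  have h1 := H S subset_rfl col
  have h2 := H T hT col2
  have h3 := H S subset_rfl (fun x => decide (x ∈ T))
  have h4 : mm S R ≤ mm S (fun x y => R x y ∧ decide (x ∈ T) ≠ decide (y ∈ T)) + mm T R := by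
    have : mm T R = mm S (fun x y => R x y ∧ x ∈ T ∧ y ∈ T) := by
      unfold mm
      symm
      rw [← Finset.sum_subset hT]
      · refine Finset.sum_congr rfl fun x hx => ?_
        rw [← Finset.sum_subset hT]
        · exact Finset.sum_congr rfl fun y hy => by simp [hx, hy]
        · intro y _ hy; simp [hy]
      · intro x _ hx; simp [hx]
    rw [this]
    unfold mm
    simp only [← Finset.sum_add_distrib]
    refine Finset.sum_le_sum fun x hx => Finset.sum_le_sum fun y hy => ?_
    by_cases h : R x y
    · have := hcov x hx y hy h
      by_cases hx : x ∈ T <;> by_cases hy : y ∈ T <;> simp_all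
    · simp [h]
  omega

end cut
end LensProof
end PF

section PG
namespace LensProof
open Finset

section sampling
variable {α : Type*}

theorem weight_sum [DecidableEq α] (V A X : Finset α) (hA : A ⊆ V) (hX : X ⊆ V)
    (hAX : Disjoint A X) (p q : ℝ) (hpq : p + q = 1) :
    ∑ S ∈ V.powerset, (p ^ S.card * q ^ (V \ S).card) * (if A ⊆ S ∧ Disjoint X S then 1 else 0) =
      p ^ A.card * q ^ X.card := by
  have h := Finset.prod_add (fun w => if w ∈ X then 0 else p) (fun w => if w ∈ A then 0 else q) V
  have h1 : ∀ S ∈ V.powerset, (∏ a ∈ S, (if a ∈ X then 0 else p)) *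
      (∏ a ∈ V \ S, (if a ∈ A then 0 else q)) =
      (p ^ S.card * q ^ (V \ S).card) * (if A ⊆ S ∧ Disjoint X S then 1 else 0) := by
    intro S hS
    by_cases hXS : Disjoint X S
    · have e1 : (∏ a ∈ S, (if a ∈ X then 0 else p)) = p ^ S.card := by
        rw [Finset.prod_congr rfl, Finset.prod_const]
        intro a ha
        rw [if_neg]
        exact fun h => Finset.disjoint_left.1 hXS h ha
      rw [e1]
      by_cases hAS : A ⊆ S
      · have e2 : (∏ a ∈ V \ S, (if a ∈ A then 0 else q)) = q ^ (V \ S).card := by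
          rw [Finset.prod_congr rfl, Finset.prod_const]
          intro a ha
          rw [if_neg]
          exact fun h => (mem_sdiff.1 ha).2 (hAS h)
        rw [e2, if_pos ⟨hAS, hXS⟩, mul_one]
      · rw [if_neg (fun h => hAS h.1), mul_zero]
        obtain ⟨a, ha, haS⟩ := Finset.not_subset.1 hAS
        rw [Finset.prod_eq_zero (i := a) (mem_sdiff.2 ⟨hA ha, haS⟩) (by simp [ha]), mul_zero]
    · rw [if_neg (fun h => hXS h.2), mul_zero]
      obtain ⟨a, ha, haS⟩ := Finset.not_disjoint_iff.1 hXS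
      rw [Finset.prod_eq_zero (i := a) haS (by simp [ha]), zero_mul]
  rw [Finset.sum_congr rfl h1] at h
  rw [← h]
  have h2 : ∀ w ∈ V, (if w ∈ X then 0 else p) + (if w ∈ A then 0 else q) =
      (if w ∈ A then p else 1) * (if w ∈ X then q else 1) := by
    intro w _
    by_cases h1 : w ∈ A
    · have : w ∉ X := Finset.disjoint_left.1 hAX h1
      simp [h1, this]
    · by_cases h2 : w ∈ X <;> simp [h1, h2, hpq]
  rw [Finset.prod_congr rfl h2, Finset.prod_mul_distrib, Finset.prod_ite_mem, Finset.prod_ite_mem,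
    Finset.inter_eq_right.2 hA, Finset.inter_eq_right.2 hX, Finset.prod_const, Finset.prod_const]

theorem q_bound (M : ℕ) (hM : 1 ≤ M) : (1 : ℝ) ≤ (1 - 1 / (M : ℝ)) ^ (M - 1) * 2.71829 := by
  obtain ⟨m, rfl⟩ : ∃ m, M = m + 1 := ⟨M - 1, by omega⟩
  rcases Nat.eq_zero_or_pos m with rfl | hm
  · norm_num
  have hm' : (0 : ℝ) < m := by exact_mod_cast hm
  have h1 : (1 + 1 / (m : ℝ)) ^ m ≤ Real.exp 1 := by
    have := Real.add_one_le_exp (1 / (m : ℝ))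
    calc (1 + 1 / (m : ℝ)) ^ m ≤ (Real.exp (1 / (m : ℝ))) ^ m := by
          refine pow_le_pow_left₀ (by positivity) (by linarith) _
      _ = Real.exp 1 := by
          rw [← Real.exp_nat_mul]; congr 1; field_simp
  have h2 : (1 - 1 / ((m + 1 : ℕ) : ℝ)) = (1 + 1 / (m : ℝ))⁻¹ := by
    push_cast
    field_simp
    ring
  rw [h2, Nat.add_sub_cancel, inv_pow, inv_mul_eq_div, le_div_iff₀ (by positivity)]
  have := Real.exp_one_lt_d9
  linarith

theorem sampling [DecidableEq α] (V : Finset α) (R : α → α → Prop) (hi : ∀ x, ¬ R x x)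
    (X : α → α → Finset α) (M : ℕ) (hM : 1 ≤ M)
    (hX : ∀ u v, R u v → u ∉ X u v ∧ v ∉ X u v ∧ X u v ⊆ V ∧ (X u v).card < M)
    (H : ∀ S ⊆ V, 13 * mm S (fun u v => R u v ∧ Disjoint (X u v) S) ≤ 150 * S.card) :
    mm V R ≤ 32 * M * V.card := by
  classical
  set p : ℝ := 1 / M with hp
  set q : ℝ := 1 - 1 / M with hq
  have hM' : (1 : ℝ) ≤ M := by exact_mod_cast hM
  have hp0 : 0 < p := by positivity
  have hq0 : 0 ≤ q := by
    rw [hq, sub_nonneg, div_le_one (by linarith)]; exact hM'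
  have hq1 : q ≤ 1 := by rw [hq]; linarith
  have hpq : p + q = 1 := by rw [hp, hq]; ring
  -- the right-hand side
  have hR : ∑ S ∈ V.powerset, (p ^ S.card * q ^ (V \ S).card) * (S.card : ℝ) = V.card * p := by
    have e : ∀ S ∈ V.powerset, (p ^ S.card * q ^ (V \ S).card) * (S.card : ℝ) =
        ∑ u ∈ V, (p ^ S.card * q ^ (V \ S).card) *
          (if {u} ⊆ S ∧ Disjoint (∅ : Finset α) S then 1 else 0) := by
      intro S hS
      rw [← Finset.mul_sum]
      congr 1
      simp only [Finset.singleton_subset_iff, Finset.disjoint_empty_left, and_true]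
      rw [Finset.sum_ite_mem, Finset.inter_eq_right.2 (mem_powerset.1 hS)]
      simp
    rw [Finset.sum_congr rfl e, Finset.sum_comm]
    rw [Finset.sum_congr rfl (fun u hu => weight_sum V {u} ∅ (by simpa using hu) (empty_subset _)
      (disjoint_empty_right _) p q hpq)]
    simp
  -- the left-hand side
  have hL : ∑ S ∈ V.powerset, (p ^ S.card * q ^ (V \ S).card) *
      (mm S (fun u v => R u v ∧ Disjoint (X u v) S) : ℝ) =
      ∑ u ∈ V, ∑ v ∈ V, if R u v then p ^ 2 * q ^ (X u v).card else 0 := by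
    have e : ∀ S ∈ V.powerset, (p ^ S.card * q ^ (V \ S).card) *
        (mm S (fun u v => R u v ∧ Disjoint (X u v) S) : ℝ) =
        ∑ u ∈ V, ∑ v ∈ V, if R u v then (p ^ S.card * q ^ (V \ S).card) *
          (if {u, v} ⊆ S ∧ Disjoint (X u v) S then 1 else 0) else 0 := by
      intro S hS
      have hSV := mem_powerset.1 hS
      have e2 : (mm S (fun u v => R u v ∧ Disjoint (X u v) S) : ℝ) =
          ∑ u ∈ V, ∑ v ∈ V, if R u v then
            (if {u, v} ⊆ S ∧ Disjoint (X u v) S then 1 else 0) else 0 := by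
        unfold mm
        push_cast
        symm
        rw [← Finset.sum_subset hSV]
        · refine Finset.sum_congr rfl fun x hx => ?_
          rw [← Finset.sum_subset hSV]
          · refine Finset.sum_congr rfl fun y hy => ?_
            by_cases h1 : R x y <;> by_cases h2 : Disjoint (X x y) S <;>
              simp [h1, h2, hx, hy, Finset.insert_subset_iff]
          · intro y _ hy; simp [hy, Finset.insert_subset_iff]
        · intro x _ hx; simp [hx, Finset.insert_subset_iff]
      rw [e2, Finset.mul_sum]
      refine Finset.sum_congr rfl fun x hx => ?_
      rw [Finset.mul_sum]
      refine Finset.sum_congr rfl fun y hy => ?_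
      by_cases h1 : R x y <;> simp [h1]
    rw [Finset.sum_congr rfl e, Finset.sum_comm]
    refine Finset.sum_congr rfl fun u hu => ?_
    rw [Finset.sum_comm]
    refine Finset.sum_congr rfl fun v hv => ?_
    by_cases h1 : R u v
    · simp only [if_pos h1]
      obtain ⟨h2, h3, h4, h5⟩ := hX u v h1
      have huv : u ≠ v := fun h => hi v (h ▸ h1)
      rw [weight_sum V {u, v} (X u v) (by simp [Finset.insert_subset_iff, hu, hv]) h4
        (by simp [h2, h3]) p q hpq, card_pair huv]
    · simp [h1]
  have hL2 : p ^ 2 * q ^ (M - 1) * mm V R ≤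
      ∑ u ∈ V, ∑ v ∈ V, if R u v then p ^ 2 * q ^ (X u v).card else 0 := by
    unfold mm
    push_cast
    rw [Finset.mul_sum]
    refine Finset.sum_le_sum fun u hu => ?_
    rw [Finset.mul_sum]
    refine Finset.sum_le_sum fun v hv => ?_
    by_cases h1 : R u v
    · simp only [if_pos h1, mul_one]
      have := (hX u v h1).2.2.2
      exact mul_le_mul_of_nonneg_left (pow_le_pow_of_le_one hq0 hq1 (by omega)) (by positivity)
    · simp [h1]
  have hsum : ∑ S ∈ V.powerset, 13 * ((p ^ S.card * q ^ (V \ S).card) *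
      (mm S (fun u v => R u v ∧ Disjoint (X u v) S) : ℝ)) ≤
      ∑ S ∈ V.powerset, 150 * ((p ^ S.card * q ^ (V \ S).card) * (S.card : ℝ)) := by
    refine Finset.sum_le_sum fun S hS => ?_
    have h1 : (13 : ℝ) * mm S (fun u v => R u v ∧ Disjoint (X u v) S) ≤ 150 * S.card := by
      exact_mod_cast H S (mem_powerset.1 hS)
    have h2 : 0 ≤ p ^ S.card * q ^ (V \ S).card := by positivity
    nlinarith [mul_le_mul_of_nonneg_left h1 h2]
  rw [← Finset.mul_sum, ← Finset.mul_sum, hL, hR] at hsum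
  have hqb : (1 : ℝ) ≤ q ^ (M - 1) * 2.71829 := q_bound M hM
  have h3 : 13 * (p ^ 2 * q ^ (M - 1) * mm V R) ≤ 150 * (V.card * p) :=
    (mul_le_mul_of_nonneg_left hL2 (by norm_num)).trans hsum
  have hpM : p * M = 1 := by rw [hp]; field_simp
  have h4 : 13 * (q ^ (M - 1) * mm V R) ≤ 150 * (V.card * (M : ℝ)) := by
    have := mul_le_mul_of_nonneg_right h3 (by positivity : (0 : ℝ) ≤ M ^ 2)
    calc 13 * (q ^ (M - 1) * mm V R) = 13 * (p ^ 2 * q ^ (M - 1) * mm V R) * M ^ 2 := by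
          linear_combination (-13 * q ^ (M - 1) * mm V R) * (p * M + 1) * hpM
      _ ≤ _ := this
      _ = _ := by linear_combination (150 * V.card * (M : ℝ)) * hpM
  have h5 : (mm V R : ℝ) ≤ q ^ (M - 1) * mm V R * 2.71829 := by
    have := mul_le_mul_of_nonneg_right hqb (Nat.cast_nonneg (α := ℝ) (mm V R))
    linarith
  have h6 : (0 : ℝ) ≤ V.card * (M : ℝ) := by positivity
  have : (mm V R : ℝ) ≤ 32 * M * V.card := by linarith
  exact_mod_cast this

end sampling
end LensProof
end PG

section PH
namespace LensProof
open Finset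

section count

theorem main_count (V : Finset ℂ) (o : ℂ) (R : ℂ → ℂ → Prop) (hs : ∀ x y, R x y → R y x)
    (hi : ∀ x, ¬ R x x) (X : ℂ → ℂ → Finset ℂ) (hXs : ∀ u v, X u v = X v u)
    (M : ℕ) (hM : 1 ≤ M)
    (hX : ∀ u v, R u v → u ∉ X u v ∧ v ∉ X u v ∧ X u v ⊆ V ∧ (X u v).card < M)
    (P : ℂ → ℂ → (II → ℂ) → Prop)
    (hPc : ∀ u v e, P u v e → Continuous e) (hP0 : ∀ u v e, P u v e → e 0 = u)
    (hP1 : ∀ u v e, P u v e → e 1 = v) (hPo : ∀ u v e, P u v e → ∀ s, e s ≠ o)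
    (hPV : ∀ u v e, P u v e → ∀ w ∈ V, w ≠ u → w ≠ v → ∀ s, e s ≠ w)
    (hPx : ∀ a b c d e f, P a b e → P c d f → a ≠ c → a ≠ d → b ≠ c → b ≠ d →
      ∀ s t s' t', e s = f t → e s' = f t' → s = s' ∧ t = t')
    (hdata : ∀ u v, R u v → ∃ e f : II → ℂ, P u v e ∧ P u v f ∧
      (∃ m : ℤ, Odd m ∧ dl (fun s => e s - o) - dl (fun s => f s - o) =
        m * (2 * Real.pi * Complex.I)) ∧
      ∀ w ∈ V, w ≠ u → w ≠ v → w ∉ X u v → dl (fun s => e s - w) = dl (fun s => f s - w)) :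
    mm V R ≤ 32 * M * V.card := by
  classical
  refine sampling V R hi X M hM hX ?_
  intro S hSV
  refine cut_bound (R := fun u v => R u v ∧ Disjoint (X u v) S)
    (fun x y h => ⟨hs _ _ h.1, by rw [hXs]; exact h.2⟩) (fun x h => hi x h.1) S ?_
  intro S' hS' col
  rcases S'.eq_empty_or_nonempty with rfl | hne
  · simp [mm]
  have hd : ∀ u v, ∃ e f : II → ℂ, R u v → P u v e ∧ P u v f ∧
      (∃ m : ℤ, Odd m ∧ dl (fun s => e s - o) - dl (fun s => f s - o) =
        m * (2 * Real.pi * Complex.I)) ∧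
      ∀ w ∈ V, w ≠ u → w ≠ v → w ∉ X u v → dl (fun s => e s - w) = dl (fun s => f s - w) := by
    intro u v
    by_cases h : R u v
    · obtain ⟨e, f, h'⟩ := hdata u v h
      exact ⟨e, f, fun _ => h'⟩
    · exact ⟨fun _ => 0, fun _ => 0, fun h' => absurd h' h⟩
  choose e f hef using hd
  have := mader (β := fun x y => ((BB x y : ℤ) : ZMod 2)) (fun x y h => BB_add h)
    (col := fun x => if col x then 1 else 0) S'.card _ S'
    (fun x y => (R x y ∧ Disjoint (X x y) S) ∧ col x ≠ col y)
    (fun a b w => ((NN (e a b) w : ℤ) : ZMod 2)) le_rfl rfl hne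
    (fun x y h => ⟨⟨hs _ _ h.1.1, by rw [hXs]; exact h.1.2⟩, h.2.symm⟩)
    (fun x h => hi x h.1.1) ?_
  · omega
  intro a ha b hb c hc d hd hac had hbc hbd hab hcd
  have hcol : ∀ x y : Bool, x ≠ y → (((if x then 1 else 0) + (if y then 1 else 0) : ZMod 2)) = 1 := by
    decide
  rw [hcol _ _ hab.2, hcol _ _ hcd.2, mul_one]
  obtain ⟨p1, p2, ⟨m, hm, hw⟩, hz⟩ := hef a b hab.1.1
  obtain ⟨q1, q2, ⟨l, hl, hw'⟩, hz'⟩ := hef c d hcd.1.1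
  have nX : ∀ {x y z}, Disjoint (X x y) S → z ∈ S' → z ∉ X x y := fun h hz hz' =>
    Finset.disjoint_left.1 h hz' (hS' hz)
  have iV : ∀ {z}, z ∈ S' → z ∈ V := fun h => hSV (hS' h)
  obtain ⟨x, hx, hix⟩ := main_ix (hPc _ _ _ p1) (hPc _ _ _ p2) (hPc _ _ _ q1) (hPc _ _ _ q2)
    (hP0 _ _ _ p1) (hP1 _ _ _ p1) (hP0 _ _ _ p2) (hP1 _ _ _ p2)
    (hP0 _ _ _ q1) (hP1 _ _ _ q1) (hP0 _ _ _ q2) (hP1 _ _ _ q2)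
    (hPo _ _ _ p1) (hPo _ _ _ p2) (hPo _ _ _ q1) (hPo _ _ _ q2)
    (hPV _ _ _ p1 c (iV hc) hac.symm hbc.symm) (hPV _ _ _ p1 d (iV hd) had.symm hbd.symm)
    (hPV _ _ _ p2 c (iV hc) hac.symm hbc.symm) (hPV _ _ _ p2 d (iV hd) had.symm hbd.symm)
    (hPV _ _ _ q1 a (iV ha) hac had) (hPV _ _ _ q1 b (iV hb) hbc hbd)
    (hPV _ _ _ q2 a (iV ha) hac had) (hPV _ _ _ q2 b (iV hb) hbc hbd)
    hm hl hw hw'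
    (hz c (iV hc) hac.symm hbc.symm (nX hab.1.2 hc)) (hz d (iV hd) had.symm hbd.symm (nX hab.1.2 hd))
    (hz' a (iV ha) hac had (nX hcd.1.2 ha)) (hz' b (iV hb) hbc hbd (nX hcd.1.2 hb))
    (hPx _ _ _ _ _ _ p1 q1 hac had hbc hbd) (hPx _ _ _ _ _ _ p1 q2 hac had hbc hbd)
    (hPx _ _ _ _ _ _ p2 q1 hac had hbc hbd) (hPx _ _ _ _ _ _ p2 q2 hac had hbc hbd)
  exact disc (hPc _ _ _ p1) (hPc _ _ _ q1) (hP0 _ _ _ p1) (hP1 _ _ _ p1) (hP0 _ _ _ q1)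
    (hP1 _ _ _ q1)
    (hPV _ _ _ p1 c (iV hc) hac.symm hbc.symm) (hPV _ _ _ p1 d (iV hd) had.symm hbd.symm)
    (hPV _ _ _ q1 a (iV ha) hac had) (hPV _ _ _ q1 b (iV hb) hbc hbd) hx hix

end count
end LensProof
end PH

namespace LensProof
open Set

/-- Identification of the plane with the complex numbers. -/
noncomputable def ph : ℝ × ℝ ≃ₜ ℂ := Complex.equivRealProdCLM.symm.toHomeomorph

section final
variable (G : TopMultigraph)

/-- `e` is an edge of `G`, transported to `ℂ` and oriented from `u` to `v`. -/
def PP (u v : ℂ) (e : II → ℂ) : Prop :=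
  ∃ (g : G.ι) (τ : II → II), (τ = id ∨ τ = unitInterval.symm) ∧ (∀ s, e s = ph (G.arc g (τ s))) ∧
    e 0 = u ∧ e 1 = v

theorem tau_inj {τ : II → II} (h : τ = id ∨ τ = unitInterval.symm) : Function.Injective τ := by
  rcases h with rfl | rfl
  · exact Function.injective_id
  · exact unitInterval.symm_bijective.injective

theorem tau_cont {τ : II → II} (h : τ = id ∨ τ = unitInterval.symm) : Continuous τ := by
  rcases h with rfl | rfl
  · exact continuous_id
  · exact unitInterval.continuous_symm

theorem tau_end {τ : II → II} (h : τ = id ∨ τ = unitInterval.symm) {s : II}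
    (hs : τ s = 0 ∨ τ s = 1) : s = 0 ∨ s = 1 := by
  rcases h with rfl | rfl
  · exact hs
  · rcases hs with hs | hs
    · right; rw [← unitInterval.symm_symm s, hs]; simp
    · left; rw [← unitInterval.symm_symm s, hs]; simp

theorem tau_ends {τ : II → II} (h : τ = id ∨ τ = unitInterval.symm) :
    (τ 0 = 0 ∧ τ 1 = 1) ∨ (τ 0 = 1 ∧ τ 1 = 0) := by
  rcases h with rfl | rfl
  · left; simp
  · right; simp

variable {G}

theorem PP.cont {u v : ℂ} {e : II → ℂ} (h : PP G u v e) : Continuous e := by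
  obtain ⟨g, τ, hτ, he, -⟩ := h
  rw [show e = fun s => ph (G.arc g (τ s)) from funext he]
  exact ph.continuous.comp ((G.continuous_arc g).comp (tau_cont hτ))

theorem PP.avoid {u v : ℂ} {e : II → ℂ} (h : PP G u v e) {w : ℝ × ℝ} (hw : w ∈ G.V)
    (hu : ph w ≠ u) (hv : ph w ≠ v) (s : II) : e s ≠ ph w := by
  obtain ⟨g, τ, hτ, he, h0, h1⟩ := h
  intro hs
  have h2 : G.arc g (τ s) = w := ph.injective (by rw [← he, hs])
  have h3 : τ s = 0 ∨ τ s = 1 := by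
    by_contra! h
    exact G.interior_avoids g _ h.1 h.2 (h2 ▸ hw)
  rcases tau_end hτ h3 with rfl | rfl
  · exact hu (hs ▸ h0)
  · exact hv (hs ▸ h1)

theorem PP.mem {u v : ℂ} {e : II → ℂ} (h : PP G u v e) :
    (∃ w ∈ G.V, u = ph w) ∧ (∃ w ∈ G.V, v = ph w) := by
  obtain ⟨g, τ, hτ, he, h0, h1⟩ := h
  rw [← h0, ← h1, he, he]
  rcases tau_ends hτ with ⟨a, b⟩ | ⟨a, b⟩ <;> rw [a, b]
  · exact ⟨⟨_, G.source_mem g, rfl⟩, ⟨_, G.target_mem g, rfl⟩⟩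
  · exact ⟨⟨_, G.target_mem g, rfl⟩, ⟨_, G.source_mem g, rfl⟩⟩

theorem PP.cross (hsc : G.SingleCrossing) {a b c d : ℂ} {e f : II → ℂ} (he : PP G a b e)
    (hf : PP G c d f) (hac : a ≠ c) (had : a ≠ d) (hbc : b ≠ c) (hbd : b ≠ d)
    (s t s' t' : II) (h : e s = f t) (h' : e s' = f t') : s = s' ∧ t = t' := by
  have hint : ∀ s t, e s = f t → (s ≠ 0 ∧ s ≠ 1) ∧ (t ≠ 0 ∧ t ≠ 1) := by
    intro s t h
    obtain ⟨⟨a', ha', rfl⟩, ⟨b', hb', rfl⟩⟩ := he.mem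
    obtain ⟨⟨c', hc', rfl⟩, ⟨d', hd', rfl⟩⟩ := hf.mem
    have e0 : e 0 = _ := he.choose_spec.choose_spec.2.2.1
    have e1 : e 1 = _ := he.choose_spec.choose_spec.2.2.2
    have f0 : f 0 = _ := hf.choose_spec.choose_spec.2.2.1
    have f1 : f 1 = _ := hf.choose_spec.choose_spec.2.2.2
    refine ⟨⟨?_, ?_⟩, ?_, ?_⟩
    · rintro rfl; exact hf.avoid ha' hac had t (h.symm.trans e0)
    · rintro rfl; exact hf.avoid hb' hbc hbd t (h.symm.trans e1)
    · rintro rfl; exact he.avoid hc' hac.symm hbc.symm s (h.trans f0)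
    · rintro rfl; exact he.avoid hd' had.symm hbd.symm s (h.trans f1)
  obtain ⟨g, τ, hτ, hg, e0, e1⟩ := he
  obtain ⟨g', τ', hτ', hg', f0, f1⟩ := hf
  have hne : g ≠ g' := by
    rintro rfl
    rw [hg] at e0 e1
    rw [hg'] at f0 f1
    rcases tau_ends hτ with ⟨x, y⟩ | ⟨x, y⟩ <;> rcases tau_ends hτ' with ⟨z, w⟩ | ⟨z, w⟩ <;>
      rw [x] at e0 <;> rw [y] at e1 <;> rw [z] at f0 <;> rw [w] at f1
    · exact hac (e0.symm.trans f0)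
    · exact had (e0.symm.trans f1)
    · exact had (e0.symm.trans f1)
    · exact hac (e0.symm.trans f0)
  have hI : ∀ s t, e s = f t → G.arc g (τ s) ∈ G.arcInterior g ∩ G.arcInterior g' := by
    intro s t h
    obtain ⟨h1, h2⟩ := hint s t h
    refine ⟨⟨τ s, ⟨fun h => ?_, fun h => ?_⟩, rfl⟩, ⟨τ' t, ⟨fun h => ?_, fun h => ?_⟩, ?_⟩⟩
    · rcases tau_end hτ (Or.inl h) with h | h
      · exact h1.1 h
      · exact h1.2 h
    · rcases tau_end hτ (Or.inr h) with h | h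
      · exact h1.1 h
      · exact h1.2 h
    · rcases tau_end hτ' (Or.inl h) with h | h
      · exact h2.1 h
      · exact h2.2 h
    · rcases tau_end hτ' (Or.inr h) with h | h
      · exact h2.1 h
      · exact h2.2 h
    · rw [hg, hg'] at h
      exact ph.injective h.symm
  have hp := hsc g g' hne (hI s t h) (hI s' t' h')
  refine ⟨tau_inj hτ (G.injective_arc g hp), ?_⟩
  have : e s = e s' := by rw [hg, hg, hp]
  rw [this, h', hg', hg'] at h
  exact (tau_inj hτ' (G.injective_arc g' (ph.injective h))).symm

theorem joins_comm {e : G.ι} {u v : ℝ × ℝ} : G.Joins e u v ↔ G.Joins e v u := by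
  unfold TopMultigraph.Joins
  rw [Set.pair_comm]

theorem pairUnion_comm (u v : ℝ × ℝ) : G.pairUnion u v = G.pairUnion v u := by
  unfold TopMultigraph.pairUnion
  simp only [joins_comm (u := u) (v := v)]

theorem isLensAt_comm {u v : ℝ × ℝ} {l : Set (ℝ × ℝ)} (h : G.IsLensAt u v l) :
    G.IsLensAt v u l := by
  obtain ⟨h1, ⟨e, he⟩, h3, h4, h5⟩ := h
  refine ⟨h1.symm, ⟨e, joins_comm.1 he⟩,
    fun e f he hf => h3 e f (joins_comm.1 he) (joins_comm.1 hf), h4, ?_⟩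
  rw [pairUnion_comm]; exact h5

theorem joins_cases {e : G.ι} {u v : ℝ × ℝ} (h : G.Joins e u v) :
    (G.arc e 0 = u ∧ G.arc e 1 = v) ∨ (G.arc e 0 = v ∧ G.arc e 1 = u) := by
  have h' : ({G.arc e 0, G.arc e 1} : Set (ℝ × ℝ)) = {u, v} := h
  exact Set.pair_eq_pair_iff.1 h'

theorem joins_mem {e : G.ι} {u v : ℝ × ℝ} (h : G.Joins e u v) : u ∈ G.V ∧ v ∈ G.V := by
  rcases joins_cases h with ⟨rfl, rfl⟩ | ⟨rfl, rfl⟩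
  · exact ⟨G.source_mem e, G.target_mem e⟩
  · exact ⟨G.target_mem e, G.source_mem e⟩

theorem joins_mem_union {e : G.ι} {u v : ℝ × ℝ} (h : G.Joins e u v) :
    u ∈ G.pairUnion u v ∧ v ∈ G.pairUnion u v := by
  have : ∀ s, G.arc e s ∈ G.pairUnion u v := fun s =>
    Set.mem_biUnion (show e ∈ {e : G.ι | G.Joins e u v} from h) ⟨s, rfl⟩
  rcases joins_cases h with ⟨h1, h2⟩ | ⟨h1, h2⟩
  · exact ⟨h1 ▸ this 0, h2 ▸ this 1⟩
  · exact ⟨h2 ▸ this 1, h1 ▸ this 0⟩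

open Classical in
/-- The orientation of an edge. -/
noncomputable def ta (u : ℝ × ℝ) (g : G.ι) : II → II :=
  if G.arc g 0 = u then id else unitInterval.symm

theorem ta_spec (u : ℝ × ℝ) (g : G.ι) : ta u g = id ∨ ta u g = unitInterval.symm := by
  unfold ta
  split_ifs <;> simp

/-- The oriented family of edges joining `u` and `v`. -/
noncomputable def fa (u v : ℝ × ℝ) (g : {g : G.ι // G.Joins g u v}) : II → ℂ :=
  fun s => ph (G.arc g (ta u g.1 s))

theorem fa_zero {u v : ℝ × ℝ} (g : {g : G.ι // G.Joins g u v}) : fa u v g 0 = ph u := by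
  unfold fa ta
  split_ifs with h
  · simp [h]
  · rcases joins_cases g.2 with ⟨h1, h2⟩ | ⟨h1, h2⟩
    · exact absurd h1 h
    · simp [h2]

theorem fa_one {u v : ℝ × ℝ} (huv : u ≠ v) (g : {g : G.ι // G.Joins g u v}) :
    fa u v g 1 = ph v := by
  unfold fa ta
  split_ifs with h
  · rcases joins_cases g.2 with ⟨h1, h2⟩ | ⟨h1, h2⟩
    · simp [h2]
    · exact absurd (h.symm.trans h1) huv
  · rcases joins_cases g.2 with ⟨h1, h2⟩ | ⟨h1, h2⟩
    · exact absurd h1 h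
    · simp [h1]

theorem fa_PP {u v : ℝ × ℝ} (huv : u ≠ v) (g : {g : G.ι // G.Joins g u v}) :
    PP G (ph u) (ph v) (fa u v g) :=
  ⟨g.1, ta u g.1, ta_spec u g.1, fun _ => rfl, fa_zero g, fa_one huv g⟩

theorem fa_fam {u v : ℝ × ℝ} (huv : u ≠ v)
    (hnc : ∀ e f : G.ι, G.Joins e u v → G.Joins f u v → e ≠ f → ¬ G.Cross e f) :
    Fam (fa (G := G) u v) (ph u) (ph v) where
  cont g := (fa_PP huv g).cont
  zero := fa_zero
  one := fa_one huv
  meet := by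
    intro g g' s t h
    have h' : G.arc g (ta u g.1 s) = G.arc g' (ta u g'.1 t) := ph.injective h
    by_cases hg : g = g'
    · subst hg
      exact Or.inl ⟨rfl, tau_inj (ta_spec u g.1) (G.injective_arc _ h')⟩
    right
    have hg' : g.1 ≠ g'.1 := fun h => hg (Subtype.ext h)
    have hc := hnc g.1 g'.1 g.2 g'.2 hg'
    have hV : ∀ (g : G.ι) (s : II), s = 0 ∨ s = 1 → G.arc g s ∈ G.V := by
      rintro g s (rfl | rfl)
      · exact G.source_mem g
      · exact G.target_mem g
    have hs : ta u g.1 s = 0 ∨ ta u g.1 s = 1 := by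
      by_contra! hs
      by_cases ht : ta u g'.1 t = 0 ∨ ta u g'.1 t = 1
      · exact G.interior_avoids g _ hs.1 hs.2 (h' ▸ hV _ _ ht)
      · push Not at ht
        exact hc ⟨_, ⟨_, hs, rfl⟩, ⟨_, ht, h'.symm⟩⟩
    have ht : ta u g'.1 t = 0 ∨ ta u g'.1 t = 1 := by
      by_contra! ht
      exact G.interior_avoids g' _ ht.1 ht.2 (h' ▸ hV _ _ hs)
    rcases tau_end (ta_spec u g.1) hs with rfl | rfl <;>
      rcases tau_end (ta_spec u g'.1) ht with rfl | rfl
    · exact Or.inl ⟨rfl, rfl⟩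
    · rw [fa_zero, fa_one huv] at h
      exact absurd (ph.injective h) huv
    · rw [fa_zero, fa_one huv] at h
      exact absurd (ph.injective h.symm) huv
    · exact Or.inr ⟨rfl, rfl⟩

theorem fa_KK (u v : ℝ × ℝ) : KK (fa (G := G) u v) = ph '' G.pairUnion u v := by
  ext z
  simp only [KK, TopMultigraph.pairUnion, Set.mem_iUnion, Set.mem_range, Set.mem_image]
  constructor
  · rintro ⟨g, s, rfl⟩
    exact ⟨_, ⟨g.1, g.2, _, rfl⟩, rfl⟩
  · rintro ⟨_, ⟨g, hg, s, rfl⟩, rfl⟩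
    refine ⟨⟨g, hg⟩, ?_⟩
    unfold fa
    rcases ta_spec u g with h | h
    · exact ⟨s, by rw [h]; rfl⟩
    · exact ⟨unitInterval.symm s, by rw [h]; simp⟩

end final
end LensProof

namespace LensProof
open Set

section final2
variable {G : TopMultigraph}

/-- The component of `o` in the complement of the edges joining `u` and `v`. -/
def cmp (G : TopMultigraph) (o u v : ℝ × ℝ) : Set (ℝ × ℝ) :=
  connectedComponentIn (G.pairUnion u v)ᶜ o

theorem cmp_comm (o u v : ℝ × ℝ) : cmp G o u v = cmp G o v u := by
  unfold cmp
  rw [pairUnion_comm]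

theorem cmp_eq {o u v : ℝ × ℝ} {l : Set (ℝ × ℝ)} (h : G.IsLensAt u v l) (ho : o ∈ l) :
    l = cmp G o u v := by
  obtain ⟨-, -, -, -, x, -, rfl⟩ := h
  exact connectedComponentIn_eq ho

theorem ph_bdd {s : Set (ℝ × ℝ)} (hs : Bornology.IsBounded s) : Bornology.IsBounded (ph '' s) :=
  (Complex.equivRealProdCLM.symm : ℝ × ℝ →L[ℝ] ℂ).lipschitz.isBounded_image hs

theorem lens_data {o u v : ℝ × ℝ} (ho : o ∉ G.pairUnion u v)
    (h : G.IsLensAt u v (cmp G o u v)) :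
    ∃ e f : II → ℂ, PP G (ph u) (ph v) e ∧ PP G (ph u) (ph v) f ∧
      (∃ m : ℤ, Odd m ∧ dl (fun s => e s - ph o) - dl (fun s => f s - ph o) =
        m * (2 * Real.pi * Complex.I)) ∧
      ∀ w ∈ G.V, w ≠ u → w ≠ v → w ∉ cmp G o u v →
        dl (fun s => e s - ph w) = dl (fun s => f s - ph w) := by
  classical
  obtain ⟨huv, -, hnc, hbd, -⟩ := h
  have hF := fa_fam huv hnc
  have hK := fa_KK (G := G) u v
  have hKc : (KK (fa (G := G) u v))ᶜ = ph '' (G.pairUnion u v)ᶜ := by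
    rw [hK, Set.image_compl_eq ph.bijective]
  have hcc : connectedComponentIn (KK (fa (G := G) u v))ᶜ (ph o) = ph '' cmp G o u v := by
    rw [hKc, cmp, ph.image_connectedComponentIn ho]
  have hoK : ph o ∉ KK (fa (G := G) u v) := by
    rw [hK]
    rintro ⟨x, hx, hxo⟩
    exact ho (ph.injective hxo ▸ hx)
  obtain ⟨i, j, hij, hz⟩ := hF.select hoK (by rw [hcc]; exact ph_bdd hbd)
    (((G.V.erase u).erase v).image ph) (by
      intro w hw
      obtain ⟨w, hw', rfl⟩ := Finset.mem_image.1 hw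
      simp only [Finset.mem_erase] at hw'
      intro hm
      obtain ⟨g, s, hs⟩ := Set.mem_iUnion.1 hm
      exact (fa_PP huv g).avoid hw'.2.2 (fun h => hw'.2.1 (ph.injective h))
        (fun h => hw'.1 (ph.injective h)) s hs)
  obtain ⟨m, hm, hw⟩ := hF.odd hoK hij
  refine ⟨fa u v i, fa u v j, fa_PP huv i, fa_PP huv j, ⟨m, hm, hw⟩, ?_⟩
  intro w hw hwu hwv hwc
  have := hz (ph w) (Finset.mem_image_of_mem _ (by simp [hw, hwu, hwv])) (by
    rw [hcc]
    rintro ⟨x, hx, hxw⟩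
    exact hwc (ph.injective hxw ▸ hx))
  exact sub_eq_zero.1 this

/-- The relation: `u`, `v` span a lens around `o` with few vertices. -/
def RR (G : TopMultigraph) (o : ℝ × ℝ) (M : ℕ) (u v : ℂ) : Prop :=
  G.IsLensAt (ph.symm u) (ph.symm v) (cmp G o (ph.symm u) (ph.symm v)) ∧
    Set.ncard {w : ℝ × ℝ | w ∈ G.V ∧ w ∈ cmp G o (ph.symm u) (ph.symm v)} < M

theorem RR_bound (hsc : G.SingleCrossing) (o : ℝ × ℝ) (ho : ∀ e : G.ι, o ∉ Set.range (G.arc e))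
    (M : ℕ) (hM : 1 ≤ M) :
    mm (G.V.map ph.toEquiv.toEmbedding) (RR G o M) ≤ 32 * M * G.V.card := by
  classical
  have hoU : ∀ u v, o ∉ G.pairUnion u v := by
    intro u v h
    obtain ⟨e, -, he⟩ := Set.mem_iUnion₂.1 h
    exact ho e he
  have hmV : ∀ {w : ℂ}, w ∈ G.V.map ph.toEquiv.toEmbedding ↔ ph.symm w ∈ G.V := by
    intro w
    rw [Finset.mem_map]
    constructor
    · rintro ⟨x, hx, rfl⟩
      simpa using hx
    · intro h
      exact ⟨_, h, by simp⟩
  have key := main_count (G.V.map ph.toEquiv.toEmbedding) (ph o) (RR G o M)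
    (fun x y h => ⟨by rw [cmp_comm]; exact isLensAt_comm h.1, by rw [cmp_comm]; exact h.2⟩)
    (fun x h => h.1.1 rfl)
    (fun u v => (G.V.map ph.toEquiv.toEmbedding).filter
      (fun w => ph.symm w ∈ cmp G o (ph.symm u) (ph.symm v)))
    (fun u v => by simp only [cmp_comm o (ph.symm u)]) M hM ?_ (PP G)
    (fun u v e h => h.cont) (fun u v e h => h.choose_spec.choose_spec.2.2.1)
    (fun u v e h => h.choose_spec.choose_spec.2.2.2) ?_ ?_
    (fun a b c d e f he hf hac had hbc hbd => he.cross hsc hf hac had hbc hbd) ?_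
  · rwa [Finset.card_map] at key
  · intro u v h
    obtain ⟨g, hg⟩ := h.1.2.1
    have hsub : cmp G o (ph.symm u) (ph.symm v) ⊆ (G.pairUnion (ph.symm u) (ph.symm v))ᶜ :=
      connectedComponentIn_subset _ _
    have hmu := joins_mem_union hg
    refine ⟨fun hm => hsub (Finset.mem_filter.1 hm).2 hmu.1,
      fun hm => hsub (Finset.mem_filter.1 hm).2 hmu.2, Finset.filter_subset _ _, ?_⟩
    refine lt_of_eq_of_lt ?_ h.2
    have e : {w : ℝ × ℝ | w ∈ G.V ∧ w ∈ cmp G o (ph.symm u) (ph.symm v)} =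
        ((G.V.filter (fun w => w ∈ cmp G o (ph.symm u) (ph.symm v)) : Finset (ℝ × ℝ)) :
          Set (ℝ × ℝ)) := by
      ext w; simp
    rw [e, Set.ncard_coe_finset, Finset.filter_map, Finset.card_map]
    congr 1
  · rintro u v e ⟨g, τ, -, he, -⟩ s hs
    rw [he] at hs
    exact ho g ⟨_, ph.injective hs⟩
  · intro u v e he w hw hwu hwv s
    have := he.avoid (hmV.1 hw) (by simpa using hwu) (by simpa using hwv) s
    simpa using this
  · intro u v h
    obtain ⟨e, f, h1, h2, h3, h4⟩ := lens_data (hoU _ _) h.1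
    simp only [Homeomorph.apply_symm_apply] at h1 h2
    refine ⟨e, f, h1, h2, h3, ?_⟩
    intro w hw hwu hwv hwX
    have := h4 (ph.symm w) (hmV.1 hw) (fun h => hwu (ph.symm.injective h))
      (fun h => hwv (ph.symm.injective h)) (fun h => hwX (Finset.mem_filter.2 ⟨hw, h⟩))
    simpa using this

theorem lens_count (hsc : G.SingleCrossing) (o : ℝ × ℝ)
    (ho : ∀ e : G.ι, o ∉ Set.range (G.arc e)) (M : ℕ) (hM : 1 ≤ M) :
    {l : Set (ℝ × ℝ) | G.IsLens l ∧ o ∈ l ∧ Set.ncard {v : ℝ × ℝ | v ∈ G.V ∧ v ∈ l} < M}.ncard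
      ≤ 16 * M * G.V.card := by
  classical
  have hb := RR_bound hsc o ho M hM
  set V' := G.V.map ph.toEquiv.toEmbedding with hV'
  set A : Finset (ℂ × ℂ) := (V' ×ˢ V').filter (fun p => RR G o M p.1 p.2) with hA
  have hAc : A.card = mm V' (RR G o M) := by
    unfold mm
    rw [hA, Finset.card_filter, Finset.sum_product]
  set F : ℂ × ℂ → Set (ℝ × ℝ) := fun p => cmp G o (ph.symm p.1) (ph.symm p.2) with hF
  have h2 : 2 * (A.image F).card ≤ A.card := by
    refine Finset.mul_card_image_le_card A 2 ?_
    intro l hl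
    obtain ⟨⟨u, v⟩, huv, rfl⟩ := Finset.mem_image.1 hl
    obtain ⟨h1, h2⟩ := Finset.mem_filter.1 huv
    obtain ⟨hu, hv⟩ := Finset.mem_product.1 h1
    have hne : u ≠ v := fun h => h2.1.1 (by rw [show u = v from h])
    have hsub : ({(u, v), (v, u)} : Finset (ℂ × ℂ)) ⊆ A.filter (fun p => F p = F (u, v)) := by
      intro p hp
      simp only [Finset.mem_insert, Finset.mem_singleton] at hp
      rcases hp with rfl | rfl
      · exact Finset.mem_filter.2 ⟨huv, rfl⟩
      · refine Finset.mem_filter.2 ⟨Finset.mem_filter.2 ⟨Finset.mem_product.2 ⟨hv, hu⟩, ?_⟩, ?_⟩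
        · exact ⟨by rw [cmp_comm]; exact isLensAt_comm h2.1, by rw [cmp_comm]; exact h2.2⟩
        · exact cmp_comm _ _ _
    have := Finset.card_le_card hsub
    rwa [Finset.card_pair (fun h => hne (Prod.ext_iff.1 h).1)] at this
  have h3 : {l : Set (ℝ × ℝ) | G.IsLens l ∧ o ∈ l ∧
      Set.ncard {v : ℝ × ℝ | v ∈ G.V ∧ v ∈ l} < M} ⊆ (A.image F : Finset (Set (ℝ × ℝ))) := by
    rintro l ⟨⟨u, v, h⟩, hol, hc⟩
    have hl := cmp_eq h hol
    obtain ⟨g, hg⟩ := h.2.1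
    have hm := joins_mem hg
    rw [Finset.mem_coe, Finset.mem_image]
    refine ⟨(ph u, ph v), Finset.mem_filter.2 ⟨Finset.mem_product.2 ⟨?_, ?_⟩, ?_⟩, ?_⟩
    · exact Finset.mem_map.2 ⟨u, hm.1, rfl⟩
    · exact Finset.mem_map.2 ⟨v, hm.2, rfl⟩
    · simp only [RR, Homeomorph.symm_apply_apply, ← hl]
      exact ⟨h, hc⟩
    · simp only [hF, Homeomorph.symm_apply_apply]
      exact hl.symm
  have h4 := Set.ncard_le_ncard h3 (Finset.finite_toSet _)
  rw [Set.ncard_coe_finset] at h4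
  rw [hAc] at h2
  nlinarith

end final2
end LensProof


/-- In a topological multigraph on `n ≥ 1` vertices in which any two distinct edges share at
most one common interior point and no two parallel edges cross, for any point `o` lying on no
edge and not a vertex and any `k ≥ 0`, the number of lenses containing `o` with fewer than
`2^k` vertices inside is at most `16·2^k·n`. -/
theorem lenses_through_point_bound (G : TopMultigraph) (hn : 1 ≤ G.V.card)
    (hsc : G.SingleCrossing) (hpar : G.ParallelNoncrossing)
    (o : ℝ × ℝ) (ho_edge : ∀ e : G.ι, o ∉ Set.range (G.arc e)) (ho_vtx : o ∉ G.V)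
    (k : ℕ) :
    {ℓ : Set (ℝ × ℝ) | G.IsLens ℓ ∧ o ∈ ℓ ∧
        Set.ncard {v : ℝ × ℝ | v ∈ G.V ∧ v ∈ ℓ} < 2 ^ k}.ncard
      ≤ 16 * 2 ^ k * G.V.card :=
  LensProof.lens_count hsc o ho_edge (2 ^ k) Nat.one_le_two_pow
end

section
/- Every separated single-crossing topological multigraph G on n vertices with e edges has crossing number cr(G) ≥ e − 3n. -/
open Set

namespace PlanarArcs

open Complex

theorem log_const {X : Type*} [TopologicalSpace X] {s : Set X} (hs : IsPreconnected s)
    {f : X → ℂ} (hf : ContinuousOn f s) (h : ∀ x ∈ s, ∀ y ∈ s, exp (f x) = exp (f y)) :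
    ∀ x ∈ s, ∀ y ∈ s, f x = f y := by
  intro x hx y hy
  refine IsSeparatedMap.constOn_of_comp (p := Complex.exp) (T2Space.isSeparatedMap _) ?_ hs hf
    h hx hy
  rw [isLocallyInjective_iff_nhds]
  intro z
  have := Complex.isCoveringMap_exp.isLocalHomeomorph.isLocallyInjective
  rw [isLocallyInjective_iff_nhds] at this
  obtain ⟨U, hU, hi⟩ := this z
  exact ⟨U, hU, fun a ha b hb hab => hi ha hb (Subtype.ext hab)⟩

theorem log_path (γ : C(unitInterval, ℂ)) : ∃ g : ℂ → ℂ, ContinuousOn g (range γ)ᶜ ∧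
    ∀ z ∈ (range γ)ᶜ, exp (g z) = (z - γ 0) / (z - γ 1) := by
  classical
  have hne : ∀ (z : ((range γ)ᶜ : Set ℂ)) t, (z : ℂ) - γ t ≠ 0 := fun z t h =>
    z.2 ⟨t, (sub_eq_zero.1 h).symm⟩
  let H : C(unitInterval × ((range γ)ᶜ : Set ℂ), {z : ℂ // z ≠ 0}) :=
    ⟨fun q => ⟨((q.2 : ℂ) - γ 0) / ((q.2 : ℂ) - γ q.1), div_ne_zero (hne _ _) (hne _ _)⟩, by
      refine Continuous.subtype_mk ?_ _
      refine Continuous.div (by fun_prop) (by fun_prop) (fun q => hne _ _)⟩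
  let f : C(((range γ)ᶜ : Set ℂ), ℂ) := ContinuousMap.const _ 0
  have H0 : ∀ a, H (0, a) = (⟨_, (f a).exp_ne_zero⟩ : {z : ℂ // z ≠ 0}) := by
    intro a
    apply Subtype.ext
    simp [H, f, div_self (hne a 0)]
  have h1 := Complex.isCoveringMap_exp.liftHomotopy_lifts H f H0
  set G := Complex.isCoveringMap_exp.liftHomotopy H f H0
  refine ⟨fun z => if hz : z ∈ (range γ)ᶜ then G (1, ⟨z, hz⟩) else 0, ?_, ?_⟩
  · rw [continuousOn_iff_continuous_domRestrict]
    have : Continuous fun z : ((range γ)ᶜ : Set ℂ) => G (1, z) := by fun_prop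
    convert! this using 1
    ext z
    exact dif_pos z.2
  · intro z hz
    beta_reduce
    rw [dif_pos hz]
    have := congr_arg Subtype.val (congrFun h1 (1, ⟨z, hz⟩))
    simpa [H] using this

theorem winding {H : ℝ → ℂ} (hH : Continuous H) (c : ℂ) (m : ℤ)
    (h : ∀ θ : ℝ, exp (H θ) = c * exp (m * (θ * I))) :
    H (2 * Real.pi) - H 0 = m * (2 * Real.pi * I) := by
  have hc : Continuous fun θ : ℝ => H θ - m * (θ * I) := by fun_prop
  have := log_const (s := univ) isPreconnected_univ hc.continuousOn
    (by intro x _ y _; simp [Complex.exp_sub, h, Complex.exp_ne_zero]) (2 * Real.pi) trivial 0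
      trivial
  push_cast at this
  simp at this
  linear_combination this

theorem winding_zero {H : ℝ → ℂ} (hH : Continuous H) (c : ℂ) (m : ℤ)
    (h : ∀ θ : ℝ, exp (H θ) = c * exp (m * (θ * I))) (hp : H (2 * Real.pi) = H 0) : m = 0 := by
  have := winding hH c m h
  rw [hp, sub_self] at this
  have h2 := Complex.two_pi_I_ne_zero
  have := mul_eq_zero.1 this.symm
  rcases this with h | h
  · exact_mod_cast h
  · exact absurd h h2

theorem no_log_two {a b : ℂ} (hab : a ≠ b) {g : ℂ → ℂ} (hg : ContinuousOn g ({a, b}ᶜ))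
    (h : ∀ z ∈ ({a, b}ᶜ : Set ℂ), exp (g z) = (z - a) / (z - b)) : False := by
  have hab' : a - b ≠ 0 := sub_ne_zero.2 hab
  have hw : ∀ θ : ℝ, ‖(1 / 2 : ℂ) * exp (θ * I)‖ = 1 / 2 := by
    intro θ
    rw [norm_mul, Complex.norm_exp_ofReal_mul_I]; norm_num
  have hsl : ∀ θ : ℝ, 1 + (1 / 2 : ℂ) * exp (θ * I) ∈ slitPlane := fun θ =>
    Complex.mem_slitPlane_of_norm_lt_one (by rw [hw]; norm_num)
  let P : ℝ → ℂ := fun θ => a + (a - b) * ((1 / 2 : ℂ) * exp (θ * I))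
  have hPc : Continuous P := by fun_prop
  have hPa : ∀ θ, P θ - a ≠ 0 := by
    intro θ; simp [P, hab', Complex.exp_ne_zero]
  have hPb' : ∀ θ, P θ - b = (a - b) * (1 + (1 / 2 : ℂ) * exp (θ * I)) := by
    intro θ; simp only [P]; ring
  have hPb : ∀ θ, P θ - b ≠ 0 := by
    intro θ; rw [hPb']; exact mul_ne_zero hab' (Complex.slitPlane_ne_zero (hsl θ))
  have hPm : ∀ θ, P θ ∈ ({a, b}ᶜ : Set ℂ) := by
    intro θ
    simp only [mem_compl_iff, mem_insert_iff, mem_singleton_iff, not_or]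
    exact ⟨sub_ne_zero.1 (hPa θ), sub_ne_zero.1 (hPb θ)⟩
  let H : ℝ → ℂ := fun θ => g (P θ) + log (1 + (1 / 2 : ℂ) * exp (θ * I))
  have hHc : Continuous H := by
    refine Continuous.add (hg.comp_continuous hPc hPm) ?_
    refine Continuous.clog (by fun_prop) hsl
  have := winding_zero hHc (1 / 2) 1 (by
    intro θ
    simp only [H]
    rw [Complex.exp_add, h _ (hPm θ), Complex.exp_log (Complex.slitPlane_ne_zero (hsl θ)), hPb']
    have := (Complex.slitPlane_ne_zero (hsl θ))
    generalize hW : 1 + (1 / 2 : ℂ) * exp (θ * I) = W at *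
    have hPa' : P θ - a = (a - b) * ((1 / 2 : ℂ) * exp (θ * I)) := by simp only [P]; ring
    rw [hPa']
    push_cast
    field_simp) (by
    have : exp (((2 * Real.pi : ℝ) : ℂ) * I) = exp (((0 : ℝ) : ℂ) * I) := by
      push_cast
      rw [Complex.exp_two_pi_mul_I]; simp
    simp only [H, P, this])
  exact one_ne_zero this

theorem borsuk {U K : Set ℂ} (hU : IsOpen U) (hUb : Bornology.IsBounded U) (hK : IsClosed K)
    (hfr : frontier U ⊆ K) {p : ℂ} (hp : p ∈ U) {h g : ℂ → ℂ} (hh : ContinuousOn h (closure U))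
    (hh0 : ∀ z ∈ closure U, h z ≠ 0) (hg : ContinuousOn g K) (m : ℤ)
    (hgh : ∀ z ∈ K, exp (g z) = (z - p) ^ m * h z) : m = 0 := by
  classical
  obtain ⟨G, hG⟩ := ContinuousMap.exists_restrict_eq hK
    ⟨K.domRestrict g, continuousOn_iff_continuous_domRestrict.mp hg⟩
  have hG' : ∀ z ∈ K, G z = g z := fun z hz => DFunLike.congr_fun hG ⟨z, hz⟩
  let F : ℂ → ℂ := fun z => if z ∈ U then exp (G z) / h z else (z - p) ^ m
  have hFc : Continuous F := by
    refine continuous_if ?_ ?_ ?_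
    · intro a ha
      have haK := hfr ha
      rw [hG' a haK, hgh a haK, mul_div_assoc, div_self (hh0 a (frontier_subset_closure ha)),
        mul_one]
    · exact ContinuousOn.div (by fun_prop) hh hh0
    · have : closure {a | a ∉ U} = Uᶜ := hU.isClosed_compl.closure_eq
      rw [this]
      refine ContinuousOn.zpow₀ (by fun_prop) m ?_
      intro a ha
      left
      rw [sub_ne_zero]
      rintro rfl
      exact ha hp
  have hF0 : ∀ z, F z ≠ 0 := by
    intro z
    simp only [F]
    split_ifs with hz
    · exact div_ne_zero (Complex.exp_ne_zero _) (hh0 z (subset_closure hz))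
    · apply zpow_ne_zero
      rw [sub_ne_zero]; rintro rfl; exact hz hp
  obtain ⟨f, ⟨-, hf⟩, -⟩ := isCoveringMapOn_exp.existsUnique_continuousMap_lifts
    (⟨F, hFc⟩ : C(ℂ, ℂ)) (a₀ := 0) (exp_log (hF0 0)) hF0
  obtain ⟨R, hR⟩ := hUb.subset_closedBall p
  set r := max R 0 + 1 with hr
  have hr0 : 0 < r := by positivity
  refine winding_zero (H := fun θ => f (p + r * exp (θ * I))) (by fun_prop) ((r : ℂ) ^ m) m ?_ ?_
  · intro θ
    have : p + r * exp (θ * I) ∉ U := by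
      intro hh
      have := hR hh
      simp [Complex.norm_exp_ofReal_mul_I, abs_of_pos hr0] at this
      have := le_max_left R 0
      linarith
    have h2 := congrFun hf (p + r * exp (θ * I))
    simp only [Function.comp_apply, ContinuousMap.coe_mk, F, if_neg this] at h2
    rw [h2, add_sub_cancel_left, mul_zpow, ← Complex.exp_int_mul]
  · have : exp (((2 * Real.pi : ℝ) : ℂ) * I) = exp (((0 : ℝ) : ℂ) * I) := by
      push_cast
      rw [Complex.exp_two_pi_mul_I]; simp
    simp only [this]

theorem arc_log {γ : unitInterval → ℂ} (hγ : Continuous γ) (hi : Function.Injective γ)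
    {f : ℂ → ℂ} (hf : ContinuousOn f (range γ)) (hf0 : ∀ z ∈ range γ, f z ≠ 0) :
    ∃ g : ℂ → ℂ, ContinuousOn g (range γ) ∧ ∀ z ∈ range γ, exp (g z) = f z := by
  have hc : Continuous fun t => f (γ t) := hf.comp_continuous hγ (fun t => ⟨t, rfl⟩)
  let q : C(unitInterval, {z : ℂ // z ≠ 0}) := ⟨fun t => ⟨f (γ t), hf0 _ ⟨t, rfl⟩⟩,
    hc.subtype_mk _⟩
  obtain ⟨Γ, h1, -⟩ := isCoveringMap_exp.exists_path_lifts q (log (f (γ 0)))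
    (by apply Subtype.ext; simp [q, exp_log (hf0 _ ⟨0, rfl⟩)])
  have hemb : Topology.IsClosedEmbedding γ := hγ.isClosedEmbedding hi
  refine ⟨fun z => Γ (Function.invFun γ z), ?_, ?_⟩
  · rw [continuousOn_iff_continuous_domRestrict]
    have : Continuous fun z : range γ => Γ (hemb.isEmbedding.toHomeomorph.symm z) := by fun_prop
    convert! this using 1
  · rintro _ ⟨t, rfl⟩
    beta_reduce
    rw [Function.leftInverse_invFun hi t]
    exact congr_arg Subtype.val (congrFun h1 t)

theorem polar_preconnected (p : ℂ) {s : Set ℝ} (hs : IsPreconnected s) :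
    IsPreconnected ((fun q : ℝ × ℝ => p + q.1 * exp (q.2 * I)) '' (s ×ˢ univ)) :=
  (hs.prod isPreconnected_univ).image _ (by fun_prop)

theorem polar_eq (p : ℂ) (s : Set ℝ) (hs : ∀ x ∈ s, 0 < x) :
    (fun q : ℝ × ℝ => p + q.1 * exp (q.2 * I)) '' (s ×ˢ univ) = {z | ‖z - p‖ ∈ s} := by
  ext z
  constructor
  · rintro ⟨q, ⟨hq, -⟩, rfl⟩
    simp [Complex.norm_exp_ofReal_mul_I, abs_of_pos (hs _ hq), hq]
  · intro hz
    exact ⟨(‖z - p‖, arg (z - p)), ⟨hz, trivial⟩, by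
      simp [Complex.norm_mul_exp_arg_mul_I]⟩

theorem punctured_ball (p : ℂ) (r : ℝ) : IsPreconnected (Metric.ball p r \ {p}) := by
  have := polar_preconnected p (s := Ioo 0 r) isPreconnected_Ioo
  rw [polar_eq p _ (fun x hx => hx.1)] at this
  convert this using 1
  ext z
  simp [sub_eq_zero, dist_eq_norm, and_comm]

theorem compl_closedBall_preconnected (p : ℂ) (r : ℝ) (hr : 0 ≤ r) :
    IsPreconnected (Metric.closedBall p r)ᶜ := by
  have := polar_preconnected p (s := Ioi r) isPreconnected_Ioi
  rw [polar_eq p (Ioi r) (fun x hx => lt_of_le_of_lt hr hx)] at this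
  convert this using 1
  ext z
  simp [dist_eq_norm]

theorem arc_interior_empty {γ : unitInterval → ℂ} (hγ : Continuous γ)
    (hi : Function.Injective γ) : interior (range γ) = ∅ := by
  by_contra hne
  obtain ⟨x, hx⟩ := nonempty_iff_ne_empty.2 hne
  obtain ⟨r, hr, hB⟩ := Metric.isOpen_iff.1 isOpen_interior x hx
  have hB' : Metric.ball x r ⊆ range γ := hB.trans interior_subset
  have hinf : (γ ⁻¹' (Metric.ball x r)).Infinite := by
    refine Set.Infinite.preimage ?_ hB'
    have h1 : (Metric.ball x r).Nonempty := ⟨x, Metric.mem_ball_self hr⟩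
    exact infinite_of_mem_nhds x (Metric.ball_mem_nhds x hr)
  obtain ⟨T, hT, hT3⟩ := hinf.exists_subset_card_eq 3
  let o := T.orderEmbOfFin hT3
  have ho : ∀ i, γ (o i) ∈ Metric.ball x r := fun i => hT (Finset.orderEmbOfFin_mem T hT3 i)
  have h01 : o 0 < o 1 := o.strictMono (by decide)
  have h12 : o 1 < o 2 := o.strictMono (by decide)
  obtain ⟨s, hs, hsB⟩ := Metric.isOpen_iff.1 Metric.isOpen_ball _ (ho 1)
  have hnb : γ ⁻¹' (Metric.ball (γ (o 1)) s) ∈ nhds (o 1) :=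
    hγ.continuousAt.preimage_mem_nhds (Metric.ball_mem_nhds _ hs)
  have hl : (nhdsWithin (o 1) (Iio (o 1))).NeBot := nhdsLT_neBot_of_exists_lt ⟨_, h01⟩
  have hr : (nhdsWithin (o 1) (Ioi (o 1))).NeBot := nhdsGT_neBot_of_exists_gt ⟨_, h12⟩
  obtain ⟨t0, ht0, ht0'⟩ := hl.nonempty_of_mem
    (Filter.inter_mem self_mem_nhdsWithin (mem_nhdsWithin_of_mem_nhds hnb))
  obtain ⟨t2, ht2, ht2'⟩ := hr.nonempty_of_mem
    (Filter.inter_mem self_mem_nhdsWithin (mem_nhdsWithin_of_mem_nhds hnb))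
  have h2 := (punctured_ball (γ (o 1)) s).preimage_of_isClosedMap hi hγ.isClosedMap
    (sdiff_subset.trans (hsB.trans hB'))
  have h3 := h2.ordConnected.out (x := t0) (y := t2)
    ⟨ht0', fun h => ne_of_lt ht0 (hi h)⟩ ⟨ht2', fun h => ne_of_gt ht2 (hi h)⟩
    ⟨le_of_lt ht0, le_of_lt ht2⟩
  exact h3.2 rfl

end PlanarArcs

namespace PlanarArcs

open Complex

/-- `U` is a connected component of the complement of `K`. -/
def Face (K U : Set ℂ) : Prop := ∃ x ∈ Kᶜ, U = connectedComponentIn Kᶜ x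

theorem Face.isOpen {K U : Set ℂ} (hK : IsClosed K) (h : Face K U) : IsOpen U := by
  obtain ⟨x, hx, rfl⟩ := h
  exact hK.isOpen_compl.connectedComponentIn

theorem Face.nonempty {K U : Set ℂ} (h : Face K U) : U.Nonempty := by
  obtain ⟨x, hx, rfl⟩ := h
  exact ⟨x, mem_connectedComponentIn hx⟩

theorem Face.isPreconnected {K U : Set ℂ} (h : Face K U) : IsPreconnected U := by
  obtain ⟨x, hx, rfl⟩ := h
  exact isPreconnected_connectedComponentIn

theorem Face.subset {K U : Set ℂ} (h : Face K U) : U ⊆ Kᶜ := by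
  obtain ⟨x, hx, rfl⟩ := h
  exact connectedComponentIn_subset _ _

theorem Face.max {K U S : Set ℂ} (h : Face K U) (hS : IsPreconnected S) (hSK : S ⊆ Kᶜ)
    (hSU : (S ∩ U).Nonempty) : S ⊆ U := by
  obtain ⟨x, hx, rfl⟩ := h
  obtain ⟨y, hyS, hyU⟩ := hSU
  rw [connectedComponentIn_eq hyU]
  exact hS.subset_connectedComponentIn hyS hSK

theorem Face.eq {K U W : Set ℂ} (h : Face K U) (h' : Face K W) (hUW : (U ∩ W).Nonempty) :
    U = W :=
  Subset.antisymm (h'.max h.isPreconnected h.subset hUW)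
    (h.max h'.isPreconnected h'.subset (by rwa [inter_comm]))

theorem face_of_mem {K : Set ℂ} {x : ℂ} (hx : x ∈ Kᶜ) : Face K (connectedComponentIn Kᶜ x) :=
  ⟨x, hx, rfl⟩

theorem Face.frontier_subset {K U : Set ℂ} (hK : IsClosed K) (h : Face K U) :
    frontier U ⊆ K := by
  intro z hz
  by_contra hzK
  have hW := face_of_mem (K := K) hzK
  have hzW := mem_connectedComponentIn (F := Kᶜ) hzK
  have hne : (connectedComponentIn Kᶜ z ∩ U).Nonempty :=
    mem_closure_iff.1 (frontier_subset_closure hz) _ (hW.isOpen hK) hzW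
  rw [hW.eq h hne] at hzW
  rw [(h.isOpen hK).frontier_eq] at hz
  exact hz.2 hzW

/-- The open arc. -/
def inner (γ : unitInterval → ℂ) : Set ℂ := γ '' {t | t ≠ 0 ∧ t ≠ 1}

theorem Ioo_eq : {t : unitInterval | t ≠ 0 ∧ t ≠ 1} = Ioo 0 1 := by
  ext t
  simp only [mem_setOf_eq, mem_Ioo]
  exact and_congr unitInterval.pos_iff_ne_zero.symm unitInterval.lt_one_iff_ne_one.symm

theorem inner_preconnected {γ : unitInterval → ℂ} (hγ : Continuous γ) :
    IsPreconnected (inner γ) := by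
  unfold inner
  rw [Ioo_eq]
  exact isPreconnected_Ioo.image _ hγ.continuousOn

theorem inner_nonempty (γ : unitInterval → ℂ) : (inner γ).Nonempty := by
  unfold inner
  rw [Ioo_eq]
  exact (nonempty_Ioo.2 zero_lt_one).image _

theorem inner_subset (γ : unitInterval → ℂ) : inner γ ⊆ range γ := image_subset_range _ _

theorem range_eq_inner (γ : unitInterval → ℂ) : range γ = inner γ ∪ {γ 0, γ 1} := by
  ext z
  constructor
  · rintro ⟨t, rfl⟩
    by_cases h0 : t = 0
    · right; simp [h0]
    by_cases h1 : t = 1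
    · right; simp [h1]
    · exact Or.inl ⟨t, ⟨h0, h1⟩, rfl⟩
  · rintro (h | rfl | rfl)
    · exact inner_subset γ h
    · exact ⟨0, rfl⟩
    · exact ⟨1, rfl⟩

theorem range_subset_closure_inner {γ : unitInterval → ℂ} (hγ : Continuous γ) :
    range γ ⊆ closure (inner γ) := by
  unfold inner
  rw [Ioo_eq]
  have h1 : closure (Ioo (0 : unitInterval) 1) = univ := by
    rw [closure_Ioo zero_ne_one]
    ext t; simp [t.2.1, t.2.2, unitInterval.le_one']
  calc range γ = γ '' closure (Ioo (0 : unitInterval) 1) := by rw [h1, image_univ]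
    _ ⊆ _ := image_closure_subset_closure_image hγ

theorem exists_subface {K : Set ℂ} (hK : IsClosed K) {γ : unitInterval → ℂ} (hγ : Continuous γ)
    (hi : Function.Injective γ) {U : Set ℂ} (hU : Face K U) :
    ∃ W, Face (K ∪ range γ) W ∧ W ⊆ U := by
  have : ¬ U ⊆ range γ := by
    intro h
    have := interior_maximal h (hU.isOpen hK)
    rw [arc_interior_empty hγ hi] at this
    obtain ⟨x, hx⟩ := hU.nonempty
    exact this hx
  obtain ⟨x, hxU, hxγ⟩ := not_subset.1 this
  have hx : x ∈ (K ∪ range γ)ᶜ := by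
    rintro (h | h)
    · exact hU.subset hxU h
    · exact hxγ h
  refine ⟨_, face_of_mem hx, ?_⟩
  refine hU.max isPreconnected_connectedComponentIn
    ((connectedComponentIn_subset _ _).trans (compl_subset_compl.2 subset_union_left))
    ⟨x, mem_connectedComponentIn hx, hxU⟩

theorem exists_two_subfaces {K : Set ℂ} (hK : IsClosed K) {γ : unitInterval → ℂ}
    (hγ : Continuous γ) (hi : Function.Injective γ) (hin : inner γ ⊆ Kᶜ)
    (hj : JoinedIn K (γ 0) (γ 1)) :
    ∃ U W W', Face K U ∧ Face (K ∪ range γ) W ∧ Face (K ∪ range γ) W' ∧ W ⊆ U ∧ W' ⊆ U ∧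
      W ≠ W' := by
  obtain ⟨x0, hx0⟩ := inner_nonempty γ
  have hU := face_of_mem (hin hx0)
  have hinU : inner γ ⊆ connectedComponentIn Kᶜ x0 :=
    (inner_preconnected hγ).subset_connectedComponentIn hx0 hin
  set U := connectedComponentIn Kᶜ x0
  have hsub : ∀ x ∈ U \ range γ, Face (K ∪ range γ) (connectedComponentIn (K ∪ range γ)ᶜ x) ∧
      connectedComponentIn (K ∪ range γ)ᶜ x ⊆ U ∧ x ∈ connectedComponentIn (K ∪ range γ)ᶜ x := by
    intro x hx
    have hx' : x ∈ (K ∪ range γ)ᶜ := by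
      rintro (h | h)
      · exact hU.subset hx.1 h
      · exact hx.2 h
    exact ⟨face_of_mem hx', hU.max isPreconnected_connectedComponentIn
      ((connectedComponentIn_subset _ _).trans (compl_subset_compl.2 subset_union_left))
      ⟨x, mem_connectedComponentIn hx', hx.1⟩, mem_connectedComponentIn hx'⟩
  by_contra hcon
  have hpre : IsPreconnected (U \ range γ) := by
    refine isPreconnected_of_forall_pair ?_
    intro x hx y hy
    obtain ⟨h1, h2, h3⟩ := hsub x hx
    obtain ⟨h1', h2', h3'⟩ := hsub y hy
    refine ⟨connectedComponentIn (K ∪ range γ)ᶜ x, ?_, h3, ?_, h1.isPreconnected⟩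
    · intro z hz
      exact ⟨h2 hz, fun h => h1.subset hz (Or.inr h)⟩
    · by_contra hne
      refine hcon ⟨U, _, _, hU, h1, h1', h2, h2', ?_⟩
      intro heq
      rw [heq] at hne
      exact hne h3'
  -- two logarithms
  obtain ⟨α, hα, hα'⟩ := log_path ⟨γ, hγ⟩
  obtain ⟨P, hP⟩ := hj
  obtain ⟨β, hβ, hβ'⟩ := log_path P.toContinuousMap
  have hPK : range P.toContinuousMap ⊆ K := by rintro _ ⟨t, rfl⟩; exact hP t
  have hPU : U ⊆ (range P.toContinuousMap)ᶜ := fun z hz h => hU.subset hz (hPK h)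
  have hc := hβ.mono hPU
  simp only [ContinuousMap.coe_mk] at hα hα'
  replace hβ' : ∀ z ∈ U, exp (β z) = (z - γ 0) / (z - γ 1) := by
    intro z hz
    have := hβ' z (hPU hz)
    simpa using this
  have hγc : IsClosed (range γ) := (isCompact_range hγ).isClosed
  have hUo := hU.isOpen hK
  have hneγ : ∀ z ∉ range γ, (z - γ 0) / (z - γ 1) ≠ 0 := by
    intro z hz
    refine div_ne_zero ?_ ?_ <;> rw [sub_ne_zero] <;> rintro rfl <;> exact hz ⟨_, rfl⟩
  have hconst : ∃ c, exp c = 1 ∧ ∀ z ∈ U \ range γ, α z = β z + c := by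
    by_cases hem : (U \ range γ).Nonempty
    · obtain ⟨y, hy⟩ := hem
      have hE : ∀ z ∈ U \ range γ, exp (α z - β z) = 1 := by
        intro z hz
        rw [Complex.exp_sub, hα' z hz.2, hβ' z hz.1, div_self (hneγ z hz.2)]
      refine ⟨α y - β y, hE y hy, fun z hz => ?_⟩
      have := log_const hpre (f := fun z => α z - β z)
        ((hα.mono fun z hz => hz.2).sub (hc.mono fun z hz => hz.1))
        (fun u hu v hv => by rw [hE u hu, hE v hv]) z hz y hy
      rw [← this]; ring
    · exact ⟨0, by simp, fun z hz => absurd ⟨z, hz⟩ hem⟩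
  obtain ⟨c, hc1, hcz⟩ := hconst
  classical
  have hab : γ 0 ≠ γ 1 := fun h => zero_ne_one (hi h)
  let g : ℂ → ℂ := fun z => if z ∈ range γ then β z + c else α z
  have hgU : ∀ z ∈ U, g z = β z + c := by
    intro z hz
    simp only [g]
    split_ifs with h
    · rfl
    · exact hcz z ⟨hz, h⟩
  have hcov : ∀ z ∈ ({γ 0, γ 1}ᶜ : Set ℂ), z ∈ range γ → z ∈ U := by
    intro z hz hzr
    rw [range_eq_inner] at hzr
    rcases hzr with h | h
    · exact hinU h
    · exact absurd h hz
  refine no_log_two hab (g := g) ?_ ?_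
  · intro z hz
    apply ContinuousAt.continuousWithinAt
    by_cases hzr : z ∈ range γ
    · have hzU := hcov z hz hzr
      have h1 : ContinuousAt (fun z => β z + c) z :=
        ((hc z hzU).continuousAt (hUo.mem_nhds hzU)).add continuousAt_const
      refine h1.congr ?_
      filter_upwards [hUo.mem_nhds hzU] with w hw
      exact (hgU w hw).symm
    · have h1 : ContinuousAt α z := (hα z hzr).continuousAt (hγc.isOpen_compl.mem_nhds hzr)
      refine h1.congr ?_
      filter_upwards [hγc.isOpen_compl.mem_nhds hzr] with w hw
      exact (if_neg hw).symm
  · intro z hz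
    by_cases hzr : z ∈ range γ
    · have hzU := hcov z hz hzr
      rw [hgU z hzU, Complex.exp_add, hc1, mul_one, hβ' z hzU]
    · simp only [g, if_neg hzr]
      exact hα' z hzr

theorem glue {A B : Set ℂ} (hA : IsClosed A) (hB : IsClosed B) {f g : ℂ → ℂ}
    (hf : ContinuousOn f A) (hg : ContinuousOn g B) (h : ∀ z ∈ A ∩ B, f z = g z) :
    ∃ k : ℂ → ℂ, ContinuousOn k (A ∪ B) ∧ (∀ z ∈ A, k z = f z) ∧ ∀ z ∈ B, k z = g z := by
  classical
  have h1 : ∀ z ∈ A, A.piecewise f g z = f z := fun z hz => piecewise_eq_of_mem _ _ _ hz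
  have h2 : ∀ z ∈ B, A.piecewise f g z = g z := by
    intro z hz
    by_cases hzA : z ∈ A
    · rw [h1 z hzA, h z ⟨hzA, hz⟩]
    · exact piecewise_eq_of_notMem _ _ _ hzA
  exact ⟨A.piecewise f g, (hf.congr h1).union_of_isClosed (hg.congr h2) hA hB, h1, h2⟩

theorem face_not_bounded_of_log {K U : Set ℂ} (hK : IsClosed K) (hU : Face K U)
    (hlog : ∀ p ∉ K, ∃ g : ℂ → ℂ, ContinuousOn g K ∧ ∀ z ∈ K, exp (g z) = z - p) :
    ¬ Bornology.IsBounded U := by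
  intro hb
  obtain ⟨p, hp⟩ := hU.nonempty
  obtain ⟨g, hg, hg'⟩ := hlog p (hU.subset hp)
  have := borsuk (hU.isOpen hK) hb hK (hU.frontier_subset hK) hp (h := fun _ => 1)
    continuousOn_const (by simp) hg 1 (by simpa using hg')
  exact one_ne_zero this

theorem log_sub_arc {γ : unitInterval → ℂ} (hγ : Continuous γ) (hi : Function.Injective γ)
    {p : ℂ} (hp : p ∉ range γ) :
    ∃ g : ℂ → ℂ, ContinuousOn g (range γ) ∧ ∀ z ∈ range γ, exp (g z) = z - p :=
  arc_log hγ hi (f := fun z => z - p) (by fun_prop)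
    (fun z hz => by rw [sub_ne_zero]; rintro rfl; exact hp hz)

theorem face_one_arc {γ : unitInterval → ℂ} (hγ : Continuous γ) (hi : Function.Injective γ)
    {U : Set ℂ} (hU : Face (range γ) U) : ¬ Bornology.IsBounded U :=
  face_not_bounded_of_log (isCompact_range hγ).isClosed hU (fun _ hp => log_sub_arc hγ hi hp)

theorem face_two_arcs {γ δ : unitInterval → ℂ} (hγ : Continuous γ) (hi : Function.Injective γ)
    (hδ : Continuous δ) (hi' : Function.Injective δ) (hs : (range γ ∩ range δ).Subsingleton)
    {U : Set ℂ} (hU : Face (range γ ∪ range δ) U) : ¬ Bornology.IsBounded U := by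
  have hc1 := (isCompact_range hγ).isClosed
  have hc2 := (isCompact_range hδ).isClosed
  refine face_not_bounded_of_log (hc1.union hc2) hU ?_
  intro p hp
  obtain ⟨f, hf, hf'⟩ := log_sub_arc hγ hi (p := p) (fun h => hp (Or.inl h))
  obtain ⟨g, hg, hg'⟩ := log_sub_arc hδ hi' (p := p) (fun h => hp (Or.inr h))
  have hex : ∃ c, exp c = 1 ∧ ∀ z ∈ range γ ∩ range δ, f z = g z + c := by
    by_cases hem : (range γ ∩ range δ).Nonempty
    · obtain ⟨y, hy⟩ := hem
      refine ⟨f y - g y, ?_, fun z hz => ?_⟩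
      · rw [Complex.exp_sub, hf' y hy.1, hg' y hy.2, div_self]
        rw [sub_ne_zero]; rintro rfl; exact hp (Or.inl hy.1)
      · rw [hs hz hy]; ring
    · exact ⟨0, by simp, fun z hz => absurd ⟨z, hz⟩ hem⟩
  obtain ⟨c, hc, hcz⟩ := hex
  obtain ⟨k, hk, hk1, hk2⟩ := glue hc1 hc2 hf (g := fun z => g z + c)
    (hg.add continuousOn_const) hcz
  refine ⟨k, hk, ?_⟩
  rintro z (hz | hz)
  · rw [hk1 z hz, hf' z hz]
  · rw [hk2 z hz, Complex.exp_add, hc, mul_one, hg' z hz]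

theorem no_three_faces {K : Set ℂ} (hK : IsClosed K) {γ : unitInterval → ℂ}
    (hγ : Continuous γ) (hi : Function.Injective γ) (hin : inner γ ⊆ Kᶜ)
    (h0 : γ 0 ∈ K) (h1 : γ 1 ∈ K) {U : Fin 3 → Set ℂ}
    (hU : ∀ i, Face (K ∪ range γ) (U i)) (hinj : Function.Injective U)
    (hb : ∀ i, Bornology.IsBounded (U i)) (hinc : ∀ i, (closure (U i) ∩ inner γ).Nonempty) :
    False := by
  have hγc : IsClosed (range γ) := (isCompact_range hγ).isClosed
  have hKc := hK.union hγc
  obtain ⟨x0, hx0⟩ := inner_nonempty γ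
  have hW := face_of_mem (hin hx0)
  have hinW : inner γ ⊆ connectedComponentIn Kᶜ x0 :=
    (inner_preconnected hγ).subset_connectedComponentIn hx0 hin
  set W := connectedComponentIn Kᶜ x0
  have hUW : ∀ i, U i ⊆ W := by
    intro i
    refine hW.max (hU i).isPreconnected
      ((hU i).subset.trans (compl_subset_compl.2 subset_union_left)) ?_
    obtain ⟨y, hy, hy'⟩ := hinc i
    obtain ⟨z, hz⟩ := mem_closure_iff.1 hy _ (hW.isOpen hK) (hinW hy')
    exact ⟨z, hz.2, hz.1⟩
  choose p hp using fun i => (hU i).nonempty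
  have hpK : ∀ i, p i ∉ K ∪ range γ := fun i => (hU i).subset (hp i)
  have hWp : IsPathConnected W := by
    rw [← (hW.isOpen hK).isConnected_iff_isPathConnected]
    exact ⟨hW.nonempty, hW.isPreconnected⟩
  have hne : ∀ i, ∀ z ∈ K ∪ range γ, z - p i ≠ 0 := by
    intro i z hz
    rw [sub_ne_zero]; rintro rfl; exact hpK i hz
  have hg : ∀ i, ∃ g : ℂ → ℂ, ContinuousOn g K ∧
      ∀ z ∈ K, exp (g z) = (z - p i) / (z - p 2) := by
    intro i
    obtain ⟨P, hP⟩ := hWp.joinedIn (p i) (hUW i (hp i)) (p 2) (hUW 2 (hp 2))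
    obtain ⟨β, hβ, hβ'⟩ := log_path P.toContinuousMap
    have hPU : K ⊆ (range P.toContinuousMap)ᶜ := by
      rintro z hz ⟨t, rfl⟩
      exact hW.subset (hP t) hz
    refine ⟨β, hβ.mono hPU, fun z hz => ?_⟩
    have := hβ' z (hPU hz)
    simpa using this
  have hh : ∀ i, ∃ g : ℂ → ℂ, ContinuousOn g (range γ) ∧
      ∀ z ∈ range γ, exp (g z) = (z - p i) / (z - p 2) := by
    intro i
    refine arc_log hγ hi (f := fun z => (z - p i) / (z - p 2)) ?_ ?_
    · exact ContinuousOn.div (by fun_prop) (by fun_prop) (fun z hz => hne 2 z (Or.inr hz))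
    · exact fun z hz => div_ne_zero (hne i z (Or.inr hz)) (hne 2 z (Or.inr hz))
  choose g hgc hge using hg
  choose h hhc hhe using hh
  have hone : ∀ i, ∀ z ∈ K, z ∈ range γ → exp (g i z - h i z) = 1 := by
    intro i z hz hz'
    rw [Complex.exp_sub, hge i z hz, hhe i z hz', div_self]
    exact div_ne_zero (hne i z (Or.inl hz)) (hne 2 z (Or.inl hz))
  have hd : ∀ i, ∃ d : ℤ, (g i (γ 1) - h i (γ 1)) - (g i (γ 0) - h i (γ 0)) =
      d * (2 * Real.pi * I) := by
    intro i
    rw [← Complex.exp_eq_one_iff, Complex.exp_sub, hone i _ h1 ⟨1, rfl⟩, hone i _ h0 ⟨0, rfl⟩,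
      div_one]
  choose d hd using hd
  obtain ⟨m, n, hmn, hmnd⟩ : ∃ m n : ℤ, ¬ (m = 0 ∧ n = 0) ∧ m * d 0 + n * d 1 = 0 := by
    by_cases hz : d 0 = 0 ∧ d 1 = 0
    · exact ⟨1, 0, by simp, by simp [hz.1]⟩
    · refine ⟨d 1, - d 0, fun hh => hz ⟨by simpa using hh.2, hh.1⟩, by ring⟩
  set c : ℂ := m * (g 0 (γ 0) - h 0 (γ 0)) + n * (g 1 (γ 0) - h 1 (γ 0)) with hcdef
  have hc1 : exp c = 1 := by
    rw [hcdef, Complex.exp_add, Complex.exp_int_mul, Complex.exp_int_mul,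
      hone 0 _ h0 ⟨0, rfl⟩, hone 1 _ h0 ⟨0, rfl⟩]
    simp
  obtain ⟨k, hk, hk1, hk2⟩ := glue hK hγc (f := fun z => m * g 0 z + n * g 1 z)
    (g := fun z => m * h 0 z + n * h 1 z + c)
    ((continuousOn_const.mul (hgc 0)).add (continuousOn_const.mul (hgc 1)))
    (((continuousOn_const.mul (hhc 0)).add (continuousOn_const.mul (hhc 1))).add
      continuousOn_const) (by
    rintro z ⟨hz, hz'⟩
    rw [range_eq_inner] at hz'
    rcases hz' with hz' | rfl | hz'
    · exact absurd hz (hin hz')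
    · simp only [hcdef]; ring
    · rw [mem_singleton_iff] at hz'
      subst hz'
      have e0 := hd 0
      have e1 := hd 1
      have e2 : (m : ℂ) * d 0 + n * d 1 = 0 := by exact_mod_cast hmnd
      simp only [hcdef]
      linear_combination (m : ℂ) * e0 + (n : ℂ) * e1 + (2 * Real.pi * I) * e2)
  have hkz : ∀ z ∈ K ∪ range γ, exp (k z) =
      ((z - p 0) / (z - p 2)) ^ m * ((z - p 1) / (z - p 2)) ^ n := by
    rintro z (hz | hz)
    · rw [hk1 z hz, Complex.exp_add, Complex.exp_int_mul, Complex.exp_int_mul, hge 0 z hz,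
        hge 1 z hz]
    · rw [hk2 z hz, Complex.exp_add, hc1, mul_one, Complex.exp_add, Complex.exp_int_mul,
        Complex.exp_int_mul, hhe 0 z hz, hhe 1 z hz]
  have hkz' : ∀ z ∈ K ∪ range γ, exp (k z) =
      (z - p 0) ^ m * (z - p 1) ^ n * (z - p 2) ^ (-m - n) := by
    intro z hz
    have e2 := hne 2 z hz
    rw [hkz z hz, div_zpow, div_zpow, show -m - n = -m + -n by ring, zpow_add₀ e2, zpow_neg, zpow_neg]
    field_simp
  have hcl : ∀ i j, i ≠ j → ∀ z ∈ closure (U i), z - p j ≠ 0 := by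
    intro i j hij z hz
    rw [sub_ne_zero]
    rintro rfl
    rw [closure_eq_self_union_frontier] at hz
    rcases hz with hz | hz
    · exact hij (hinj ((hU i).eq (hU j) ⟨_, hz, hp j⟩))
    · exact hpK j ((hU i).frontier_subset hKc hz)
  have hco : ∀ i j, i ≠ j → ∀ l : ℤ, ContinuousOn (fun z => (z - p j) ^ l) (closure (U i)) :=
    fun i j hij l => ContinuousOn.zpow₀ (by fun_prop) l (fun z hz => Or.inl (hcl i j hij z hz))
  apply hmn
  constructor
  · refine borsuk ((hU 0).isOpen hKc) (hb 0) hKc ((hU 0).frontier_subset hKc) (hp 0)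
      (h := fun z => (z - p 1) ^ n * (z - p 2) ^ (-m - n))
      ((hco 0 1 (by decide) _).mul (hco 0 2 (by decide) _)) ?_ hk m ?_
    · exact fun z hz => mul_ne_zero (zpow_ne_zero _ (hcl 0 1 (by decide) z hz))
        (zpow_ne_zero _ (hcl 0 2 (by decide) z hz))
    · intro z hz; rw [hkz' z hz]; ring
  · refine borsuk ((hU 1).isOpen hKc) (hb 1) hKc ((hU 1).frontier_subset hKc) (hp 1)
      (h := fun z => (z - p 0) ^ m * (z - p 2) ^ (-m - n))
      ((hco 1 0 (by decide) _).mul (hco 1 2 (by decide) _)) ?_ hk n ?_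
    · exact fun z hz => mul_ne_zero (zpow_ne_zero _ (hcl 1 0 (by decide) z hz))
        (zpow_ne_zero _ (hcl 1 2 (by decide) z hz))
    · intro z hz; rw [hkz' z hz]; ring

end PlanarArcs

namespace PlanarArcs

open Complex

/-- A plane drawing: finitely many injective arcs with pairwise disjoint interiors. -/
structure Drawing (ι : Type) where
  γ : ι → unitInterval → ℂ
  V : Finset ℂ
  cont : ∀ e, Continuous (γ e)
  inj : ∀ e, Function.Injective (γ e)
  src : ∀ e, γ e 0 ∈ V
  tgt : ∀ e, γ e 1 ∈ V
  avoid : ∀ e, ∀ z ∈ inner (γ e), z ∉ V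
  disj : ∀ e f, e ≠ f → Disjoint (inner (γ e)) (inner (γ f))

namespace Drawing

variable {ι : Type} (D : Drawing ι)

/-- The union of the arcs in `S`. -/
def K (S : Finset ι) : Set ℂ := ⋃ e ∈ S, range (D.γ e)

theorem K_compact (S : Finset ι) : IsCompact (D.K S) :=
  S.isCompact_biUnion fun e _ => isCompact_range (D.cont e)

theorem K_closed (S : Finset ι) : IsClosed (D.K S) := (D.K_compact S).isClosed

theorem range_subset_K {S : Finset ι} {e : ι} (he : e ∈ S) : range (D.γ e) ⊆ D.K S :=
  subset_biUnion_of_mem (u := fun e => range (D.γ e)) (by exact he)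

theorem K_mono {S T : Finset ι} (h : S ⊆ T) : D.K S ⊆ D.K T :=
  biUnion_subset_biUnion_left (by exact h)

theorem K_insert [DecidableEq ι] (S : Finset ι) (e : ι) :
    D.K (insert e S) = D.K S ∪ range (D.γ e) := by
  unfold K
  rw [Finset.set_biUnion_insert, union_comm]

theorem inner_disj_range {e f : ι} (h : e ≠ f) : Disjoint (inner (D.γ e)) (range (D.γ f)) := by
  rw [range_eq_inner, disjoint_union_right]
  refine ⟨D.disj e f h, ?_⟩
  rw [Set.disjoint_left]
  rintro z hz (rfl | rfl)
  · exact D.avoid e _ hz (D.src f)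
  · exact D.avoid e _ hz (D.tgt f)

theorem inner_subset_compl {S : Finset ι} {e : ι} (he : e ∉ S) : inner (D.γ e) ⊆ (D.K S)ᶜ := by
  intro z hz hzK
  simp only [K, mem_iUnion] at hzK
  obtain ⟨f, hf, hzf⟩ := hzK
  exact Set.disjoint_left.1 (D.inner_disj_range (f := f) (by rintro rfl; exact he hf)) hz hzf

theorem mem_K {S : Finset ι} {z : ℂ} : z ∈ D.K S ↔ ∃ e ∈ S, z ∈ range (D.γ e) := by
  simp [K]

open Classical in
/-- Endpoints of the arcs. -/
noncomputable def ends [Fintype ι] : Finset ℂ :=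
  Finset.univ.image (fun e => D.γ e 0) ∪ Finset.univ.image (fun e => D.γ e 1)

theorem src_mem [Fintype ι] (e : ι) : D.γ e 0 ∈ D.ends := by
  simp [ends]

theorem tgt_mem [Fintype ι] (e : ι) : D.γ e 1 ∈ D.ends := by
  simp [ends]

theorem ends_subset [Fintype ι] : D.ends ⊆ D.V := by
  intro z hz
  simp only [ends, Finset.mem_union, Finset.mem_image, Finset.mem_univ, true_and] at hz
  rcases hz with ⟨e, rfl⟩ | ⟨e, rfl⟩
  exacts [D.src e, D.tgt e]

theorem mem_V_K [Fintype ι] {z : ℂ} (hz : z ∈ D.V) (hK : z ∈ D.K Finset.univ) : z ∈ D.ends := by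
  obtain ⟨e, -, he⟩ := D.mem_K.1 hK
  rw [range_eq_inner] at he
  rcases he with he | rfl | rfl
  · exact absurd hz (D.avoid e _ he)
  · exact D.src_mem e
  · exact D.tgt_mem e

theorem ends_K [Fintype ι] {z : ℂ} (hz : z ∈ D.ends) : z ∈ D.K Finset.univ := by
  simp only [ends, Finset.mem_union, Finset.mem_image, Finset.mem_univ, true_and] at hz
  rw [mem_K]
  rcases hz with ⟨e, rfl⟩ | ⟨e, rfl⟩
  exacts [⟨e, Finset.mem_univ _, 0, rfl⟩, ⟨e, Finset.mem_univ _, 1, rfl⟩]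

open Classical in
/-- Boundary vector of an arc. -/
noncomputable def bd [Fintype ι] (e : ι) : D.ends → ℚ :=
  Pi.single ⟨D.γ e 0, D.src_mem e⟩ 1 - Pi.single ⟨D.γ e 1, D.tgt_mem e⟩ 1

theorem joined_of_mem_span [Fintype ι] {S : Finset ι} {e : ι}
    (h : D.bd e ∈ Submodule.span ℚ (D.bd '' (S : Set ι))) :
    JoinedIn (D.K S) (D.γ e 0) (D.γ e 1) := by
  classical
  let c : D.ends → ℚ := fun v =>
    if JoinedIn (D.K S) (D.γ e 0) v ∨ (v : ℂ) = D.γ e 0 then 1 else 0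
  have hf : ∀ f, c ⬝ᵥ D.bd f = c ⟨D.γ f 0, D.src_mem f⟩ - c ⟨D.γ f 1, D.tgt_mem f⟩ := by
    intro f
    unfold bd
    rw [dotProduct_sub, dotProduct_single, dotProduct_single, mul_one, mul_one]
  have hS : ∀ f ∈ S, JoinedIn (D.K S) (D.γ f 0) (D.γ f 1) := by
    intro f hf
    refine ⟨⟨⟨D.γ f, D.cont f⟩, rfl, rfl⟩, fun t => D.range_subset_K hf ⟨t, rfl⟩⟩
  have h0 : ∀ x ∈ Submodule.span ℚ (D.bd '' (S : Set ι)), c ⬝ᵥ x = 0 := by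
    intro x hx
    induction hx using Submodule.span_induction with
    | mem x hx =>
      obtain ⟨f, hfS, rfl⟩ := hx
      rw [hf, sub_eq_zero]
      have hj := hS f hfS
      simp only [c]
      congr 1
      apply propext
      constructor
      · rintro (h | h)
        · exact Or.inl (h.trans hj)
        · left; rw [← h]; exact hj
      · rintro (h | h)
        · exact Or.inl (h.trans hj.symm)
        · left; rw [← h]; exact hj.symm
    | zero => simp
    | add x y _ _ hx hy => rw [dotProduct_add, hx, hy, add_zero]
    | smul a x _ hx => rw [dotProduct_smul, hx, smul_zero]
  have h1 := h0 _ h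
  rw [hf] at h1
  have h2 : c ⟨D.γ e 0, D.src_mem e⟩ = 1 := by simp [c]
  rw [h2] at h1
  by_contra hcon
  have hne : D.γ e 1 ≠ D.γ e 0 := fun h => zero_ne_one (D.inj e h).symm
  have h3 : c ⟨D.γ e 1, D.tgt_mem e⟩ = 0 := by simp [c, hcon, hne]
  rw [h3] at h1
  norm_num at h1

theorem euler [Fintype ι] (S : Finset ι) : ∃ B ⊆ S, LinearIndepOn ℚ D.bd (B : Set ι) ∧
    ∃ F : Finset (Set ℂ), (∀ U ∈ F, Face (D.K S) U) ∧ S.card + 1 ≤ B.card + F.card := by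
  classical
  induction S using Finset.induction_on with
  | empty =>
    refine ⟨∅, le_rfl, by simp, {connectedComponentIn (D.K ∅)ᶜ 0}, ?_, by simp⟩
    intro U hU
    rw [Finset.mem_singleton] at hU
    subst hU
    exact face_of_mem (by simp [K])
  | insert e S he ih =>
    obtain ⟨B, hBS, hB, F, hF, hcard⟩ := ih
    have hinc := D.inner_subset_compl he
    have hsub := fun U (hU : Face (D.K S) U) =>
      exists_subface (D.K_closed S) (D.cont e) (D.inj e) hU
    choose! s hs hsU using hsub
    rw [← D.K_insert] at hs
    have hsinj : Set.InjOn s F := by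
      intro U hU U' hU' hUU
      obtain ⟨x, hx⟩ := (hs U (hF U hU)).nonempty
      refine (hF U hU).eq (hF U' hU') ⟨x, hsU U (hF U hU) hx, ?_⟩
      rw [hUU] at hx
      exact hsU U' (hF U' hU') hx
    rw [Finset.card_insert_of_notMem he]
    by_cases hspan : D.bd e ∈ Submodule.span ℚ (D.bd '' (B : Set ι))
    · have hj := D.joined_of_mem_span
        (Submodule.span_mono (image_mono (Finset.coe_subset.2 hBS)) hspan)
      obtain ⟨U, W, W', hU, hW, hW', hWU, hWU', hne⟩ :=
        exists_two_subfaces (D.K_closed S) (D.cont e) (D.inj e) hinc hj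
      rw [← D.K_insert] at hW hW'
      refine ⟨B, hBS.trans (Finset.subset_insert _ _), hB,
        (F.erase U).image s ∪ {W, W'}, ?_, ?_⟩
      · intro X hX
        simp only [Finset.mem_union, Finset.mem_image, Finset.mem_insert,
          Finset.mem_singleton] at hX
        rcases hX with ⟨Y, hY, rfl⟩ | rfl | rfl
        · exact hs Y (hF Y (Finset.mem_of_mem_erase hY))
        · exact hW
        · exact hW'
      · rw [Finset.card_union_of_disjoint, Finset.card_pair hne, Finset.card_image_of_injOn]
        · have := Finset.pred_card_le_card_erase (s := F) (a := U)
          omega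
        · exact hsinj.mono (Finset.coe_subset.2 (Finset.erase_subset _ _))
        · rw [Finset.disjoint_left]
          intro X hX hX'
          simp only [Finset.mem_image, Finset.mem_insert, Finset.mem_singleton] at hX hX'
          obtain ⟨Y, hY, rfl⟩ := hX
          have hYF := hF Y (Finset.mem_of_mem_erase hY)
          obtain ⟨x, hx⟩ := (hs Y hYF).nonempty
          have hxU : x ∈ U := by
            rcases hX' with h | h
            · rw [h] at hx; exact hWU hx
            · rw [h] at hx; exact hWU' hx
          exact Finset.ne_of_mem_erase hY (hYF.eq hU ⟨x, hsU Y hYF hx, hxU⟩)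
    · have heB : e ∉ B := fun h => he (hBS h)
      refine ⟨insert e B, Finset.insert_subset_insert _ hBS, ?_, F.image s, ?_, ?_⟩
      · rw [Finset.coe_insert]
        exact hB.insert hspan
      · intro X hX
        obtain ⟨Y, hY, rfl⟩ := Finset.mem_image.1 hX
        exact hs Y (hF Y hY)
      · rw [Finset.card_insert_of_notMem heB, Finset.card_image_of_injOn hsinj]
        omega

theorem unbounded_unique [Fintype ι] {S : Finset ι} {U W : Set ℂ} (hU : Face (D.K S) U)
    (hW : Face (D.K S) W) (hbU : ¬ Bornology.IsBounded U) (hbW : ¬ Bornology.IsBounded W) :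
    U = W := by
  obtain ⟨R, hR⟩ := (D.K_compact S).isBounded.subset_closedBall 0
  have hR' : D.K S ⊆ Metric.closedBall 0 (max R 0) :=
    hR.trans (Metric.closedBall_subset_closedBall (le_max_left _ _))
  have hcon := compl_closedBall_preconnected (0 : ℂ) (max R 0) (le_max_right _ _)
  have key : ∀ X, Face (D.K S) X → ¬ Bornology.IsBounded X →
      (Metric.closedBall (0 : ℂ) (max R 0))ᶜ ⊆ X := by
    intro X hX hb
    refine hX.max hcon (compl_subset_compl.2 hR') ?_
    by_contra h
    apply hb
    refine Metric.isBounded_closedBall.subset (s := X) (t := Metric.closedBall (0 : ℂ) (max R 0)) ?_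
    intro z hz
    by_contra hz'
    exact h ⟨z, hz', hz⟩
  have hne : ((Metric.closedBall (0 : ℂ) (max R 0))ᶜ).Nonempty := by
    rw [nonempty_compl]
    intro h
    apply NormedSpace.unbounded_univ ℝ ℂ
    rw [← h]
    exact Metric.isBounded_closedBall
  obtain ⟨x, hx⟩ := hne
  exact hU.eq hW ⟨x, key U hU hbU hx, key W hW hbW hx⟩

theorem euler_bounded [Fintype ι] : ∃ F : Finset (Set ℂ),
    (∀ U ∈ F, Face (D.K Finset.univ) U ∧ Bornology.IsBounded U) ∧
    Fintype.card ι ≤ D.ends.card + F.card := by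
  classical
  obtain ⟨B, -, hB, F, hF, hcard⟩ := D.euler Finset.univ
  refine ⟨F.filter Bornology.IsBounded, ?_, ?_⟩
  · intro U hU
    rw [Finset.mem_filter] at hU
    exact ⟨hF U hU.1, hU.2⟩
  · have h1 : B.card ≤ D.ends.card := by
      have := LinearIndependent.fintype_card_le_finrank hB
      simpa using this
    have h2 : (F.filter fun U => ¬ Bornology.IsBounded U).card ≤ 1 := by
      rw [Finset.card_le_one]
      intro U hU W hW
      rw [Finset.mem_filter] at hU hW
      exact D.unbounded_unique (hF U hU.1) (hF W hW.1) hU.2 hW.2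
    have h3 := Finset.card_filter_add_card_filter_not (s := F) (Bornology.IsBounded)
    rw [Finset.card_univ] at hcard
    omega

end Drawing
end PlanarArcs

namespace PlanarArcs

open Complex

namespace Drawing

variable {ι : Type} (D : Drawing ι)

open Classical in
/-- Arcs whose interior meets the closure of `U`. -/
noncomputable def inc [Fintype ι] (U : Set ℂ) : Finset ι :=
  Finset.univ.filter fun e => (closure U ∩ inner (D.γ e)).Nonempty

theorem mem_inc [Fintype ι] {U : Set ℂ} {e : ι} :
    e ∈ D.inc U ↔ (closure U ∩ inner (D.γ e)).Nonempty := by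
  simp [inc]

theorem face_inc [Fintype ι] {U : Set ℂ} (hU : Face (D.K Finset.univ) U) :
    Face (D.K (D.inc U)) U := by
  have hKc := D.K_closed Finset.univ
  have hIc := D.K_closed (D.inc U)
  have hUo := hU.isOpen hKc
  have hmono : D.K (D.inc U) ⊆ D.K Finset.univ := D.K_mono (Finset.subset_univ _)
  obtain ⟨x, hx⟩ := hU.nonempty
  have hxI : x ∈ (D.K (D.inc U))ᶜ := fun h => hU.subset hx (hmono h)
  have hC := face_of_mem hxI
  have hxC := mem_connectedComponentIn hxI
  set C := connectedComponentIn (D.K (D.inc U))ᶜ x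
  have hCo := hC.isOpen hIc
  have hUC : U ⊆ C := hC.max hU.isPreconnected
    (hU.subset.trans (compl_subset_compl.2 hmono)) ⟨x, hx, hxC⟩
  have hfr : ∀ w ∈ closure U, w ∈ C → w ∉ U → w ∈ D.V := by
    intro w hw hwC hwU
    have hwf : w ∈ frontier U := by
      rw [hUo.frontier_eq]; exact ⟨hw, hwU⟩
    obtain ⟨e, -, he⟩ := D.mem_K.1 (hU.frontier_subset hKc hwf)
    have he' := he
    rw [range_eq_inner] at he
    rcases he with he | rfl | rfl
    · exact absurd (D.range_subset_K (D.mem_inc.2 ⟨w, hw, he⟩) he') (hC.subset hwC)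
    · exact D.src e
    · exact D.tgt e
  have hCU : C ⊆ closure U := by
    have : C ⊆ interior (closure U) := by
      refine hC.isPreconnected.subset_of_closure_inter_subset isOpen_interior
        ⟨x, hxC, interior_mono subset_closure (by rwa [hUo.interior_eq])⟩ ?_
      rintro z ⟨hz, hzC⟩
      replace hz : z ∈ closure U := by
        have := closure_mono (interior_subset (s := closure U)) hz
        rwa [closure_closure] at this
      by_cases hzU : z ∈ U
      · exact interior_mono subset_closure (by rwa [hUo.interior_eq])
      have hopen : IsOpen (C \ ((D.V : Set ℂ) \ {z})) :=
        hCo.sdiff (D.V.finite_toSet.subset sdiff_subset).isClosed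
      obtain ⟨r, hr, hball⟩ := Metric.isOpen_iff.1 hopen z ⟨hzC, fun h => h.2 rfl⟩
      have hP : Metric.ball z r \ {z} ⊆ U := by
        refine (punctured_ball z r).subset_of_closure_inter_subset hUo ?_ ?_
        · obtain ⟨y, hy, hyU⟩ := mem_closure_iff.1 hz _ Metric.isOpen_ball (Metric.mem_ball_self hr)
          exact ⟨y, ⟨hy, by rintro rfl; exact hzU hyU⟩, hyU⟩
        · rintro w ⟨hw, hwb, hwz⟩
          by_contra hwU
          exact (hball hwb).2 ⟨hfr w hw (hball hwb).1 hwU, hwz⟩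
      refine mem_interior.2 ⟨Metric.ball z r, ?_, Metric.isOpen_ball, Metric.mem_ball_self hr⟩
      intro w hw
      by_cases hwz : w = z
      · rw [hwz]; exact hz
      · exact subset_closure (hP ⟨hw, hwz⟩)
    exact this.trans interior_subset
  have hCK : C ⊆ (D.K Finset.univ)ᶜ := by
    intro z hz hzK
    obtain ⟨e, -, he⟩ := D.mem_K.1 hzK
    obtain ⟨w, hwC, hw⟩ := mem_closure_iff.1 (range_subset_closure_inner (D.cont e) he) C hCo hz
    exact hC.subset hz (D.range_subset_K (D.mem_inc.2 ⟨w, hCU hwC, hw⟩) he)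
  have hCsub : C ⊆ U := hU.max hC.isPreconnected hCK ⟨x, hxC, hx⟩
  exact ⟨x, hxI, Subset.antisymm hUC hCsub⟩

theorem pair_subsingleton {e f : ι} (hef : e ≠ f)
    (h : ({D.γ e 0, D.γ e 1} : Set ℂ) ≠ {D.γ f 0, D.γ f 1}) :
    (range (D.γ e) ∩ range (D.γ f)).Subsingleton := by
  have key : ∀ z ∈ range (D.γ e) ∩ range (D.γ f),
      (z = D.γ e 0 ∨ z = D.γ e 1) ∧ (z = D.γ f 0 ∨ z = D.γ f 1) := by
    rintro z ⟨h1, h2⟩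
    have h1' := h1
    have h2' := h2
    rw [range_eq_inner] at h1' h2'
    constructor
    · rcases h1' with h1' | h1'
      · exact absurd h2 (Set.disjoint_left.1 (D.inner_disj_range hef) h1')
      · simpa using h1'
    · rcases h2' with h2' | h2'
      · exact absurd h1 (Set.disjoint_left.1 (D.inner_disj_range hef.symm) h2')
      · simpa using h2'
  intro z hz w hw
  by_contra hne
  apply h
  obtain ⟨a, b⟩ := key z hz
  obtain ⟨c, d⟩ := key w hw
  have h1 : ({D.γ e 0, D.γ e 1} : Set ℂ) = {z, w} := by
    rcases a with a | a <;> rcases c with c | c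
    · exact absurd (a.trans c.symm) hne
    · rw [a, c]
    · rw [a, c, pair_comm]
    · exact absurd (a.trans c.symm) hne
  have h2 : ({D.γ f 0, D.γ f 1} : Set ℂ) = {z, w} := by
    rcases b with a | a <;> rcases d with c | c
    · exact absurd (a.trans c.symm) hne
    · rw [a, c]
    · rw [a, c, pair_comm]
    · exact absurd (a.trans c.symm) hne
  rw [h1, h2]

/-- Every bounded component of two parallel arcs contains a vertex. -/
def Lensy : Prop := ∀ e f, e ≠ f → ({D.γ e 0, D.γ e 1} : Set ℂ) = {D.γ f 0, D.γ f 1} →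
  ∀ U, Face (range (D.γ e) ∪ range (D.γ f)) U → Bornology.IsBounded U → ∃ w ∈ D.V, w ∈ U

open Classical in
theorem three_le [Fintype ι] (hL : D.Lensy) {U : Set ℂ} (hU : Face (D.K Finset.univ) U)
    (hb : Bornology.IsBounded U) :
    3 ≤ (D.inc U).card + (D.V.filter (· ∈ U)).card := by
  have hF := D.face_inc hU
  by_contra hlt
  obtain h | h | h : (D.inc U).card = 0 ∨ (D.inc U).card = 1 ∨ (D.inc U).card = 2 := by omega
  · rw [Finset.card_eq_zero] at h
    rw [h] at hF
    have : (univ : Set ℂ) ⊆ U := by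
      refine hF.max isPreconnected_univ (by simp [K]) ?_
      rw [univ_inter]; exact hF.nonempty
    exact NormedSpace.unbounded_univ ℝ ℂ (hb.subset this)
  · obtain ⟨e, he⟩ := Finset.card_eq_one.1 h
    have hK : D.K {e} = range (D.γ e) := by simp [K]
    rw [he, hK] at hF
    exact face_one_arc (D.cont e) (D.inj e) hF hb
  · obtain ⟨e, f, hef, he⟩ := Finset.card_eq_two.1 h
    have hK : D.K {e, f} = range (D.γ e) ∪ range (D.γ f) := by
      ext z; simp [mem_K]
    rw [he, hK] at hF
    by_cases heq : ({D.γ e 0, D.γ e 1} : Set ℂ) = {D.γ f 0, D.γ f 1}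
    · obtain ⟨w, hw, hwU⟩ := hL e f hef heq U hF hb
      have : 0 < (D.V.filter (· ∈ U)).card :=
        Finset.card_pos.2 ⟨w, Finset.mem_filter.2 ⟨hw, hwU⟩⟩
      omega
    · exact face_two_arcs (D.cont e) (D.inj e) (D.cont f) (D.inj f)
        (D.pair_subsingleton hef heq) hF hb

open Classical in
theorem inc_le_two [Fintype ι] (F : Finset (Set ℂ))
    (hF : ∀ U ∈ F, Face (D.K Finset.univ) U ∧ Bornology.IsBounded U) (e : ι) :
    (F.filter fun U => e ∈ D.inc U).card ≤ 2 := by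
  by_contra hlt
  rw [not_le, Finset.two_lt_card] at hlt
  obtain ⟨a, ha, b, hb, c, hc, hab, hac, hbc⟩ := hlt
  rw [Finset.mem_filter] at ha hb hc
  have hK : (D.K (Finset.univ.erase e) ∪ {D.γ e 0, D.γ e 1}) ∪ range (D.γ e) =
      D.K Finset.univ := by
    have h1 : ({D.γ e 0, D.γ e 1} : Set ℂ) ⊆ range (D.γ e) := by
      rintro z (rfl | rfl)
      exacts [⟨0, rfl⟩, ⟨1, rfl⟩]
    rw [union_assoc, union_eq_self_of_subset_left h1, ← D.K_insert,
      Finset.insert_erase (Finset.mem_univ e)]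
  refine no_three_faces (K := D.K (Finset.univ.erase e) ∪ {D.γ e 0, D.γ e 1}) (γ := D.γ e)
    (U := ![a, b, c]) ((D.K_closed _).union (Set.toFinite _).isClosed) (D.cont e) (D.inj e) ?_
    (by simp) (by simp) ?_ ?_ ?_ ?_
  · rintro z hz (h | h | h)
    · exact D.inner_subset_compl (Finset.notMem_erase e _) hz h
    · exact D.avoid e z hz (h ▸ D.src e)
    · exact D.avoid e z hz (h ▸ D.tgt e)
  · rw [hK]
    intro i
    fin_cases i
    exacts [(hF a ha.1).1, (hF b hb.1).1, (hF c hc.1).1]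
  · intro i j hij
    fin_cases i <;> fin_cases j <;> simp_all
  · intro i
    fin_cases i
    exacts [(hF a ha.1).2, (hF b hb.1).2, (hF c hc.1).2]
  · intro i
    fin_cases i
    exacts [D.mem_inc.1 ha.2, D.mem_inc.1 hb.2, D.mem_inc.1 hc.2]

theorem card_le [Fintype ι] (hL : D.Lensy) : Fintype.card ι ≤ 3 * D.V.card := by
  classical
  obtain ⟨F, hF, hE⟩ := D.euler_bounded
  have h1 : F.card * 3 ≤ ∑ U ∈ F, ((D.inc U).card + (D.V.filter (· ∈ U)).card) := by
    rw [← smul_eq_mul]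
    exact Finset.card_nsmul_le_sum _ _ _ fun U hU => D.three_le hL (hF U hU).1 (hF U hU).2
  rw [Finset.sum_add_distrib] at h1
  have h2 : ∑ U ∈ F, (D.inc U).card ≤ Fintype.card ι * 2 := by
    have := Finset.sum_card_bipartiteAbove_eq_sum_card_bipartiteBelow
      (s := F) (t := (Finset.univ : Finset ι)) (fun U e => e ∈ D.inc U)
    simp only [Finset.bipartiteAbove, Finset.bipartiteBelow] at this
    have h' : ∀ U, (Finset.univ.filter fun e => e ∈ D.inc U) = D.inc U := by
      intro U; ext e; simp
    simp only [h'] at this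
    rw [this, ← smul_eq_mul]
    exact Finset.sum_le_card_nsmul _ _ _ fun e _ => D.inc_le_two F hF e
  have h3 : ∑ U ∈ F, (D.V.filter (· ∈ U)).card ≤ (D.V \ D.ends).card := by
    rw [← Finset.card_biUnion]
    · apply Finset.card_le_card
      intro z hz
      rw [Finset.mem_biUnion] at hz
      obtain ⟨U, hU, hz⟩ := hz
      rw [Finset.mem_filter] at hz
      exact Finset.mem_sdiff.2 ⟨hz.1, fun h => (hF U hU).1.subset hz.2 (D.ends_K h)⟩
    · intro U hU W hW hne
      rw [Function.onFun, Finset.disjoint_left]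
      intro z hz hz'
      rw [Finset.mem_filter] at hz hz'
      exact hne ((hF U hU).1.eq (hF W hW).1 ⟨z, hz.2, hz'.2⟩)
  have h4 := Finset.card_sdiff_add_card_eq_card D.ends_subset
  omega

end Drawing
end PlanarArcs


namespace PlanarArcs

theorem interior_arcs_empty {κ : Type} (γ : κ → unitInterval → ℂ) (hc : ∀ e, Continuous (γ e))
    (hi : ∀ e, Function.Injective (γ e)) (S : Finset κ) :
    interior (⋃ e ∈ S, range (γ e)) = ∅ := by
  classical
  induction S using Finset.induction_on with
  | empty => simp
  | insert e S he ih =>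
    rw [Finset.set_biUnion_insert, union_comm,
      interior_union_isClosed_of_interior_empty _ (arc_interior_empty (hc e) (hi e)), ih]
    exact (S.isCompact_biUnion fun e _ => isCompact_range (hc e)).isClosed

/-- The plane as `ℂ`. -/
noncomputable def toC : ℝ × ℝ ≃ₜ ℂ := Complex.equivRealProdCLM.symm.toHomeomorph

theorem toC_symm_bounded {s : Set ℂ} (hs : Bornology.IsBounded s) :
    Bornology.IsBounded (toC.symm '' s) :=
  (Complex.equivRealProdCLM.lipschitz).isBounded_image hs

theorem inner_toC (G : TopMultigraph) (e : G.ι) :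
    inner (fun t => toC (G.arc e t)) = toC '' G.arcInterior e := by
  rw [inner, TopMultigraph.arcInterior, image_image]

/-- The drawing given by a noncrossing set of edges. -/
noncomputable def sub (G : TopMultigraph) (R : Set G.ι)
    (hR : ∀ e ∈ R, ∀ f ∈ R, e ≠ f → ¬ G.Cross e f) : Drawing R where
  γ e t := toC (G.arc e t)
  V := G.V.map toC.toEquiv.toEmbedding
  cont e := toC.continuous.comp (G.continuous_arc e)
  inj e := toC.injective.comp (G.injective_arc e)
  src e := Finset.mem_map_of_mem _ (G.source_mem e)
  tgt e := Finset.mem_map_of_mem _ (G.target_mem e)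
  avoid e := by
    rintro z ⟨t, ⟨h0, h1⟩, rfl⟩ hz
    obtain ⟨w, hw, hwe⟩ := Finset.mem_map.1 hz
    have : w = G.arc e t := toC.injective hwe
    exact G.interior_avoids e t h0 h1 (this ▸ hw)
  disj e f hef := by
    rw [inner_toC, inner_toC, disjoint_image_iff toC.injective, Set.disjoint_iff_inter_eq_empty,
      ← Set.not_nonempty_iff_eq_empty]
    exact hR e e.2 f f.2 fun h => hef (Subtype.ext h)

theorem sub_lensy (G : TopMultigraph) (hsep : G.Separated) (R : Set G.ι)
    (hR : ∀ e ∈ R, ∀ f ∈ R, e ≠ f → ¬ G.Cross e f) : (sub G R hR).Lensy := by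
  classical
  intro e f hef hends U hU hb
  have hpar : G.endpoints f = G.endpoints e := by
    have h : toC '' G.endpoints e = toC '' G.endpoints f := by
      rw [TopMultigraph.endpoints, TopMultigraph.endpoints, image_pair, image_pair]
      exact hends
    exact (toC.injective.image_injective h).symm
  set u := G.arc e 0 with hu
  set v := G.arc e 1 with hv
  have hJe : G.Joins e u v := rfl
  have hJf : G.Joins f u v := hpar
  have hTim : toC '' G.pairUnion u v =
      ⋃ g ∈ Finset.univ.filter (fun g => G.Joins g u v), range (fun t => toC (G.arc g t)) := by
    rw [TopMultigraph.pairUnion, image_iUnion₂]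
    ext z
    simp only [mem_iUnion, Finset.mem_filter, Finset.mem_univ, true_and, mem_image, mem_range,
      exists_exists_eq_and, mem_setOf_eq]
  have hempty : interior (toC '' G.pairUnion u v) = ∅ := by
    rw [hTim]
    exact interior_arcs_empty _ (fun g => toC.continuous.comp (G.continuous_arc g))
      (fun g => toC.injective.comp (G.injective_arc g)) _
  have hsubT : ∀ g, G.Joins g u v → range (fun t => toC (G.arc g t)) ⊆
      toC '' G.pairUnion u v := by
    rintro g hg _ ⟨t, rfl⟩
    exact mem_image_of_mem _ (mem_biUnion (x := g) hg ⟨t, rfl⟩)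
  have hUo : IsOpen U := hU.isOpen
    ((isCompact_range ((sub G R hR).cont e)).isClosed.union
      (isCompact_range ((sub G R hR).cont f)).isClosed)
  have hnot : ¬ U ⊆ toC '' G.pairUnion u v := by
    intro h
    have := interior_maximal h hUo
    rw [hempty] at this
    obtain ⟨x, hx⟩ := hU.nonempty
    exact this hx
  obtain ⟨x, hxU, hxT⟩ := not_subset.1 hnot
  obtain ⟨y, rfl⟩ := toC.surjective x
  have hy : y ∈ (G.pairUnion u v)ᶜ := fun h => hxT (mem_image_of_mem _ h)
  have hℓU : toC '' connectedComponentIn (G.pairUnion u v)ᶜ y ⊆ U := by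
    refine hU.max (isPreconnected_connectedComponentIn.image _ toC.continuous.continuousOn) ?_
      ⟨_, mem_image_of_mem _ (mem_connectedComponentIn hy), hxU⟩
    rintro _ ⟨w, hw, rfl⟩ hw'
    have hw2 : toC w ∈ toC '' G.pairUnion u v := by
      rcases hw' with h | h
      · exact hsubT e hJe h
      · exact hsubT f hJf h
    rw [toC.injective.mem_set_image] at hw2
    exact connectedComponentIn_subset _ _ hw hw2
  have hℓb : Bornology.IsBounded (connectedComponentIn (G.pairUnion u v)ᶜ y) := by
    have := toC_symm_bounded (hb.subset hℓU)
    rwa [image_image, show (fun x => toC.symm (toC x)) = id by ext x <;> simp, image_id] at this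
  obtain ⟨w, hw, hwℓ⟩ := hsep.2 _ ⟨u, v, G.ends_ne e, ⟨e, hJe⟩, fun a b ha hb' hab =>
    hsep.1 a b ⟨hab, ha.trans hb'.symm⟩, hℓb, y, hy, rfl⟩
  exact ⟨toC w, Finset.mem_map_of_mem _ hw, hℓU (mem_image_of_mem _ hwℓ)⟩

end PlanarArcs

/-- Every separated single-crossing topological multigraph with `n` vertices and `e` edges has
at least `e - 3n` crossings. -/
theorem crossingNumber_ge_sub (G : TopMultigraph)
    (hsc : G.SingleCrossing) (hsep : G.Separated) :
    (G.edgeCount : ℤ) - 3 * (G.V.card : ℤ) ≤ (G.crossingNumber : ℤ) := by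
  classical
  let P := {p : Sym2 G.ι // ¬ p.IsDiag ∧ ∀ e ∈ p, ∀ f ∈ p, e ≠ f → G.Cross e f}
  have hex : ∀ p : P, ∃ a, a ∈ p.1 := fun p => ⟨_, Sym2.out_fst_mem p.1⟩
  choose a ha using hex
  let R : Set G.ι := (range a)ᶜ
  have hR : ∀ e ∈ R, ∀ f ∈ R, e ≠ f → ¬ G.Cross e f := by
    intro e he f hf hef hcr
    have hcr' : G.Cross f e := by
      unfold TopMultigraph.Cross at hcr ⊢
      rwa [inter_comm]
    let p : P := ⟨s(e, f), by simpa using hef, by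
      intro x hx y hy hxy
      rw [Sym2.mem_iff] at hx hy
      rcases hx with rfl | rfl <;> rcases hy with rfl | rfl
      · exact absurd rfl hxy
      · exact hcr
      · exact hcr'
      · exact absurd rfl hxy⟩
    have hp : a p = e ∨ a p = f := Sym2.mem_iff.1 (ha p)
    rcases hp with hp | hp
    · exact he ⟨p, hp⟩
    · exact hf ⟨p, hp⟩
  have h1 := (PlanarArcs.sub G R hR).card_le (PlanarArcs.sub_lensy G hsep R hR)
  have h2 : (PlanarArcs.sub G R hR).V.card = G.V.card := Finset.card_map _
  rw [h2, ← Nat.card_eq_fintype_card] at h1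
  have h3 : (range a).ncard ≤ G.crossingNumber := by
    have : Nat.card (range a) ≤ Nat.card P :=
      Nat.card_le_card_of_surjective (rangeFactorization a) rangeFactorization_surjective
    exact this
  have h4 : (range a).ncard + Nat.card R = G.edgeCount := Set.ncard_add_ncard_compl (range a)
  omega
end
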